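/- Let W = {W_x}_{x∈𝒳} be a classical-quantum channel with outputs on a finite-dimensional Hilbert space B and let r > 0. Then the limit lim_{n→∞} −(1/n) log(1 − ε^NS(W^⊗n, e^{nr})) exists and equals sup_{1/2 ≤ α ≤ 1} ((1−α)/α)·(Ĩ_α(W) − r). -/

import Mathlib

noncomputable section
open scoped BigOperators
open Classical
open scoped ComplexOrder

namespace ChannelSim

/-! ### Classical definitions -/

/-- A probability distribution on a finite type. -/
def IsProbDist {Y : Type*} [Fintype Y] (p : Y → ℝ) : Prop :=
  (∀ y, 0 ≤ p y) ∧ ∑ y, p y = 1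

/-- A classical channel: a stochastic matrix, i.e. each row is a probability distribution. -/
def IsChannel {X Y : Type*} [Fintype Y] (W : X → Y → ℝ) : Prop :=
  ∀ x, IsProbDist (W x)

/-- The `n`-fold product channel `W^{⊗n}`. -/
def prodChannel {X Y : Type*} (W : X → Y → ℝ) (n : ℕ) :
    (Fin n → X) → (Fin n → Y) → ℝ :=
  fun xs ys => ∏ i, W (xs i) (ys i)

/-- The `n`-fold product distribution `q^{⊗n}`. -/
def prodDist {Y : Type*} (q : Y → ℝ) (n : ℕ) : (Fin n → Y) → ℝ :=
  fun ys => ∏ i, q (ys i)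

/-- Fidelity of probability distributions on a finite type. -/
def cFid {Y : Type*} [Fintype Y] (p q : Y → ℝ) : ℝ :=
  (∑ y, Real.sqrt (p y * q y)) ^ 2

/-- Purified distance of probability distributions on a finite type. -/
def cPD {Y : Type*} [Fintype Y] (p q : Y → ℝ) : ℝ :=
  Real.sqrt (1 - cFid p q)

/-- Non-signaling simulation error of a classical channel with communication size `M`. -/
def cEpsNS {X Y : Type*} [Fintype X] [Fintype Y] (W : X → Y → ℝ) (M : ℝ) : ℝ :=
  sInf { e : ℝ | ∃ (W' : X → Y → ℝ) (q : Y → ℝ), IsChannel W' ∧ IsProbDist q ∧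
    (∀ x y, W' x y ≤ M * q y) ∧ e = ⨆ x, cPD (W x) (W' x) }

/-- Shared-randomness simulation error of a classical channel with communication size `M`. -/
def cEpsSR {X Y : Type*} [Fintype X] [Fintype Y] (W : X → Y → ℝ) (M : ℝ) : ℝ :=
  sInf { e : ℝ | ∃ (k m : ℕ) (pS : Fin k → ℝ) (Enc : X → Fin k → Fin m → ℝ)
    (Dec : Fin m → Fin k → Y → ℝ),
    IsProbDist pS ∧ (∀ x s, IsProbDist (Enc x s)) ∧ (∀ i s, IsProbDist (Dec i s)) ∧
    (m : ℝ) ≤ M ∧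
    e = ⨆ x, cPD (W x) (fun y => ∑ s, pS s * ∑ i, Enc x s i * Dec i s y) }

/-- Classical Rényi divergence of order `α > 0`, with values in the extended reals:
the Kullback–Leibler divergence at `α = 1`, and `+∞` whenever `α > 1` (or `α = 1`)
and the support of `p` is not contained in that of `q`. -/
def cRenyiD {Y : Type*} [Fintype Y] (α : ℝ) (p q : Y → ℝ) : EReal :=
  if α = 1 then
    (if ∀ y, q y = 0 → p y = 0 then
      ((∑ y, p y * Real.log (p y / q y) : ℝ) : EReal) else (⊤ : EReal))
  else if 1 < α ∧ ¬ (∀ y, q y = 0 → p y = 0) then (⊤ : EReal)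
  else (((α - 1)⁻¹ * Real.log (∑ y, p y ^ α * q y ^ (1 - α)) : ℝ) : EReal)

/-- Rényi mutual information `I_α(W) = inf_q sup_x D_α(W(·|x)‖q)` of a classical channel. -/
def cRenyiMI {X Y : Type*} [Fintype X] [Fintype Y] (α : ℝ) (W : X → Y → ℝ) : EReal :=
  ⨅ q : {q : Y → ℝ // IsProbDist q}, ⨆ x, cRenyiD α (W x) q.1

/-- Kullback–Leibler divergence (real-valued formula, valid on matching supports). -/
def cKL {Y : Type*} [Fintype Y] (p q : Y → ℝ) : ℝ :=
  ∑ y, p y * Real.log (p y / q y)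

/-- Relative-entropy variance (real-valued formula, valid on matching supports). -/
def cVar {Y : Type*} [Fintype Y] (p q : Y → ℝ) : ℝ :=
  (∑ y, p y * (Real.log (p y / q y)) ^ 2) - (cKL p q) ^ 2

/-- The empirical type of a word `xs ∈ X^n`. -/
def empType {X : Type*} [Fintype X] {n : ℕ} (xs : Fin n → X) : X → ℝ :=
  fun x => (Finset.univ.filter fun i => xs i = x).card / n

/-! ### Quantum definitions -/

/-- A density matrix: positive semidefinite with unit trace. -/
def IsDensity {n : Type*} [Fintype n] [DecidableEq n] (ρ : Matrix n n ℂ) : Prop :=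
  ρ.PosSemidef ∧ ρ.trace = 1

/-- Functional calculus for Hermitian matrices (junk value `0` on non-Hermitian input). -/
def matFun {n : Type*} [Fintype n] [DecidableEq n] (f : ℝ → ℝ) (A : Matrix n n ℂ) :
    Matrix n n ℂ :=
  if hA : A.IsHermitian then
    (hA.eigenvectorUnitary : Matrix n n ℂ) *
      Matrix.diagonal (fun i => ((f (hA.eigenvalues i)) : ℂ)) *
      (star (hA.eigenvectorUnitary : Matrix n n ℂ))
  else 0

/-- Fidelity of density matrices: `F(ρ,σ) = (Tr √(√ρ σ √ρ))²`. -/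
def qFid {n : Type*} [Fintype n] [DecidableEq n] (ρ σ : Matrix n n ℂ) : ℝ :=
  ((matFun Real.sqrt (matFun Real.sqrt ρ * σ * matFun Real.sqrt ρ)).trace).re ^ 2

/-- Purified distance of density matrices. -/
def qPD {n : Type*} [Fintype n] [DecidableEq n] (ρ σ : Matrix n n ℂ) : ℝ :=
  Real.sqrt (1 - qFid ρ σ)

/-- Non-signaling simulation error of a classical-quantum channel with communication size `M`. -/
def qEpsNS {X B : Type*} [Fintype X] [Fintype B] [DecidableEq B]
    (W : X → Matrix B B ℂ) (M : ℝ) : ℝ :=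
  sInf { e : ℝ | ∃ (W' : X → Matrix B B ℂ) (σ : Matrix B B ℂ),
    (∀ x, IsDensity (W' x)) ∧ IsDensity σ ∧ (∀ x, (M • σ - W' x).PosSemidef) ∧
    e = ⨆ x, qPD (W x) (W' x) }

/-- Support inclusion `supp ρ ⊆ supp σ` for positive semidefinite matrices, expressed
via kernels: every vector killed by `σ` is killed by `ρ`. -/
def suppLE {n : Type*} [Fintype n] (ρ σ : Matrix n n ℂ) : Prop :=
  ∀ v, σ.mulVec v = 0 → ρ.mulVec v = 0

/-- Umegaki relative entropy `D(ρ‖σ) = Tr ρ (log ρ − log σ)` (logarithms on supports;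
real-valued formula, valid when `supp ρ ⊆ supp σ`). -/
def relEntQ {n : Type*} [Fintype n] [DecidableEq n] (ρ σ : Matrix n n ℂ) : ℝ :=
  ((ρ * (matFun Real.log ρ - matFun Real.log σ)).trace).re

/-- Quantum relative-entropy variance `Tr ρ (log ρ − log σ)² − D(ρ‖σ)²`. -/
def varQ {n : Type*} [Fintype n] [DecidableEq n] (ρ σ : Matrix n n ℂ) : ℝ :=
  ((ρ * (matFun Real.log ρ - matFun Real.log σ) ^ 2).trace).re - (relEntQ ρ σ) ^ 2

/-- Sandwiched Rényi divergence of order `α`, valued in the extended reals: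
`D̃_α(ρ‖σ) = (α−1)⁻¹ log Tr (σ^{(1−α)/(2α)} ρ σ^{(1−α)/(2α)})^α`, with the Umegaki relative
entropy at `α = 1`, and `+∞` when `α ≥ 1` and `supp ρ ⊄ supp σ`, or `α < 1` and `ρσ = 0`. -/
def sandD {n : Type*} [Fintype n] [DecidableEq n] (α : ℝ) (ρ σ : Matrix n n ℂ) : EReal :=
  if α = 1 then (if suppLE ρ σ then ((relEntQ ρ σ : ℝ) : EReal) else (⊤ : EReal))
  else if (1 < α ∧ ¬ suppLE ρ σ) ∨ (α < 1 ∧ ρ * σ = 0) then (⊤ : EReal)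
  else (((α - 1)⁻¹ * Real.log
      (((matFun (fun t => t ^ α)
        (matFun (fun t => t ^ ((1 - α) / (2 * α))) σ * ρ *
          matFun (fun t => t ^ ((1 - α) / (2 * α))) σ)).trace).re) : ℝ) : EReal)

/-- Sandwiched Rényi mutual information `Ĩ_α(W) = inf_σ sup_x D̃_α(W_x‖σ)` of a CQ channel. -/
def sandMI {X B : Type*} [Fintype X] [Fintype B] [DecidableEq B]
    (α : ℝ) (W : X → Matrix B B ℂ) : EReal :=
  ⨅ σ : {σ : Matrix B B ℂ // IsDensity σ}, ⨆ x, sandD α (W x) σ.1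

/-- `n`-fold tensor power `ρ^{⊗n}` of a matrix, realized on the index set `Fin n → B`. -/
def tensPow {B : Type*} (ρ : Matrix B B ℂ) (n : ℕ) :
    Matrix (Fin n → B) (Fin n → B) ℂ :=
  Matrix.of fun a b => ∏ i, ρ (a i) (b i)

/-- Tensor product `V_1 ⊗ ⋯ ⊗ V_k` of a family of matrices. -/
def tensProd {B : Type*} {k : ℕ} (V : Fin k → Matrix B B ℂ) :
    Matrix (Fin k → B) (Fin k → B) ℂ :=
  Matrix.of fun a b => ∏ i, V i (a i) (b i)

/-- The `n`-fold product CQ channel `W^{⊗n}`. -/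
def cqPow {X B : Type*} (W : X → Matrix B B ℂ) (n : ℕ) :
    (Fin n → X) → Matrix (Fin n → B) (Fin n → B) ℂ :=
  fun xs => Matrix.of fun a b => ∏ i, W (xs i) (a i) (b i)

/-- Minimal positive eigenvalue of a Hermitian matrix (junk value `0` otherwise). -/
def minPosEig {n : Type*} [Fintype n] [DecidableEq n] (A : Matrix n n ℂ) : ℝ :=
  if hA : A.IsHermitian then sInf {t : ℝ | 0 < t ∧ ∃ i, hA.eigenvalues i = t} else 0

/-- Extended-real exponential, sending `⊥ = −∞` to `0`. -/
def expE (x : EReal) : ℝ := if x = ⊥ then 0 else Real.exp x.toReal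


/-- The joint classical–quantum state `W∘p = Σ_x p(x) |x⟩⟨x| ⊗ W_x` as a block-diagonal
matrix on `ℂ^{|X|} ⊗ B`. -/
def cqJoint {X B : Type*} [DecidableEq X] (p : X → ℝ) (W : X → Matrix B B ℂ) :
    Matrix (X × B) (X × B) ℂ :=
  Matrix.of fun a b => if a.1 = b.1 then (p a.1 : ℂ) * W a.1 a.2 b.2 else 0

end ChannelSim

set_option linter.unusedSectionVars false

namespace ChannelSim

/-! ### Spectral toolkit -/

section Spectral

variable {n : Type*} [Fintype n] [DecidableEq n]

/-- The Hermitian matrix with eigenvector unitary `U` and eigenvalues `a`. -/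
def specMat (U : Matrix.unitaryGroup n ℂ) (a : n → ℝ) : Matrix n n ℂ :=
  (U : Matrix n n ℂ) * Matrix.diagonal (fun i => (a i : ℂ)) * star (U : Matrix n n ℂ)

/-- Real part of the trace. -/
def rtr {m : Type*} [Fintype m] (A : Matrix m m ℂ) : ℝ := A.trace.re

theorem star_mul_self_unitary (U : Matrix.unitaryGroup n ℂ) :
    star (U : Matrix n n ℂ) * (U : Matrix n n ℂ) = 1 := Unitary.coe_star_mul_self U

theorem self_mul_star_unitary (U : Matrix.unitaryGroup n ℂ) :
    (U : Matrix n n ℂ) * star (U : Matrix n n ℂ) = 1 := Unitary.coe_mul_star_self U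

theorem specMat_isHermitian (U : Matrix.unitaryGroup n ℂ) (a : n → ℝ) :
    (specMat U a).IsHermitian := by
  unfold specMat
  rw [Matrix.star_eq_conjTranspose]
  apply Matrix.isHermitian_mul_mul_conjTranspose
  rw [Matrix.IsHermitian, Matrix.diagonal_conjTranspose]
  congr 1
  ext i
  simp

theorem exists_specMat {A : Matrix n n ℂ} (hA : A.IsHermitian) :
    ∃ U a, A = specMat U a := by
  refine ⟨hA.eigenvectorUnitary, hA.eigenvalues, ?_⟩
  have := hA.spectral_theorem
  rw [Unitary.conjStarAlgAut_apply] at this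
  exact this

theorem matFun_specMat (f : ℝ → ℝ) (U : Matrix.unitaryGroup n ℂ) (a : n → ℝ) :
    matFun f (specMat U a) = specMat U (fun i => f (a i)) := by
  have hA := specMat_isHermitian U a
  have key : ∀ (V : Matrix.unitaryGroup n ℂ) (b : n → ℝ), specMat U a = specMat V b →
      specMat V (fun i => f (b i)) = specMat U (fun i => f (a i)) := by
    intro V b h
    set M : Matrix n n ℂ := star (U : Matrix n n ℂ) * (V : Matrix n n ℂ) with hM
    have h1 : Matrix.diagonal (fun i => (a i : ℂ)) * M
        = M * Matrix.diagonal (fun i => (b i : ℂ)) := by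
      have : star (U : Matrix n n ℂ) * specMat U a * V = star (U : Matrix n n ℂ) * specMat V b * V := by
        rw [h]
      unfold specMat at this
      calc _ = star (U : Matrix n n ℂ) * U * Matrix.diagonal (fun i => (a i : ℂ)) * M := by
            rw [star_mul_self_unitary, one_mul]
        _ = star (U : Matrix n n ℂ) * (V : Matrix n n ℂ) * Matrix.diagonal (fun i => (b i : ℂ)) *
              (star (V : Matrix n n ℂ) * V) := by
            rw [hM]; simp only [Matrix.mul_assoc] at this ⊢; exact this
        _ = _ := by rw [star_mul_self_unitary, mul_one]
    have h2 : Matrix.diagonal (fun i => (f (a i) : ℂ)) * M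
        = M * Matrix.diagonal (fun i => (f (b i) : ℂ)) := by
      ext i j
      have h3 := congrFun (congrFun h1 i) j
      rw [Matrix.diagonal_mul, Matrix.mul_diagonal] at h3 ⊢
      by_cases hm : M i j = 0
      · simp [hm]
      · rw [mul_comm] at h3
        have := mul_left_cancel₀ hm h3
        have : a i = b j := by exact_mod_cast this
        rw [this, mul_comm]
    calc specMat V (fun i => f (b i))
        = (U : Matrix n n ℂ) * (M * Matrix.diagonal (fun i => (f (b i) : ℂ))) * star (V : Matrix n n ℂ) := by
          rw [hM, specMat]
          simp only [← Matrix.mul_assoc]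
          rw [self_mul_star_unitary, one_mul]
      _ = _ := by
          rw [← h2, hM, specMat]
          simp only [Matrix.mul_assoc]
          rw [self_mul_star_unitary, mul_one]
  have h4 := hA.spectral_theorem
  rw [Unitary.conjStarAlgAut_apply] at h4
  rw [matFun, dif_pos hA]
  exact key hA.eigenvectorUnitary hA.eigenvalues h4

theorem specMat_mul (U : Matrix.unitaryGroup n ℂ) (a b : n → ℝ) :
    specMat U a * specMat U b = specMat U (fun i => a i * b i) := by
  unfold specMat
  calc _ = (U : Matrix n n ℂ) * (Matrix.diagonal (fun i => (a i : ℂ)) *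
        (star (U : Matrix n n ℂ) * U) * Matrix.diagonal (fun i => (b i : ℂ))) *
        star (U : Matrix n n ℂ) := by simp only [Matrix.mul_assoc]
    _ = _ := by
      rw [star_mul_self_unitary, mul_one, Matrix.diagonal_mul_diagonal]
      push_cast; rfl

theorem specMat_sub (U : Matrix.unitaryGroup n ℂ) (a b : n → ℝ) :
    specMat U a - specMat U b = specMat U (fun i => a i - b i) := by
  unfold specMat
  rw [← Matrix.sub_mul, ← Matrix.mul_sub, Matrix.diagonal_sub]
  push_cast; rfl

theorem specMat_smul (U : Matrix.unitaryGroup n ℂ) (c : ℝ) (a : n → ℝ) :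
    c • specMat U a = specMat U (fun i => c * a i) := by
  unfold specMat
  rw [← Matrix.smul_mul, ← Matrix.mul_smul, ← Matrix.diagonal_smul]
  congr 3
  ext i
  simp

theorem specMat_one (U : Matrix.unitaryGroup n ℂ) : specMat U (fun _ => 1) = 1 := by
  unfold specMat
  simp

theorem specMat_const (U : Matrix.unitaryGroup n ℂ) (c : ℝ) :
    specMat U (fun _ => c) = c • (1 : Matrix n n ℂ) := by
  rw [← specMat_one U, specMat_smul]; simp

theorem trace_specMat (U : Matrix.unitaryGroup n ℂ) (a : n → ℝ) :
    (specMat U a).trace = ((∑ i, a i : ℝ) : ℂ) := by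
  unfold specMat
  rw [Matrix.trace_mul_comm, ← Matrix.mul_assoc, star_mul_self_unitary, one_mul,
    Matrix.trace_diagonal]
  push_cast; rfl

theorem rtr_specMat (U : Matrix.unitaryGroup n ℂ) (a : n → ℝ) :
    rtr (specMat U a) = ∑ i, a i := by
  rw [rtr, trace_specMat, Complex.ofReal_re]

theorem specMat_posSemidef (U : Matrix.unitaryGroup n ℂ) {a : n → ℝ} (ha : ∀ i, 0 ≤ a i) :
    (specMat U a).PosSemidef := by
  unfold specMat
  rw [Matrix.star_eq_conjTranspose]
  apply Matrix.PosSemidef.mul_mul_conjTranspose_same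
  apply Matrix.PosSemidef.diagonal
  intro i
  simpa using ha i

theorem specMat_posSemidef_iff (U : Matrix.unitaryGroup n ℂ) {a : n → ℝ} :
    (specMat U a).PosSemidef ↔ ∀ i, 0 ≤ a i := by
  refine ⟨fun h => ?_, specMat_posSemidef U⟩
  have h1 := h.conjTranspose_mul_mul_same (U : Matrix n n ℂ)
  have h2 : (U : Matrix n n ℂ).conjTranspose * specMat U a * U
      = Matrix.diagonal (fun i => (a i : ℂ)) := by
    unfold specMat
    rw [← Matrix.star_eq_conjTranspose]
    calc _ = (star (U : Matrix n n ℂ) * U) * Matrix.diagonal (fun i => (a i : ℂ)) *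
        (star (U : Matrix n n ℂ) * U) := by simp only [Matrix.mul_assoc]
      _ = _ := by rw [star_mul_self_unitary, mul_one, one_mul]
  rw [h2, Matrix.posSemidef_diagonal_iff] at h1
  intro i
  simpa using h1 i

theorem specMat_posDef_iff (U : Matrix.unitaryGroup n ℂ) {a : n → ℝ} :
    (specMat U a).PosDef ↔ ∀ i, 0 < a i := by
  unfold specMat
  rw [Matrix.IsUnit.posDef_star_right_conjugate_iff (Unitary.isUnit_coe (U := U)), Matrix.posDef_diagonal_iff]
  simp

theorem exists_specMat_nonneg {A : Matrix n n ℂ} (hA : A.PosSemidef) :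
    ∃ U a, A = specMat U a ∧ ∀ i, 0 ≤ a i := by
  obtain ⟨U, a, rfl⟩ := exists_specMat hA.1
  exact ⟨U, a, rfl, (specMat_posSemidef_iff U).1 hA⟩

theorem exists_specMat_pos {A : Matrix n n ℂ} (hA : A.PosDef) :
    ∃ U a, A = specMat U a ∧ ∀ i, 0 < a i := by
  obtain ⟨U, a, rfl⟩ := exists_specMat hA.1
  exact ⟨U, a, rfl, (specMat_posDef_iff U).1 hA⟩

theorem trace_mul_specMat {m : Type*} [Fintype m] [DecidableEq m]
    (C : Matrix n m ℂ) (V : Matrix.unitaryGroup m ℂ) (b : m → ℝ)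
    (U : Matrix.unitaryGroup n ℂ) (a : n → ℝ) :
    rtr (C * specMat V b * C.conjTranspose * specMat U a) =
      ∑ i, ∑ j, Complex.normSq ((star (U : Matrix n n ℂ) * C * (V : Matrix m m ℂ)) i j)
        * (b j * a i) := by
  set M : Matrix n m ℂ := star (U : Matrix n n ℂ) * C * (V : Matrix m m ℂ) with hM
  have h1 : (C * specMat V b * C.conjTranspose * specMat U a).trace =
      (M * Matrix.diagonal (fun i => (b i : ℂ)) * M.conjTranspose *
        Matrix.diagonal (fun i => (a i : ℂ))).trace := by
    unfold specMat
    rw [hM, ← Matrix.mul_assoc, Matrix.trace_mul_comm]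
    simp only [Matrix.conjTranspose_mul, Matrix.star_eq_conjTranspose,
      Matrix.conjTranspose_conjTranspose, Matrix.mul_assoc]
  rw [rtr, h1, Matrix.trace, Complex.re_sum]
  refine Finset.sum_congr rfl fun i _ => ?_
  rw [Matrix.diag_apply, Matrix.mul_diagonal, Matrix.mul_apply, Finset.sum_mul, Complex.re_sum]
  refine Finset.sum_congr rfl fun j _ => ?_
  rw [Matrix.mul_diagonal, Matrix.conjTranspose_apply, RCLike.star_def]
  have : M i j * (b j : ℂ) * (starRingEnd ℂ) (M i j) * (a i : ℂ) =
      (M i j * (starRingEnd ℂ) (M i j)) * (b j : ℂ) * a i := by ring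
  rw [this, Complex.mul_conj]
  rw [← Complex.ofReal_mul, ← Complex.ofReal_mul, Complex.ofReal_re]
  ring

theorem sum_normSq_row (U : Matrix.unitaryGroup n ℂ) (i : n) :
    ∑ j, Complex.normSq ((U : Matrix n n ℂ) i j) = 1 := by
  have h := congrFun (congrFun (self_mul_star_unitary U) i) i
  rw [Matrix.mul_apply, Matrix.one_apply_eq] at h
  have h2 : ((∑ j, Complex.normSq ((U : Matrix n n ℂ) i j) : ℝ) : ℂ) = 1 := by
    rw [← h]; push_cast
    refine Finset.sum_congr rfl fun j _ => ?_
    rw [Matrix.star_apply, RCLike.star_def, Complex.mul_conj]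
  exact_mod_cast h2

theorem sum_normSq_col (U : Matrix.unitaryGroup n ℂ) (j : n) :
    ∑ i, Complex.normSq ((U : Matrix n n ℂ) i j) = 1 := by
  have h := congrFun (congrFun (star_mul_self_unitary U) j) j
  rw [Matrix.mul_apply, Matrix.one_apply_eq] at h
  have h2 : ((∑ i, Complex.normSq ((U : Matrix n n ℂ) i j) : ℝ) : ℂ) = 1 := by
    rw [← h]; push_cast
    refine Finset.sum_congr rfl fun i _ => ?_
    rw [Matrix.star_apply, RCLike.star_def, mul_comm, Complex.mul_conj]
  exact_mod_cast h2

/-- Two spectral decompositions are related by a doubly stochastic overlap matrix. -/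
theorem exists_overlap (U V : Matrix.unitaryGroup n ℂ) :
    ∃ c : n → n → ℝ, (∀ i j, 0 ≤ c i j) ∧ (∀ i, ∑ j, c i j = 1) ∧ (∀ j, ∑ i, c i j = 1) ∧
      ∀ a b : n → ℝ, rtr (specMat U a * specMat V b) = ∑ i, ∑ j, c i j * (a i * b j) := by
  refine ⟨fun i j => Complex.normSq (((star U * V : Matrix.unitaryGroup n ℂ) : Matrix n n ℂ) i j),
    fun i j => Complex.normSq_nonneg _, fun i => sum_normSq_row _ i, fun j => sum_normSq_col _ j,
    fun a b => ?_⟩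
  have h := trace_mul_specMat (1 : Matrix n n ℂ) V b U a
  rw [rtr, Matrix.trace_mul_comm]
  rw [rtr] at h
  simp only [one_mul, Matrix.conjTranspose_one, mul_one] at h
  rw [h]
  refine Finset.sum_congr rfl fun i _ => Finset.sum_congr rfl fun j _ => ?_
  simp only [Submonoid.coe_mul, Unitary.coe_star]
  ring

end Spectral

section Powers

variable {n : Type*} [Fintype n] [DecidableEq n]

/-- Real power of a Hermitian matrix. -/
def pw (p : ℝ) (A : Matrix n n ℂ) : Matrix n n ℂ := matFun (fun t => t ^ p) A

/-- `(Tr A^{1/(1+s)})^{1+s}`. -/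
def nQ (s : ℝ) (A : Matrix n n ℂ) : ℝ := (rtr (pw (1 / (1 + s)) A)) ^ (1 + s)

/-- `exp (-s D̃_{1/(1+s)}(ρ‖σ))`. -/
def Qs (s : ℝ) (ρ σ : Matrix n n ℂ) : ℝ := nQ s (pw (s / 2) σ * ρ * pw (s / 2) σ)

theorem pw_specMat (p : ℝ) (U : Matrix.unitaryGroup n ℂ) (a : n → ℝ) :
    pw p (specMat U a) = specMat U (fun i => a i ^ p) := matFun_specMat _ U a

theorem matFun_sqrt (A : Matrix n n ℂ) : matFun Real.sqrt A = pw (1 / 2) A := by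
  unfold pw
  congr 1
  ext t
  rw [Real.sqrt_eq_rpow]

theorem pw_posSemidef (p : ℝ) {A : Matrix n n ℂ} (hA : A.PosSemidef) : (pw p A).PosSemidef := by
  obtain ⟨U, a, rfl, ha⟩ := exists_specMat_nonneg hA
  rw [pw_specMat]
  exact specMat_posSemidef U fun i => Real.rpow_nonneg (ha i) _

theorem pw_conjTranspose (p : ℝ) {A : Matrix n n ℂ} (hA : A.PosSemidef) :
    (pw p A).conjTranspose = pw p A := (pw_posSemidef p hA).1

theorem pw_zero {A : Matrix n n ℂ} (hA : A.IsHermitian) : pw 0 A = 1 := by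
  obtain ⟨U, a, rfl⟩ := exists_specMat hA
  rw [pw_specMat]
  simp [specMat_one]

theorem pw_one {A : Matrix n n ℂ} (hA : A.IsHermitian) : pw 1 A = A := by
  obtain ⟨U, a, rfl⟩ := exists_specMat hA
  rw [pw_specMat]
  simp

theorem pw_mul_pw {p q : ℝ} (h : p + q ≠ 0) {A : Matrix n n ℂ} (hA : A.PosSemidef) :
    pw p A * pw q A = pw (p + q) A := by
  obtain ⟨U, a, rfl, ha⟩ := exists_specMat_nonneg hA
  rw [pw_specMat, pw_specMat, pw_specMat, specMat_mul]
  congr 1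
  ext i
  rw [Real.rpow_add' (ha i) h]

theorem pw_pw {p q : ℝ} {A : Matrix n n ℂ} (hA : A.PosSemidef) :
    pw p (pw q A) = pw (q * p) A := by
  obtain ⟨U, a, rfl, ha⟩ := exists_specMat_nonneg hA
  rw [pw_specMat, pw_specMat, pw_specMat]
  congr 1
  ext i
  rw [Real.rpow_mul (ha i)]

theorem pw_half_mul_self {A : Matrix n n ℂ} (hA : A.PosSemidef) :
    pw (1 / 2) A * pw (1 / 2) A = A := by
  rw [pw_mul_pw (by norm_num) hA, show (1 / 2 + 1 / 2 : ℝ) = 1 by norm_num, pw_one hA.1]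

theorem pw_smul (p : ℝ) {c : ℝ} (hc : 0 ≤ c) {A : Matrix n n ℂ} (hA : A.PosSemidef) :
    pw p (c • A) = c ^ p • pw p A := by
  obtain ⟨U, a, rfl, ha⟩ := exists_specMat_nonneg hA
  rw [specMat_smul, pw_specMat, pw_specMat, specMat_smul]
  congr 1
  ext i
  rw [Real.mul_rpow hc (ha i)]

theorem rtr_nonneg {A : Matrix n n ℂ} (hA : A.PosSemidef) : 0 ≤ rtr A := by
  have := hA.trace_nonneg
  rw [Complex.le_def] at this
  simpa [rtr] using this.1

theorem rtr_add (A B : Matrix n n ℂ) : rtr (A + B) = rtr A + rtr B := by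
  simp [rtr]

theorem rtr_sub (A B : Matrix n n ℂ) : rtr (A - B) = rtr A - rtr B := by
  simp [rtr]

theorem rtr_smul (c : ℝ) (A : Matrix n n ℂ) : rtr (c • A) = c * rtr A := by
  simp [rtr]

theorem rtr_sum {ι : Type*} (s : Finset ι) (A : ι → Matrix n n ℂ) :
    rtr (∑ i ∈ s, A i) = ∑ i ∈ s, rtr (A i) := by
  simp [rtr, Matrix.trace_sum]

theorem rtr_mul_comm {m : Type*} [Fintype m] (A : Matrix n m ℂ) (B : Matrix m n ℂ) :
    rtr (A * B) = rtr (B * A) := by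
  rw [rtr, rtr, Matrix.trace_mul_comm]

theorem rtr_mul_nonneg {A B : Matrix n n ℂ} (hA : A.PosSemidef) (hB : B.PosSemidef) :
    0 ≤ rtr (A * B) := by
  rw [← pw_half_mul_self hA, Matrix.mul_assoc, rtr_mul_comm]
  apply rtr_nonneg
  have := hB.mul_mul_conjTranspose_same (pw (1 / 2) A)
  rwa [pw_conjTranspose _ hA] at this

theorem rtr_mul_mono {A B C : Matrix n n ℂ} (h : (B - A).PosSemidef) (hC : C.PosSemidef) :
    rtr (A * C) ≤ rtr (B * C) := by
  have := rtr_mul_nonneg h hC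
  rw [Matrix.sub_mul, rtr_sub] at this
  linarith

theorem rtr_matFun_eq (f : ℝ → ℝ) {A : Matrix n n ℂ} (hA : A.IsHermitian) :
    rtr (matFun f A) = ((A.charpoly.roots).map (fun z => f z.re)).sum := by
  rw [hA.roots_charpoly_eq_eigenvalues, matFun, dif_pos hA]
  change rtr (specMat _ _) = _
  rw [rtr_specMat, Multiset.map_map]
  simp

theorem rtr_matFun_swap (f : ℝ → ℝ) (C : Matrix n n ℂ) :
    rtr (matFun f (C * C.conjTranspose)) = rtr (matFun f (C.conjTranspose * C)) := by
  rw [rtr_matFun_eq f (Matrix.isHermitian_mul_conjTranspose_self C),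
    rtr_matFun_eq f (Matrix.isHermitian_conjTranspose_mul_self C), Matrix.charpoly_mul_comm]

theorem rtr_pw_swap (p : ℝ) (C : Matrix n n ℂ) :
    rtr (pw p (C * C.conjTranspose)) = rtr (pw p (C.conjTranspose * C)) :=
  rtr_matFun_swap _ C

theorem nQ_swap (s : ℝ) (C : Matrix n n ℂ) :
    nQ s (C * C.conjTranspose) = nQ s (C.conjTranspose * C) := by
  rw [nQ, nQ, rtr_pw_swap]

theorem nQ_nonneg (s : ℝ) {A : Matrix n n ℂ} (hA : A.PosSemidef) : 0 ≤ nQ s A :=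
  Real.rpow_nonneg (rtr_nonneg (pw_posSemidef _ hA)) _

theorem sandwich_posSemidef {A B : Matrix n n ℂ} (hA : A.PosSemidef) (hB : B.PosSemidef) :
    (A * B * A).PosSemidef := by
  have := hB.mul_mul_conjTranspose_same A
  rwa [hA.1.eq] at this

theorem Qs_nonneg (s : ℝ) {ρ σ : Matrix n n ℂ} (hρ : ρ.PosSemidef) (hσ : σ.PosSemidef) :
    0 ≤ Qs s ρ σ :=
  nQ_nonneg s (sandwich_posSemidef (pw_posSemidef _ hσ) hρ)

theorem Qs_eq {s : ℝ} (hs : s ≠ 0) {ρ σ : Matrix n n ℂ} (hρ : ρ.PosSemidef) (hσ : σ.PosSemidef) :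
    Qs s ρ σ = nQ s (pw (1 / 2) ρ * pw s σ * pw (1 / 2) ρ) := by
  have h := nQ_swap s (pw (s / 2) σ * pw (1 / 2) ρ)
  rw [Matrix.conjTranspose_mul, pw_conjTranspose _ hσ, pw_conjTranspose _ hρ] at h
  have e1 : pw (s / 2) σ * pw (1 / 2) ρ * (pw (1 / 2) ρ * pw (s / 2) σ)
      = pw (s / 2) σ * ρ * pw (s / 2) σ := by
    calc _ = pw (s / 2) σ * (pw (1 / 2) ρ * pw (1 / 2) ρ) * pw (s / 2) σ := by
          simp only [Matrix.mul_assoc]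
      _ = _ := by rw [pw_half_mul_self hρ]
  have e2 : pw (1 / 2) ρ * pw (s / 2) σ * (pw (s / 2) σ * pw (1 / 2) ρ)
      = pw (1 / 2) ρ * pw s σ * pw (1 / 2) ρ := by
    calc _ = pw (1 / 2) ρ * (pw (s / 2) σ * pw (s / 2) σ) * pw (1 / 2) ρ := by
          simp only [Matrix.mul_assoc]
      _ = _ := by rw [pw_mul_pw (by simpa using hs) hσ, add_halves]
  rw [e1, e2] at h
  exact h

theorem holder_weighted {ι : Type*} (S : Finset ι) {c f g : ι → ℝ} {t : ℝ} (ht0 : 0 < t)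
    (ht1 : t < 1) (hc : ∀ i ∈ S, 0 ≤ c i) (hf : ∀ i ∈ S, 0 ≤ f i) (hg : ∀ i ∈ S, 0 ≤ g i) :
    ∑ i ∈ S, c i * (f i ^ t * g i ^ (1 - t)) ≤
      (∑ i ∈ S, c i * f i) ^ t * (∑ i ∈ S, c i * g i) ^ (1 - t) := by
  have hpq : (1 / t).HolderConjugate (1 / (1 - t)) := by
    rw [Real.holderConjugate_iff]
    refine ⟨by rw [lt_div_iff₀ ht0]; linarith, by simp⟩
  have h := Real.inner_le_Lp_mul_Lq_of_nonneg S hpq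
    (f := fun i => (c i * f i) ^ t) (g := fun i => (c i * g i) ^ (1 - t))
    (fun i hi => Real.rpow_nonneg (mul_nonneg (hc i hi) (hf i hi)) _)
    (fun i hi => Real.rpow_nonneg (mul_nonneg (hc i hi) (hg i hi)) _)
  simp only [one_div_one_div] at h
  have ht2 : 1 - t ≠ 0 := by linarith
  have e0 : ∑ i ∈ S, c i * (f i ^ t * g i ^ (1 - t)) =
      ∑ i ∈ S, (c i * f i) ^ t * (c i * g i) ^ (1 - t) := by
    refine Finset.sum_congr rfl fun i hi => ?_
    rw [Real.mul_rpow (hc i hi) (hf i hi), Real.mul_rpow (hc i hi) (hg i hi)]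
    have : c i = c i ^ t * c i ^ (1 - t) := by
      rw [← Real.rpow_add' (hc i hi) (by norm_num)]; norm_num
    nth_rewrite 1 [this]
    ring
  have e1 : ∑ i ∈ S, ((c i * f i) ^ t) ^ (1 / t) = ∑ i ∈ S, c i * f i := by
    refine Finset.sum_congr rfl fun i hi => ?_
    rw [← Real.rpow_mul (mul_nonneg (hc i hi) (hf i hi)), mul_one_div_cancel ht0.ne', Real.rpow_one]
  have e2 : ∑ i ∈ S, ((c i * g i) ^ (1 - t)) ^ (1 / (1 - t)) = ∑ i ∈ S, c i * g i := by
    refine Finset.sum_congr rfl fun i hi => ?_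
    rw [← Real.rpow_mul (mul_nonneg (hc i hi) (hg i hi)), mul_one_div_cancel ht2, Real.rpow_one]
  rw [e1, e2] at h
  rw [e0]
  exact h

theorem overlap_fst {c : n → n → ℝ} (h : ∀ i, ∑ j, c i j = 1) (f : n → ℝ) :
    ∑ p : n × n, c p.1 p.2 * f p.1 = ∑ i, f i := by
  rw [Fintype.sum_prod_type]
  refine Finset.sum_congr rfl fun i _ => ?_
  simp only
  rw [← Finset.sum_mul, h, one_mul]

theorem overlap_snd {c : n → n → ℝ} (h : ∀ j, ∑ i, c i j = 1) (f : n → ℝ) :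
    ∑ p : n × n, c p.1 p.2 * f p.2 = ∑ i, f i := by
  rw [Fintype.sum_prod_type_right]
  refine Finset.sum_congr rfl fun i _ => ?_
  simp only
  rw [← Finset.sum_mul, h, one_mul]

/-- Hölder's inequality for traces of products of positive matrices. -/
theorem trace_holder {s : ℝ} (hs0 : 0 < s) (hs1 : s < 1) {S K : Matrix n n ℂ}
    (hS : S.PosSemidef) (hK : K.PosSemidef) :
    rtr (S * K) ≤ (rtr (pw (1 / s) S)) ^ s * (rtr (pw (1 / (1 - s)) K)) ^ (1 - s) := by
  obtain ⟨U, a, rfl, ha⟩ := exists_specMat_nonneg hS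
  obtain ⟨V, b, rfl, hb⟩ := exists_specMat_nonneg hK
  obtain ⟨c, hc0, hc1, hc2, hc⟩ := exists_overlap U V
  rw [hc, pw_specMat, pw_specMat, rtr_specMat, rtr_specMat]
  have hs2 : 1 - s ≠ 0 := by linarith
  have h := holder_weighted (Finset.univ : Finset (n × n)) (c := fun p => c p.1 p.2)
    (f := fun p => a p.1 ^ (1 / s)) (g := fun p => b p.2 ^ (1 / (1 - s))) hs0 hs1
    (fun p _ => hc0 _ _) (fun p _ => Real.rpow_nonneg (ha _) _)
    (fun p _ => Real.rpow_nonneg (hb _) _)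
  rw [overlap_fst hc1 (fun i => a i ^ (1 / s)),
    overlap_snd hc2 (fun i => b i ^ (1 / (1 - s)))] at h
  refine le_trans (le_of_eq ?_) h
  rw [Fintype.sum_prod_type]
  refine Finset.sum_congr rfl fun i _ => Finset.sum_congr rfl fun j _ => ?_
  simp only
  rw [← Real.rpow_mul (ha i), ← Real.rpow_mul (hb j), one_div_mul_cancel hs0.ne',
    one_div_mul_cancel hs2, Real.rpow_one, Real.rpow_one]

/-- Reverse Hölder inequality. -/
theorem nQ_le {s : ℝ} (hs0 : 0 < s) {A Z : Matrix n n ℂ}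
    (hA : A.PosSemidef) (hZ : Z.PosDef) :
    nQ s A ≤ rtr (A * Z) * (rtr (pw (-(1 / s)) Z)) ^ s := by
  obtain ⟨U, a, rfl, ha⟩ := exists_specMat_nonneg hA
  obtain ⟨V, b, rfl, hb⟩ := exists_specMat_pos hZ
  obtain ⟨c, hc0, hc1, hc2, hc⟩ := exists_overlap U V
  rw [hc, nQ, pw_specMat, pw_specMat, rtr_specMat, rtr_specMat]
  have hs1 : 0 < 1 + s := by linarith
  have ht0 : 0 < 1 / (1 + s) := by positivity
  have ht1 : 1 / (1 + s) < 1 := by rw [div_lt_one hs1]; linarith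
  have h := holder_weighted (Finset.univ : Finset (n × n)) (c := fun p => c p.1 p.2)
    (f := fun p => a p.1 * b p.2) (g := fun p => b p.2 ^ (-(1 / s))) ht0 ht1
    (fun p _ => hc0 _ _) (fun p _ => mul_nonneg (ha _) (hb _).le)
    (fun p _ => Real.rpow_nonneg (hb _).le _)
  rw [overlap_snd hc2 (fun i => b i ^ (-(1 / s)))] at h
  have e : ∀ p : n × n, c p.1 p.2 * ((a p.1 * b p.2) ^ (1 / (1 + s)) *
      (b p.2 ^ (-(1 / s))) ^ (1 - 1 / (1 + s))) = c p.1 p.2 * a p.1 ^ (1 / (1 + s)) := by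
    intro p
    rw [Real.mul_rpow (ha _) (hb _).le, ← Real.rpow_mul (hb _).le, mul_assoc (a p.1 ^ _),
      ← Real.rpow_add (hb _)]
    have : 1 / (1 + s) + -(1 / s) * (1 - 1 / (1 + s)) = 0 := by field_simp; ring
    rw [this, Real.rpow_zero, mul_one]
  simp only [e] at h
  rw [overlap_fst hc1 (fun i => a i ^ (1 / (1 + s)))] at h
  have h0 : 0 ≤ ∑ i, a i ^ (1 / (1 + s)) := Finset.sum_nonneg fun i _ => Real.rpow_nonneg (ha i) _
  have h2 := Real.rpow_le_rpow h0 h hs1.le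
  refine h2.trans (le_of_eq ?_)
  have n1 : 0 ≤ ∑ p : n × n, c p.1 p.2 * (a p.1 * b p.2) :=
    Finset.sum_nonneg fun p _ => mul_nonneg (hc0 _ _) (mul_nonneg (ha _) (hb _).le)
  have n2 : 0 ≤ ∑ i, b i ^ (-(1 / s)) := Finset.sum_nonneg fun i _ => Real.rpow_nonneg (hb i).le _
  rw [Real.mul_rpow (Real.rpow_nonneg n1 _) (Real.rpow_nonneg n2 _), ← Real.rpow_mul n1,
    ← Real.rpow_mul n2, one_div_mul_cancel hs1.ne', Real.rpow_one, Fintype.sum_prod_type]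
  congr 2
  field_simp
  ring

/-- The reverse Hölder inequality is tight. -/
theorem exists_nQ_near {s : ℝ} (hs0 : 0 < s) {A : Matrix n n ℂ}
    (hA : A.PosSemidef) {ε : ℝ} (hε : 0 < ε) :
    ∃ Z : Matrix n n ℂ, Z.PosDef ∧ rtr (pw (-(1 / s)) Z) ≤ 1 ∧ rtr (A * Z) ≤ nQ s A + ε := by
  obtain ⟨U, a, rfl, ha⟩ := exists_specMat_nonneg hA
  have hs1 : 0 < 1 + s := by linarith
  have hcont : Continuous fun δ : ℝ => (∑ i, (a i + δ) ^ (1 / (1 + s))) ^ (1 + s) := by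
    refine Continuous.rpow_const (continuous_finsetSum _ fun i _ => ?_) fun _ => Or.inr hs1.le
    exact Continuous.rpow_const (by fun_prop) fun _ => Or.inr (by positivity)
  have hev : ∀ᶠ δ in nhdsWithin (0 : ℝ) (Set.Ioi 0),
      (∑ i, (a i + δ) ^ (1 / (1 + s))) ^ (1 + s) < nQ s (specMat U a) + ε := by
    have h1 := (hcont.tendsto 0).mono_left (nhdsWithin_le_nhds (s := Set.Ioi 0))
    refine h1.eventually (gt_mem_nhds ?_)
    simp only [add_zero]
    rw [nQ, pw_specMat, rtr_specMat]
    linarith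
  obtain ⟨δ, hδ, hδ0⟩ := (hev.and self_mem_nhdsWithin).exists
  have hpos : ∀ i, 0 < a i + δ := fun i => by linarith [ha i]
  rcases isEmpty_or_nonempty n with hn | hn
  · refine ⟨specMat U fun _ => 1, (specMat_posDef_iff U).2 fun _ => one_pos, ?_, ?_⟩
    · rw [pw_specMat, rtr_specMat]; simp
    · rw [specMat_mul, rtr_specMat]
      have := nQ_nonneg s hA
      simp only [Finset.univ_eq_empty, Finset.sum_empty]
      linarith
  set T := ∑ i, (a i + δ) ^ (1 / (1 + s)) with hT
  have hT0 : 0 < T := Finset.sum_pos (fun i _ => Real.rpow_pos_of_pos (hpos i) _)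
    Finset.univ_nonempty
  refine ⟨specMat U fun i => (a i + δ) ^ (1 / (1 + s) - 1) * T ^ s,
    (specMat_posDef_iff U).2 fun i => mul_pos (Real.rpow_pos_of_pos (hpos i) _)
      (Real.rpow_pos_of_pos hT0 _), ?_, ?_⟩
  · rw [pw_specMat, rtr_specMat]
    have : ∀ i, ((a i + δ) ^ (1 / (1 + s) - 1) * T ^ s) ^ (-(1 / s)) =
        (a i + δ) ^ (1 / (1 + s)) * T⁻¹ := by
      intro i
      rw [Real.mul_rpow (Real.rpow_nonneg (hpos i).le _) (Real.rpow_nonneg hT0.le _),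
        ← Real.rpow_mul (hpos i).le, ← Real.rpow_mul hT0.le]
      congr 1
      · congr 1; field_simp; ring
      · rw [show s * -(1 / s) = -1 by field_simp, Real.rpow_neg_one]
    simp only [this]
    rw [← Finset.sum_mul, mul_inv_cancel₀ hT0.ne']
  · rw [specMat_mul, rtr_specMat]
    refine le_trans ?_ hδ.le
    rw [Real.rpow_add hT0, Real.rpow_one]
    nth_rewrite 2 [hT]
    rw [Finset.sum_mul]
    refine Finset.sum_le_sum fun i _ => ?_
    rw [← mul_assoc]
    refine mul_le_mul_of_nonneg_right ?_ (Real.rpow_nonneg hT0.le _)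
    rw [Real.rpow_sub (hpos i), Real.rpow_one, mul_div_assoc']
    rw [div_le_iff₀ (hpos i), mul_comm]
    exact mul_le_mul_of_nonneg_left (by linarith) (Real.rpow_nonneg (hpos i).le _)

end Powers

section Loewner

open scoped MatrixOrder Matrix.Norms.L2Operator

variable {n : Type*} [Fintype n] [DecidableEq n]

theorem pw_eq_rpow (p : ℝ) {A : Matrix n n ℂ} (hA : A.PosSemidef) : pw p A = A ^ p := by
  rw [CFC.rpow_eq_cfc_real (Matrix.nonneg_iff_posSemidef.2 hA), hA.1.cfc_eq, pw, matFun,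
    dif_pos hA.1, Matrix.IsHermitian.cfc, Unitary.conjStarAlgAut_apply]
  rfl

/-- Operator monotonicity of fractional powers (Löwner–Heinz). -/
theorem pw_mono {p : ℝ} (hp0 : 0 ≤ p) (hp1 : p ≤ 1) {A B : Matrix n n ℂ} (hA : A.PosSemidef)
    (h : (B - A).PosSemidef) : (pw p B - pw p A).PosSemidef := by
  have hB : B.PosSemidef := by simpa using h.add hA
  rw [pw_eq_rpow p hA, pw_eq_rpow p hB, ← Matrix.le_iff]
  exact CFC.rpow_le_rpow ⟨hp0, hp1⟩ (Matrix.le_iff.2 h)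

/-- Operator concavity of fractional powers. -/
theorem pw_concave {p : ℝ} (hp0 : 0 ≤ p) (hp1 : p ≤ 1) {A B : Matrix n n ℂ} (hA : A.PosSemidef)
    (hB : B.PosSemidef) {a b : ℝ} (ha : 0 ≤ a) (hb : 0 ≤ b) (hab : a + b = 1) :
    (pw p (a • A + b • B) - (a • pw p A + b • pw p B)).PosSemidef := by
  rw [pw_eq_rpow p hA, pw_eq_rpow p hB, pw_eq_rpow p ((hA.smul ha).add (hB.smul hb)),
    ← Matrix.le_iff]
  exact (CFC.concaveOn_rpow (A := Matrix n n ℂ) ⟨hp0, hp1⟩).2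
    (Matrix.nonneg_iff_posSemidef.2 hA) (Matrix.nonneg_iff_posSemidef.2 hB) ha hb hab

end Loewner

section Sandwiched

variable {n : Type*} [Fintype n] [DecidableEq n]

theorem nQ_le_of_normalized {s : ℝ} (hs0 : 0 < s) {A Z : Matrix n n ℂ}
    (hA : A.PosSemidef) (hZ : Z.PosDef) (hZ1 : rtr (pw (-(1 / s)) Z) ≤ 1) :
    nQ s A ≤ rtr (A * Z) := by
  have h0 := rtr_nonneg (pw_posSemidef (-(1 / s)) hZ.posSemidef)
  calc nQ s A ≤ rtr (A * Z) * (rtr (pw (-(1 / s)) Z)) ^ s := nQ_le hs0 hA hZ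
    _ ≤ rtr (A * Z) * 1 := mul_le_mul_of_nonneg_left (Real.rpow_le_one h0 hZ1 hs0.le)
        (rtr_mul_nonneg hA hZ.posSemidef)
    _ = _ := mul_one _

theorem nQ_mono {s : ℝ} (hs0 : 0 < s) {A B : Matrix n n ℂ} (hA : A.PosSemidef)
    (h : (B - A).PosSemidef) : nQ s A ≤ nQ s B := by
  have hB : B.PosSemidef := by simpa using h.add hA
  refine le_of_forall_pos_le_add fun ε hε => ?_
  obtain ⟨Z, hZ, hZ1, hZ2⟩ := exists_nQ_near hs0 hB hε
  exact (nQ_le_of_normalized hs0 hA hZ hZ1).trans ((rtr_mul_mono h hZ.posSemidef).trans hZ2)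

theorem nQ_pos (s : ℝ) {A : Matrix n n ℂ} (hA : A.PosSemidef) (h : A ≠ 0) : 0 < nQ s A := by
  obtain ⟨U, a, rfl, ha⟩ := exists_specMat_nonneg hA
  rw [nQ, pw_specMat, rtr_specMat]
  apply Real.rpow_pos_of_pos
  have : ∃ i, 0 < a i := by
    by_contra hcon
    push Not at hcon
    apply h
    have : a = fun _ => 0 := funext fun i => le_antisymm (hcon i) (ha i)
    rw [this, specMat_const, zero_smul]
  obtain ⟨i, hi⟩ := this
  exact Finset.sum_pos' (fun j _ => Real.rpow_nonneg (ha j) _)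
    ⟨i, Finset.mem_univ _, Real.rpow_pos_of_pos hi _⟩

theorem mul_specMat_eq_zero {m : Type*} {B : Matrix m n ℂ} {V : Matrix.unitaryGroup n ℂ}
    {b f : n → ℝ} (h : B * specMat V b = 0) (hf : ∀ j, b j = 0 → f j = 0) :
    B * specMat V f = 0 := by
  have : specMat V f = specMat V b * specMat V (fun j => f j / b j) := by
    rw [specMat_mul]
    congr 1
    ext j
    by_cases hb : b j = 0
    · simp [hb, hf j hb]
    · field_simp
  rw [this, ← Matrix.mul_assoc, h, Matrix.zero_mul]

theorem mul_pw_eq_zero {m : Type*} {B : Matrix m n ℂ} {A : Matrix n n ℂ} (hA : A.PosSemidef)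
    {p q : ℝ} (hp : p ≠ 0) (hq : q ≠ 0) (h : B * pw p A = 0) : B * pw q A = 0 := by
  obtain ⟨U, a, rfl, ha⟩ := exists_specMat_nonneg hA
  rw [pw_specMat] at h ⊢
  refine mul_specMat_eq_zero h fun j hj => ?_
  rw [(Real.rpow_eq_zero (ha j) hp).1 hj, Real.zero_rpow hq]

theorem Qs_pos {s : ℝ} (hs0 : 0 < s) {ρ σ : Matrix n n ℂ} (hρ : ρ.PosSemidef)
    (hσ : σ.PosSemidef) (h : ρ * σ ≠ 0) : 0 < Qs s ρ σ := by
  refine nQ_pos s (sandwich_posSemidef (pw_posSemidef _ hσ) hρ) fun h0 => h ?_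
  have h1 : (pw (s / 2) σ * pw (1 / 2) ρ) * (pw (s / 2) σ * pw (1 / 2) ρ).conjTranspose = 0 := by
    rw [Matrix.conjTranspose_mul, pw_conjTranspose _ hσ, pw_conjTranspose _ hρ, ← h0]
    calc _ = pw (s / 2) σ * (pw (1 / 2) ρ * pw (1 / 2) ρ) * pw (s / 2) σ := by
          simp only [Matrix.mul_assoc]
      _ = _ := by rw [pw_half_mul_self hρ]
  rw [Matrix.self_mul_conjTranspose_eq_zero] at h1
  have h2 := mul_pw_eq_zero hρ (by norm_num) one_ne_zero h1
  have h3 := congrArg Matrix.conjTranspose h2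
  rw [Matrix.conjTranspose_mul, pw_conjTranspose _ hσ, pw_conjTranspose _ hρ, pw_one hρ.1,
    Matrix.conjTranspose_zero] at h3
  have h4 := mul_pw_eq_zero hσ (by positivity) one_ne_zero h3
  rwa [pw_one hσ.1] at h4

theorem Qs_eq_zero {s : ℝ} (hs0 : 0 < s) {ρ σ : Matrix n n ℂ}
    (hσ : σ.PosSemidef) (h : ρ * σ = 0) : Qs s ρ σ = 0 := by
  rw [← pw_one hσ.1] at h
  have h1 : ρ * pw (s / 2) σ = 0 := mul_pw_eq_zero hσ one_ne_zero (by positivity) h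
  rw [Qs, Matrix.mul_assoc, h1, Matrix.mul_zero, nQ]
  have : (0 : Matrix n n ℂ) = specMat 1 (fun _ => 0) := by rw [specMat_const, zero_smul]
  rw [this, pw_specMat, rtr_specMat]
  rw [Real.zero_rpow (by positivity), Finset.sum_const_zero, Real.zero_rpow (by positivity)]

theorem Qs_zero {ρ σ : Matrix n n ℂ} (hρ : ρ.PosSemidef) (hσ : σ.PosSemidef) :
    Qs 0 ρ σ = rtr ρ := by
  rw [Qs, nQ, zero_div, pw_zero hσ.1, one_mul, mul_one, add_zero, div_one, pw_one hρ.1,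
    Real.rpow_one]

theorem sandwich_sub (R A B : Matrix n n ℂ) : R * A * R - R * B * R = R * (A - B) * R := by
  rw [Matrix.mul_sub, Matrix.sub_mul]

theorem rtr_sandwich_mul (R S Z : Matrix n n ℂ) :
    rtr (R * S * R * Z) = rtr (S * (R * Z * R)) := by
  rw [Matrix.mul_assoc, Matrix.mul_assoc, rtr_mul_comm]
  simp only [Matrix.mul_assoc]

theorem Qs_le_of_normalized {s : ℝ} (hs0 : 0 < s) {ρ σ Z : Matrix n n ℂ}
    (hρ : ρ.PosSemidef) (hσ : σ.PosSemidef) (hZ : Z.PosDef) (hZ1 : rtr (pw (-(1 / s)) Z) ≤ 1) :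
    Qs s ρ σ ≤ rtr (pw s σ * (pw (1 / 2) ρ * Z * pw (1 / 2) ρ)) := by
  rw [Qs_eq hs0.ne' hρ hσ, ← rtr_sandwich_mul]
  exact nQ_le_of_normalized hs0 (sandwich_posSemidef (pw_posSemidef _ hρ) (pw_posSemidef _ hσ))
    hZ hZ1

theorem exists_Qs_near {s : ℝ} (hs0 : 0 < s) {ρ σ : Matrix n n ℂ}
    (hρ : ρ.PosSemidef) (hσ : σ.PosSemidef) {ε : ℝ} (hε : 0 < ε) :
    ∃ Z : Matrix n n ℂ, Z.PosDef ∧ rtr (pw (-(1 / s)) Z) ≤ 1 ∧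
      rtr (pw s σ * (pw (1 / 2) ρ * Z * pw (1 / 2) ρ)) ≤ Qs s ρ σ + ε := by
  obtain ⟨Z, h1, h2, h3⟩ := exists_nQ_near hs0
    (sandwich_posSemidef (pw_posSemidef (1 / 2) hρ) (pw_posSemidef s hσ)) hε
  refine ⟨Z, h1, h2, ?_⟩
  rwa [Qs_eq hs0.ne' hρ hσ, ← rtr_sandwich_mul]

theorem Qs_mono {s : ℝ} (hs0 : 0 < s) (hs1 : s ≤ 1) {ρ σ τ : Matrix n n ℂ}
    (hρ : ρ.PosSemidef) (hσ : σ.PosSemidef) (h : (τ - σ).PosSemidef) :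
    Qs s ρ σ ≤ Qs s ρ τ := by
  have hτ : τ.PosSemidef := by simpa using h.add hσ
  rw [Qs_eq hs0.ne' hρ hσ, Qs_eq hs0.ne' hρ hτ]
  refine nQ_mono hs0 (sandwich_posSemidef (pw_posSemidef _ hρ) (pw_posSemidef _ hσ)) ?_
  rw [sandwich_sub]
  exact sandwich_posSemidef (pw_posSemidef _ hρ) (pw_mono hs0.le hs1 hσ h)

theorem Qs_smul {s : ℝ} (hs0 : 0 < s) {ρ σ : Matrix n n ℂ}
    (hρ : ρ.PosSemidef) (hσ : σ.PosSemidef) {c : ℝ} (hc : 0 ≤ c) :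
    Qs s ρ (c • σ) = c ^ s * Qs s ρ σ := by
  rw [Qs_eq hs0.ne' hρ hσ, Qs_eq hs0.ne' hρ (hσ.smul hc), pw_smul s hc hσ, Matrix.mul_smul,
    Matrix.smul_mul, nQ, nQ, pw_smul _ (Real.rpow_nonneg hc _)
    (sandwich_posSemidef (pw_posSemidef _ hρ) (pw_posSemidef _ hσ)), rtr_smul,
    Real.mul_rpow (Real.rpow_nonneg (Real.rpow_nonneg hc _) _)
    (rtr_nonneg (pw_posSemidef _ (sandwich_posSemidef (pw_posSemidef _ hρ) (pw_posSemidef _ hσ)))),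
    ← Real.rpow_mul (Real.rpow_nonneg hc _), one_div_mul_cancel (by linarith), Real.rpow_one]

/-- Concavity in the second argument. -/
theorem Qs_concave {s : ℝ} (hs0 : 0 < s) (hs1 : s ≤ 1) {ρ σ τ : Matrix n n ℂ}
    (hρ : ρ.PosSemidef) (hσ : σ.PosSemidef) (hτ : τ.PosSemidef) {a b : ℝ} (ha : 0 ≤ a)
    (hb : 0 ≤ b) (hab : a + b = 1) :
    a * Qs s ρ σ + b * Qs s ρ τ ≤ Qs s ρ (a • σ + b • τ) := by
  refine le_of_forall_pos_le_add fun ε hε => ?_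
  obtain ⟨Z, hZ, hZ1, hZ2⟩ := exists_Qs_near hs0 hρ ((hσ.smul ha).add (hτ.smul hb)) hε
  have hK : (pw (1 / 2) ρ * Z * pw (1 / 2) ρ).PosSemidef :=
    sandwich_posSemidef (pw_posSemidef _ hρ) hZ.posSemidef
  have h1 := rtr_mul_mono (pw_concave hs0.le hs1 hσ hτ ha hb hab) hK
  rw [Matrix.add_mul, Matrix.smul_mul, Matrix.smul_mul, rtr_add, rtr_smul, rtr_smul] at h1
  have h2 := mul_le_mul_of_nonneg_left (Qs_le_of_normalized hs0 hρ hσ hZ hZ1) ha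
  have h3 := mul_le_mul_of_nonneg_left (Qs_le_of_normalized hs0 hρ hτ hZ hZ1) hb
  linarith

theorem qFid_eq {ρ σ : Matrix n n ℂ} (hρ : ρ.PosSemidef) (hσ : σ.PosSemidef) :
    qFid ρ σ = Qs 1 ρ σ := by
  rw [Qs_eq one_ne_zero hρ hσ, pw_one hσ.1, nQ, qFid, matFun_sqrt, matFun_sqrt,
    show (1 + 1 : ℝ) = (2 : ℕ) by norm_num, Real.rpow_natCast]
  rfl

theorem IsDensity.rtr_eq {ρ : Matrix n n ℂ} (h : IsDensity ρ) : rtr ρ = 1 := by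
  rw [rtr, h.2, Complex.one_re]

theorem Qs_le_rpow {s : ℝ} (hs0 : 0 < s) (hs1 : s < 1) {ρ σ : Matrix n n ℂ}
    (hρ : IsDensity ρ) (hσ : σ.PosSemidef) : Qs s ρ σ ≤ Qs 1 ρ σ ^ s := by
  have hcont : Filter.Tendsto (fun ε : ℝ => (Qs 1 ρ σ + ε) ^ s)
      (nhdsWithin 0 (Set.Ioi 0)) (nhds (Qs 1 ρ σ ^ s)) := by
    have : Continuous fun ε : ℝ => (Qs 1 ρ σ + ε) ^ s :=
      Continuous.rpow_const (by fun_prop) fun _ => Or.inr hs0.le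
    have h := (this.tendsto 0).mono_left (nhdsWithin_le_nhds (s := Set.Ioi 0))
    simpa using h
  refine ge_of_tendsto hcont ?_
  filter_upwards [self_mem_nhdsWithin] with ε hε
  obtain ⟨Z, hZ, hZ1, hZ2⟩ := exists_Qs_near one_pos hρ.1 hσ (Set.mem_Ioi.1 hε)
  rw [pw_one hσ.1] at hZ2
  obtain ⟨V, z, rfl, hz⟩ := exists_specMat_pos hZ
  obtain ⟨U, b, rfl, hb⟩ := exists_specMat_nonneg hσ
  have hz' : ∀ i, 0 < z i ^ s := fun i => Real.rpow_pos_of_pos (hz i) _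
  have h1 := Qs_le_of_normalized hs0 hρ.1 (specMat_posSemidef U hb) ((specMat_posDef_iff V).2 hz')
    (by
      rw [pw_specMat, rtr_specMat] at hZ1 ⊢
      convert hZ1 using 2 with i
      rw [← Real.rpow_mul (hz i).le]
      congr 1
      field_simp)
  refine h1.trans ?_
  set R := pw (1 / 2) ρ with hR
  have hRc : R.conjTranspose = R := pw_conjTranspose _ hρ.1
  have htr : ∀ f g : n → ℝ, rtr (specMat U f * (R * specMat V g * R)) =
      ∑ p : n × n, Complex.normSq ((star (V : Matrix n n ℂ) * R * (U : Matrix n n ℂ)) p.1 p.2)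
        * (f p.2 * g p.1) := by
    intro f g
    rw [← rtr_sandwich_mul, Fintype.sum_prod_type]
    have := trace_mul_specMat R U f V g
    rw [hRc] at this
    exact this
  have hone := htr (fun _ => 1) (fun _ => 1)
  rw [specMat_one, specMat_one, one_mul, mul_one, hR, pw_half_mul_self hρ.1, hρ.rtr_eq] at hone
  rw [htr] at hZ2
  rw [pw_specMat, htr]
  have h := holder_weighted (Finset.univ : Finset (n × n))
    (c := fun p => Complex.normSq ((star (V : Matrix n n ℂ) * R * (U : Matrix n n ℂ)) p.1 p.2))
    (f := fun p => b p.2 * z p.1) (g := fun p => 1 * 1) hs0 hs1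
    (fun p _ => Complex.normSq_nonneg _) (fun p _ => mul_nonneg (hb _) (hz _).le)
    (fun p _ => by norm_num)
  rw [← hone, Real.one_rpow, mul_one] at h
  refine le_trans (le_trans (le_of_eq ?_) h) ?_
  · refine Finset.sum_congr rfl fun p _ => ?_
    rw [Real.mul_rpow (hb _) (hz _).le]
    simp
  · rw [mul_one]
    refine Real.rpow_le_rpow (Finset.sum_nonneg fun p _ => ?_) hZ2 hs0.le
    exact mul_nonneg (Complex.normSq_nonneg _) (mul_nonneg (hb _) (hz _).le)

theorem Qs_anti {s s' : ℝ} (hs0 : 0 < s) (hss : s ≤ s') (hs1 : s' ≤ 1) {ρ τ : Matrix n n ℂ}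
    (hρ : ρ.PosSemidef) (hτ : IsDensity τ) : Qs s' ρ τ ≤ Qs s ρ τ := by
  rcases hss.eq_or_lt with rfl | hlt
  · exact le_rfl
  have hs' : 0 < s' := by linarith
  have h1s : 0 < 1 + s := by linarith
  set R := pw (1 / 2) ρ with hR
  have hRc : R.conjTranspose = R := pw_conjTranspose _ hρ
  set Y := pw (s / 2) τ * R with hY
  have hYc : Y.conjTranspose = R * pw (s / 2) τ := by
    rw [hY, Matrix.conjTranspose_mul, hRc, pw_conjTranspose _ hτ.1]
  have hA0 : (Y.conjTranspose * Y).PosSemidef := Matrix.posSemidef_conjTranspose_mul_self Y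
  have hYY : Y.conjTranspose * Y = R * pw s τ * R := by
    rw [hYc, hY]
    calc _ = R * (pw (s / 2) τ * pw (s / 2) τ) * R := by simp only [Matrix.mul_assoc]
      _ = _ := by rw [pw_mul_pw (by linarith) hτ.1, add_halves]
  obtain ⟨U, a, hUa, ha⟩ := exists_specMat_nonneg hA0
  have e0 : Qs s ρ τ = (∑ i, a i ^ (1 / (1 + s))) ^ (1 + s) := by
    rw [Qs_eq hs0.ne' hρ hτ.1, ← hR, ← hYY, hUa, nQ, pw_specMat, rtr_specMat]
  set T : ℝ → ℝ := fun δ => ∑ i, (a i + δ) ^ (1 / (1 + s)) with hT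
  have hTc : Continuous T := by
    refine continuous_finsetSum _ fun i _ => ?_
    exact Continuous.rpow_const (by fun_prop) fun _ => Or.inr (by positivity)
  have hT0 : 0 ≤ T 0 := Finset.sum_nonneg fun i _ => Real.rpow_nonneg (by simpa using ha i) _
  have hlim : Filter.Tendsto (fun δ => T 0 ^ (1 - (s' - s)) * T δ ^ s')
      (nhdsWithin 0 (Set.Ioi 0)) (nhds (Qs s ρ τ)) := by
    have hc : Continuous fun δ => T 0 ^ (1 - (s' - s)) * T δ ^ s' :=
      continuous_const.mul (hTc.rpow_const fun _ => Or.inr hs'.le)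
    have h := (hc.tendsto 0).mono_left (nhdsWithin_le_nhds (s := Set.Ioi 0))
    have e : T 0 ^ (1 - (s' - s)) * T 0 ^ s' = Qs s ρ τ := by
      rw [e0, ← Real.rpow_add' hT0 (by linarith), hT]
      simp only [add_zero]
      congr 1
      ring
    rwa [e] at h
  refine ge_of_tendsto hlim ?_
  filter_upwards [self_mem_nhdsWithin] with δ hδ
  rw [Set.mem_Ioi] at hδ
  have hpos : ∀ i, 0 < a i + δ := fun i => by linarith [ha i]
  set β := s' / (1 + s) with hβ
  have hβ0 : 0 < β := by positivity
  have hβ1 : β < 1 := by rw [hβ, div_lt_one h1s]; linarith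
  set V := specMat U (fun i => (a i + δ) ^ (-β)) with hV
  set V' := specMat U (fun i => (a i + δ) ^ (-β / 2)) with hV'
  have hVV : V' * V' = V := by
    rw [hV', hV, specMat_mul]
    congr 1
    ext i
    rw [← Real.rpow_add (hpos i), add_halves]
  have hVp : V.PosDef := (specMat_posDef_iff U).2 fun i => Real.rpow_pos_of_pos (hpos i) _
  have hV'c : V'.conjTranspose = V' := (specMat_isHermitian U _)
  have h1 := nQ_le hs' (sandwich_posSemidef (pw_posSemidef (1 / 2) hρ) (pw_posSemidef s' hτ.1)) hVp
  rw [← hR, ← Qs_eq hs'.ne' hρ hτ.1] at h1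
  have e1 : rtr (pw (-(1 / s')) V) = T δ := by
    rw [hV, pw_specMat, rtr_specMat]
    refine Finset.sum_congr rfl fun i _ => ?_
    rw [← Real.rpow_mul (hpos i).le]
    congr 1
    rw [hβ]
    field_simp
  rw [e1] at h1
  have hK : (Y * V * Y.conjTranspose).PosSemidef := hVp.posSemidef.mul_mul_conjTranspose_same Y
  have e2 : rtr (R * pw s' τ * R * V) = rtr (pw (s' - s) τ * (Y * V * Y.conjTranspose)) := by
    have : pw s' τ = pw (s / 2) τ * pw (s' - s) τ * pw (s / 2) τ := by
      rw [pw_mul_pw (by linarith) hτ.1, pw_mul_pw (by linarith) hτ.1]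
      congr 1
      ring
    rw [this, hYc, hY]
    calc _ = rtr ((R * pw (s / 2) τ) * (pw (s' - s) τ * (pw (s / 2) τ * R * V))) := by
          simp only [Matrix.mul_assoc]
      _ = _ := by
          rw [rtr_mul_comm]; simp only [Matrix.mul_assoc]
  have hd0 : 0 < s' - s := by linarith
  have hd1 : s' - s < 1 := by linarith
  have h2 := trace_holder hd0 hd1 (pw_posSemidef (s' - s) hτ.1) hK
  rw [pw_pw hτ.1, mul_one_div_cancel hd0.ne', pw_one hτ.1.1, hτ.rtr_eq, Real.one_rpow, one_mul,
    ← e2] at h2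
  have e3 : rtr (pw (1 / (1 - (s' - s))) (Y * V * Y.conjTranspose)) =
      ∑ i, (a i * (a i + δ) ^ (-β)) ^ (1 / (1 - (s' - s))) := by
    have e4 : Y * V * Y.conjTranspose = (Y * V') * (Y * V').conjTranspose := by
      rw [Matrix.conjTranspose_mul Y V', hV'c, ← hVV]
      simp only [Matrix.mul_assoc]
    have e5 : (Y * V').conjTranspose * (Y * V') = specMat U (fun i => a i * (a i + δ) ^ (-β)) := by
      rw [Matrix.conjTranspose_mul Y V', hV'c]
      calc _ = V' * (Y.conjTranspose * Y) * V' := by simp only [Matrix.mul_assoc]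
        _ = _ := by
          rw [hUa, hV', specMat_mul, specMat_mul]
          congr 1
          ext i
          rw [mul_assoc, mul_comm, mul_assoc, ← Real.rpow_add (hpos i), add_halves]
    rw [e4, rtr_pw_swap, e5, pw_specMat, rtr_specMat]
  have h3 : ∑ i, (a i * (a i + δ) ^ (-β)) ^ (1 / (1 - (s' - s))) ≤ T 0 := by
    refine Finset.sum_le_sum fun i _ => ?_
    rw [add_zero]
    have hle : a i * (a i + δ) ^ (-β) ≤ a i ^ (1 - β) := by
      rcases (ha i).eq_or_lt with h0 | h0
      · rw [← h0, zero_mul]; exact Real.rpow_nonneg le_rfl _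
      · rw [sub_eq_add_neg, Real.rpow_add h0, Real.rpow_one]
        refine mul_le_mul_of_nonneg_left ?_ h0.le
        exact Real.rpow_le_rpow_of_nonpos h0 (by linarith) (by linarith)
    have h := Real.rpow_le_rpow (mul_nonneg (ha i) (Real.rpow_nonneg (hpos i).le _)) hle
      (z := 1 / (1 - (s' - s))) (by apply div_nonneg <;> linarith)
    refine h.trans (le_of_eq ?_)
    rw [← Real.rpow_mul (ha i)]
    congr 1
    rw [hβ]
    have : 1 - (s' - s) ≠ 0 := by linarith
    field_simp
    ring
  rw [e3] at h2
  have n3 : 0 ≤ ∑ i, (a i * (a i + δ) ^ (-β)) ^ (1 / (1 - (s' - s))) :=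
    Finset.sum_nonneg fun i _ =>
      Real.rpow_nonneg (mul_nonneg (ha i) (Real.rpow_nonneg (hpos i).le _)) _
  refine h1.trans (mul_le_mul_of_nonneg_right (h2.trans ?_) (Real.rpow_nonneg
    (Finset.sum_nonneg fun i _ => Real.rpow_nonneg (hpos i).le _) _))
  exact Real.rpow_le_rpow n3 h3 (by linarith)

theorem qFid_le {s : ℝ} (hs0 : 0 < s) (hs1 : s ≤ 1) {ρ σ τ Z : Matrix n n ℂ} {M : ℝ}
    (hM : 0 ≤ M) (hρ : ρ.PosSemidef) (hσ : σ.PosSemidef) (hτ : IsDensity τ)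
    (h : (M • σ - τ).PosSemidef) (hZ : Z.PosDef) (hZ1 : rtr (pw (-(1 / s)) Z) ≤ 1) :
    qFid ρ τ ≤ M ^ s * rtr (pw s σ * (pw (1 / 2) ρ * Z * pw (1 / 2) ρ)) := by
  rw [qFid_eq hρ hτ.1]
  refine (Qs_anti hs0 hs1 le_rfl hρ hτ).trans ?_
  refine (Qs_mono hs0 hs1 hρ hτ.1 h).trans ?_
  rw [Qs_smul hs0 hρ hσ hM]
  exact mul_le_mul_of_nonneg_left (Qs_le_of_normalized hs0 hρ hσ hZ hZ1) (Real.rpow_nonneg hM _)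

theorem le_qFid {ρ τ D : Matrix n n ℂ} (hρ : ρ.PosSemidef) (hτ : τ.PosSemidef)
    (hD : D.PosSemidef) (h : (τ - D * ρ * D).PosSemidef) : (rtr (D * ρ)) ^ 2 ≤ qFid ρ τ := by
  rw [qFid_eq hρ hτ, Qs_eq one_ne_zero hρ hτ, pw_one hτ.1]
  set R := pw (1 / 2) ρ with hR
  have hRp : R.PosSemidef := pw_posSemidef _ hρ
  have hB : (R * D * R).PosSemidef := sandwich_posSemidef hRp hD
  have h1 : nQ 1 (R * (D * ρ * D) * R) ≤ nQ 1 (R * τ * R) := by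
    refine nQ_mono one_pos (sandwich_posSemidef hRp (sandwich_posSemidef hD hρ)) ?_
    rw [sandwich_sub]
    exact sandwich_posSemidef hRp h
  refine le_trans (le_of_eq ?_) h1
  have e1 : R * (D * ρ * D) * R = (R * D * R) * (R * D * R) := by
    calc _ = R * (D * (R * R) * D) * R := by rw [hR, pw_half_mul_self hρ]
      _ = _ := by simp only [Matrix.mul_assoc]
  have e2 : pw (1 / (1 + 1)) ((R * D * R) * (R * D * R)) = R * D * R := by
    obtain ⟨U, a, hUa, ha⟩ := exists_specMat_nonneg hB
    rw [hUa, specMat_mul, pw_specMat]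
    congr 1
    ext i
    rw [show (1 / (1 + 1) : ℝ) = 1 / 2 by norm_num, ← Real.sqrt_eq_rpow,
      Real.sqrt_mul_self (ha i)]
  rw [e1, nQ, e2, show (1 + 1 : ℝ) = (2 : ℕ) by norm_num, Real.rpow_natCast]
  congr 1
  rw [rtr_mul_comm (R * D), ← Matrix.mul_assoc, hR, pw_half_mul_self hρ, rtr_mul_comm]

end Sandwiched

theorem trace_eq_rtr {m : Type*} [Fintype m] [DecidableEq m] {A : Matrix m m ℂ} (hA : A.PosSemidef) : A.trace = (rtr A : ℂ) := by
  obtain ⟨U, a, rfl, ha⟩ := exists_specMat_nonneg hA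
  rw [trace_specMat, rtr_specMat]

section Tensor

variable {ι : Type*} [Fintype ι] [DecidableEq ι] {B : ι → Type*} [∀ i, Fintype (B i)]
  [∀ i, DecidableEq (B i)]

/-- Tensor product of a family of matrices indexed by a finite type. -/
def piT (A : ∀ i, Matrix (B i) (B i) ℂ) : Matrix (∀ i, B i) (∀ i, B i) ℂ :=
  Matrix.of fun a b => ∏ i, A i (a i) (b i)

theorem piT_apply (A : ∀ i, Matrix (B i) (B i) ℂ) (a b : ∀ i, B i) : piT A a b = ∏ i, A i (a i) (b i) := rfl

theorem piT_mul (A A' : ∀ i, Matrix (B i) (B i) ℂ) : piT A * piT A' = piT (fun i => A i * A' i) := by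
  ext a b
  rw [Matrix.mul_apply, piT_apply]
  simp only [Matrix.mul_apply, piT_apply]
  rw [Finset.prod_univ_sum, Fintype.piFinset_univ]
  simp only [Finset.prod_mul_distrib]

theorem piT_one : piT (fun i : ι => (1 : Matrix (B i) (B i) ℂ)) = 1 := by
  ext a b
  rw [piT_apply]
  by_cases h : a = b
  · subst h; simp
  · rw [Matrix.one_apply_ne h]
    obtain ⟨i, hi⟩ := Function.ne_iff.1 h
    exact Finset.prod_eq_zero (Finset.mem_univ i) (Matrix.one_apply_ne hi)

theorem piT_conjTranspose (A : ∀ i, Matrix (B i) (B i) ℂ) :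
    (piT A).conjTranspose = piT (fun i => (A i).conjTranspose) := by
  ext a b
  simp [piT_apply, Matrix.conjTranspose_apply]

theorem trace_piT (A : ∀ i, Matrix (B i) (B i) ℂ) : (piT A).trace = ∏ i, (A i).trace := by
  simp only [Matrix.trace, Matrix.diag_apply, piT_apply]
  rw [Finset.prod_univ_sum, Fintype.piFinset_univ]

theorem piT_diagonal (a : ∀ i, B i → ℂ) :
    piT (fun i => Matrix.diagonal (a i)) = Matrix.diagonal (fun b => ∏ i, a i (b i)) := by
  ext b c
  rw [piT_apply]
  by_cases h : b = c
  · subst h; simp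
  · rw [Matrix.diagonal_apply_ne _ h]
    obtain ⟨i, hi⟩ := Function.ne_iff.1 h
    exact Finset.prod_eq_zero (Finset.mem_univ i) (Matrix.diagonal_apply_ne _ hi)

theorem piT_smul (c : ι → ℝ) (A : ∀ i, Matrix (B i) (B i) ℂ) :
    piT (fun i => c i • A i) = (∏ i, c i) • piT A := by
  ext a b
  simp only [piT_apply, Matrix.smul_apply, Complex.real_smul, Finset.prod_mul_distrib]
  push_cast
  rfl

theorem piT_sum {J : Type*} [Fintype J] (A : ∀ i, J → Matrix (B i) (B i) ℂ) :
    piT (fun i => ∑ j, A i j) = ∑ f : ι → J, piT (fun i => A i (f i)) := by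
  ext a b
  simp only [piT_apply, Matrix.sum_apply]
  rw [Finset.prod_univ_sum, Fintype.piFinset_univ]

/-- Tensor product of unitaries. -/
def piU (U : ∀ i, Matrix.unitaryGroup (B i) ℂ) : Matrix.unitaryGroup (∀ i, B i) ℂ :=
  ⟨piT (fun i => (U i : Matrix (B i) (B i) ℂ)), by
    rw [Matrix.mem_unitaryGroup_iff, Matrix.star_eq_conjTranspose, piT_conjTranspose, piT_mul,
      ← piT_one]
    congr 1
    ext1 i
    exact self_mul_star_unitary (U i)⟩

theorem piT_specMat (U : ∀ i, Matrix.unitaryGroup (B i) ℂ) (a : ∀ i, B i → ℝ) :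
    piT (fun i => specMat (U i) (a i)) = specMat (piU U) (fun b => ∏ i, a i (b i)) := by
  have : (fun i => specMat (U i) (a i)) = fun i => ((U i : Matrix (B i) (B i) ℂ) *
    Matrix.diagonal (fun j => (a i j : ℂ))) * (U i : Matrix (B i) (B i) ℂ).conjTranspose := rfl
  rw [this, ← piT_mul, ← piT_mul, piT_diagonal, ← piT_conjTranspose]
  unfold specMat
  push_cast
  rfl

theorem pw_piT (p : ℝ) {A : ∀ i, Matrix (B i) (B i) ℂ} (hA : ∀ i, (A i).PosSemidef) :
    pw p (piT A) = piT (fun i => pw p (A i)) := by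
  choose U a hUa ha using fun i => exists_specMat_nonneg (hA i)
  have : A = fun i => specMat (U i) (a i) := funext hUa
  subst this
  simp only [piT_specMat, pw_specMat]
  congr 1
  ext b
  rw [Real.finsetProd_rpow _ _ fun i _ => ha i _]

theorem piT_posSemidef {A : ∀ i, Matrix (B i) (B i) ℂ} (hA : ∀ i, (A i).PosSemidef) :
    (piT A).PosSemidef := by
  choose U a hUa ha using fun i => exists_specMat_nonneg (hA i)
  have : A = fun i => specMat (U i) (a i) := funext hUa
  subst this
  rw [piT_specMat]
  exact specMat_posSemidef _ fun b => Finset.prod_nonneg fun i _ => ha i _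

theorem piT_posDef {A : ∀ i, Matrix (B i) (B i) ℂ} (hA : ∀ i, (A i).PosDef) :
    (piT A).PosDef := by
  choose U a hUa ha using fun i => exists_specMat_pos (hA i)
  have : A = fun i => specMat (U i) (a i) := funext hUa
  subst this
  rw [piT_specMat]
  exact (specMat_posDef_iff _).2 fun b => Finset.prod_pos fun i _ => ha i _

theorem piT_isDensity {A : ∀ i, Matrix (B i) (B i) ℂ} (hA : ∀ i, IsDensity (A i)) :
    IsDensity (piT A) :=
  ⟨piT_posSemidef fun i => (hA i).1, by rw [trace_piT]; simp [fun i => (hA i).2]⟩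

theorem rtr_piT {A : ∀ i, Matrix (B i) (B i) ℂ} (hA : ∀ i, (A i).PosSemidef) :
    rtr (piT A) = ∏ i, rtr (A i) := by
  rw [rtr, trace_piT]
  simp only [fun i => trace_eq_rtr (hA i)]
  rw [← Complex.ofReal_prod, Complex.ofReal_re]

theorem rtr_piT_mul {A A' : ∀ i, Matrix (B i) (B i) ℂ} (hA : ∀ i, (A i).PosSemidef)
    (hA' : ∀ i, (A' i).PosSemidef) :
    rtr (piT A * piT A') = ∏ i, rtr (A i * A' i) := by
  have key : ∀ i, (A i * A' i).trace = (rtr (A i * A' i) : ℂ) := by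
    intro i
    have h1 : (A i * A' i).trace = (pw (1 / 2) (A i) * A' i * pw (1 / 2) (A i)).trace := by
      conv_lhs => rw [← pw_half_mul_self (hA i), Matrix.mul_assoc, Matrix.trace_mul_comm]
    have h2 := trace_eq_rtr (sandwich_posSemidef (pw_posSemidef (1 / 2) (hA i)) (hA' i))
    rw [rtr, h1, h2, Complex.ofReal_re]
  rw [piT_mul, rtr, trace_piT]
  simp only [key]
  rw [← Complex.ofReal_prod, Complex.ofReal_re]

theorem nQ_piT (s : ℝ) {A : ∀ i, Matrix (B i) (B i) ℂ} (hA : ∀ i, (A i).PosSemidef) :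
    nQ s (piT A) = ∏ i, nQ s (A i) := by
  simp only [nQ]
  rw [pw_piT _ hA, rtr_piT fun i => pw_posSemidef _ (hA i),
    Real.finsetProd_rpow _ _ fun i _ => rtr_nonneg (pw_posSemidef _ (hA i))]

theorem Qs_piT (s : ℝ) {A S : ∀ i, Matrix (B i) (B i) ℂ} (hA : ∀ i, (A i).PosSemidef)
    (hS : ∀ i, (S i).PosSemidef) :
    Qs s (piT A) (piT S) = ∏ i, Qs s (A i) (S i) := by
  simp only [Qs]
  rw [pw_piT _ hS, piT_mul, piT_mul,
    nQ_piT s fun i => sandwich_posSemidef (pw_posSemidef _ (hS i)) (hA i)]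

/-- Tensor products are monotone on positive semidefinite matrices. -/
theorem piT_mono {A A' : ∀ i, Matrix (B i) (B i) ℂ} (hA : ∀ i, (A i).PosSemidef)
    (h : ∀ i, (A' i - A i).PosSemidef) : (piT A' - piT A).PosSemidef := by
  have h1 : piT A' = ∑ t ∈ (Finset.univ : Finset ι).powerset,
      piT (fun i => if i ∈ t then A i else A' i - A i) := by
    ext a b
    rw [Matrix.sum_apply, piT_apply]
    have : ∀ i, A' i (a i) (b i) = A i (a i) (b i) + (A' i - A i) (a i) (b i) := by
      intro i; simp
    simp only [this]
    rw [Finset.prod_add]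
    refine Finset.sum_congr rfl fun t ht => ?_
    rw [piT_apply]
    rw [← Finset.prod_sdiff (Finset.subset_univ t), mul_comm]
    congr 1
    · refine Finset.prod_congr rfl fun i hi => ?_
      rw [if_neg (Finset.mem_sdiff.1 hi).2]
    · refine Finset.prod_congr rfl fun i hi => ?_
      rw [if_pos hi]
  have hmem : (Finset.univ : Finset ι) ∈ (Finset.univ : Finset ι).powerset := by simp
  rw [h1, ← Finset.add_sum_erase _ _ hmem]
  have h2 : piT (fun i => if i ∈ (Finset.univ : Finset ι) then A i else A' i - A i) = piT A := by
    simp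
  rw [h2, add_sub_cancel_left]
  refine Matrix.posSemidef_sum _ fun t _ => piT_posSemidef fun i => ?_
  split_ifs
  · exact hA i
  · exact h i

end Tensor

section Minimax

variable {n : Type*} [Fintype n] [DecidableEq n]

theorem continuous_rtr_mul_right (K : Matrix n n ℂ) :
    Continuous fun S : Matrix n n ℂ => rtr (S * K) :=
  Complex.continuous_re.comp ((continuous_id.matrix_mul continuous_const).matrix_trace)

theorem continuous_rtr_mul_left (S : Matrix n n ℂ) :
    Continuous fun K : Matrix n n ℂ => rtr (S * K) :=
  Complex.continuous_re.comp ((continuous_const.matrix_mul continuous_id).matrix_trace)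

theorem isClosed_posSemidef : IsClosed {S : Matrix n n ℂ | S.PosSemidef} := by
  have : {S : Matrix n n ℂ | S.PosSemidef} =
      {S | S.conjTranspose = S} ∩ ⋂ x : n → ℂ, {S | 0 ≤ dotProduct (star x) (S.mulVec x)} := by
    ext S
    simp only [Set.mem_ofPred_eq, Set.mem_inter_iff, Set.mem_iInter]
    exact Matrix.posSemidef_iff_dotProduct_mulVec
  rw [this]
  refine (isClosed_eq (by fun_prop) (by fun_prop)).inter (isClosed_iInter fun x => ?_)
  have hc : Continuous fun S : Matrix n n ℂ => dotProduct (star x) (S.mulVec x) :=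
    continuous_const.dotProduct (continuous_id.matrix_mulVec continuous_const)
  exact isClosed_le continuous_const hc

theorem norm_entry_le_rtr {S : Matrix n n ℂ} (hS : S.PosSemidef) (i j : n) :
    ‖S i j‖ ≤ rtr S := by
  obtain ⟨U, a, rfl, ha⟩ := exists_specMat_nonneg hS
  rw [rtr_specMat, specMat, Matrix.mul_assoc, Matrix.mul_apply]
  refine (norm_sum_le _ _).trans (Finset.sum_le_sum fun k _ => ?_)
  rw [Matrix.diagonal_mul, norm_mul, norm_mul, Matrix.star_apply, norm_star, Complex.norm_real,
    Real.norm_of_nonneg (ha k)]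
  have h1 := entry_norm_bound_of_unitary U.2 i k
  have h2 := entry_norm_bound_of_unitary U.2 j k
  have h0 := norm_nonneg ((U : Matrix n n ℂ) j k)
  calc _ ≤ 1 * (a k * 1) := by
        have := ha k
        gcongr
    _ = a k := by ring

/-- The positive part of the unit ball dual to the Schatten norm of exponent `1 / (1 - s)`. -/
def dualBall (n : Type*) [Fintype n] [DecidableEq n] (s : ℝ) : Set (Matrix n n ℂ) :=
  {S | S.PosSemidef ∧ ∀ K : Matrix n n ℂ, K.PosSemidef → rtr (pw (1 / (1 - s)) K) ≤ 1 →
    rtr (S * K) ≤ 1}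

theorem dualBall_convex (s : ℝ) : Convex ℝ (dualBall n s) := by
  rintro S ⟨hS, hS'⟩ T ⟨hT, hT'⟩ a b ha hb hab
  refine ⟨(hS.smul ha).add (hT.smul hb), fun K hK hK1 => ?_⟩
  rw [Matrix.add_mul, rtr_add, Matrix.smul_mul, Matrix.smul_mul, rtr_smul, rtr_smul]
  have h1 := mul_le_mul_of_nonneg_left (hS' K hK hK1) ha
  have h2 := mul_le_mul_of_nonneg_left (hT' K hK hK1) hb
  linarith

theorem dualBall_isCompact [Nonempty n] {s : ℝ} (hs1 : s < 1) :
    IsCompact (dualBall n s) := by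
  have hclosed : IsClosed (dualBall n s) := by
    have : dualBall n s = {S : Matrix n n ℂ | S.PosSemidef} ∩
        ⋂ K : {K : Matrix n n ℂ // K.PosSemidef ∧ rtr (pw (1 / (1 - s)) K) ≤ 1},
          {S | rtr (S * K.1) ≤ 1} := by
      ext S
      simp [dualBall]
    rw [this]
    exact isClosed_posSemidef.inter (isClosed_iInter fun K =>
      isClosed_le (continuous_rtr_mul_right _) continuous_const)
  have hq : 0 < 1 - s := by linarith
  set N : ℝ := (Fintype.card n : ℝ) with hN
  have hN0 : 0 < N := by rw [hN]; exact_mod_cast Fintype.card_pos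
  set c : ℝ := (1 / N) ^ (1 - s) with hc
  have hc0 : 0 < c := by positivity
  have hbound : ∀ S ∈ dualBall n s, rtr S ≤ 1 / c := by
    rintro S ⟨hS, hS'⟩
    have h1 := hS' (specMat 1 fun _ => c) (specMat_posSemidef _ fun _ => hc0.le) (by
      rw [pw_specMat, rtr_specMat, Finset.sum_const, Finset.card_univ, hc, ← Real.rpow_mul
        (by positivity), mul_one_div_cancel hq.ne', Real.rpow_one, nsmul_eq_mul, ← hN,
        mul_one_div_cancel hN0.ne'])
    rw [specMat_const, Matrix.mul_smul, rtr_smul, mul_one] at h1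
    rw [le_div_iff₀ hc0]
    linarith
  refine IsCompact.of_isClosed_subset
    (isCompact_univ_pi fun _ : n => isCompact_univ_pi fun _ : n =>
      isCompact_closedBall (0 : ℂ) (1 / c)) hclosed ?_
  intro S hS
  exact fun i _ j _ => mem_closedBall_zero_iff.2 <| (norm_entry_le_rtr hS.1 i j).trans (hbound S hS)

theorem rtr_pw_le_of_mem_dualBall {s : ℝ} (hs0 : 0 < s) (hs1 : s < 1) {S : Matrix n n ℂ}
    (hS : S ∈ dualBall n s) : rtr (pw (1 / s) S) ≤ 1 := by
  have hq : 0 < 1 - s := by linarith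
  have hps := pw_posSemidef (1 / s) hS.1
  have ht0 := rtr_nonneg hps
  rcases ht0.eq_or_lt with h | ht
  · rw [← h]; exact zero_le_one
  set t := rtr (pw (1 / s) S) with htdef
  have hK : pw ((1 - s) / s) S = pw ((1 - s) / s) S := rfl
  have h1 := hS.2 ((t ^ (-(1 - s))) • pw ((1 - s) / s) S)
    ((pw_posSemidef _ hS.1).smul (Real.rpow_nonneg ht0 _)) (by
      rw [pw_smul _ (Real.rpow_nonneg ht0 _) (pw_posSemidef _ hS.1), pw_pw hS.1, rtr_smul,
        ← Real.rpow_mul ht0, show (1 - s) / s * (1 / (1 - s)) = 1 / s by field_simp, ← htdef,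
        show -(1 - s) * (1 / (1 - s)) = -1 by field_simp, Real.rpow_neg_one,
        inv_mul_cancel₀ ht.ne'])
  have h2 : S * pw ((1 - s) / s) S = pw (1 / s) S := by
    conv_lhs => rw [← pw_one hS.1.1]
    rw [pw_pw hS.1, one_mul, pw_mul_pw (by
      have : 0 < (1 - s) / s := by positivity
      positivity) hS.1]
    congr 1
    field_simp
    ring
  rw [Matrix.mul_smul, rtr_smul, h2, ← htdef] at h1
  have h3 : t ^ (-(1 - s)) * t = t ^ s := by
    conv_lhs => rw [← Real.rpow_one t, ← Real.rpow_mul ht0, ← Real.rpow_add ht]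
    congr 1; ring
  rw [h3] at h1
  by_contra hcon
  push Not at hcon
  exact absurd h1 (not_le.2 (Real.one_lt_rpow hcon hs0))

theorem mem_dualBall_of_rtr_pw_le {s : ℝ} (hs0 : 0 < s) (hs1 : s < 1) {S : Matrix n n ℂ}
    (hS : S.PosSemidef) (h : rtr (pw (1 / s) S) ≤ 1) : S ∈ dualBall n s := by
  refine ⟨hS, fun K hK hK1 => (trace_holder hs0 hs1 hS hK).trans ?_⟩
  exact mul_le_one₀ (Real.rpow_le_one (rtr_nonneg (pw_posSemidef _ hS)) h hs0.le)
    (Real.rpow_nonneg (rtr_nonneg (pw_posSemidef _ hK)) _)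
    (Real.rpow_le_one (rtr_nonneg (pw_posSemidef _ hK)) hK1 (by linarith))

/-- Minimax duality for the sandwiched quantity: if no density `σ` makes all `Qs s (W x) σ`
at least `c`, then a mixture of dual operators has Schatten norm at most `c`. -/
theorem exists_mixture_of_forall_lt [Nonempty n] {X : Type*} {W : X → Matrix n n ℂ}
    (hW : ∀ x, (W x).PosSemidef) {s : ℝ} (hs0 : 0 < s) (hs1 : s < 1) {c : ℝ} (hc : 0 < c)
    (h : ∀ σ : Matrix n n ℂ, IsDensity σ → ∃ x, Qs s (W x) σ < c) :
    ∃ (J : Type) (_ : Fintype J) (w : J → ℝ) (x : J → X) (Z : J → Matrix n n ℂ),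
      (∀ j, 0 ≤ w j) ∧ ∑ j, w j = 1 ∧ (∀ j, (Z j).PosDef) ∧
      (∀ j, rtr (pw (-(1 / s)) (Z j)) ≤ 1) ∧
      (rtr (pw (1 / (1 - s)) (∑ j, w j • (pw (1 / 2) (W (x j)) * Z j * pw (1 / 2) (W (x j))))))
        ^ (1 - s) ≤ c := by
  set G : Set (Matrix n n ℂ) := {K | ∃ x Z, Matrix.PosDef Z ∧ rtr (pw (-(1 / s)) Z) ≤ 1 ∧
    K = pw (1 / 2) (W x) * Z * pw (1 / 2) (W x)} with hG
  have hGpsd : ∀ K ∈ G, K.PosSemidef := by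
    rintro K ⟨x, Z, hZ, -, rfl⟩
    exact sandwich_posSemidef (pw_posSemidef _ (hW x)) hZ.posSemidef
  have hsep : ∀ S ∈ dualBall n s, ∃ K ∈ G, rtr (S * K) < c := by
    intro S hS
    have ht1 := rtr_pw_le_of_mem_dualBall hs0 hs1 hS
    have hps := pw_posSemidef (1 / s) hS.1
    have ht0 := rtr_nonneg hps
    set t := rtr (pw (1 / s) S) with htdef
    rcases ht0.eq_or_lt with h0 | ht
    · obtain ⟨x, hx⟩ : ∃ x : X, True := by
        obtain ⟨x, -⟩ := h ((1 / (Fintype.card n : ℝ)) • 1) ⟨Matrix.PosSemidef.one.smul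
          (by positivity), by
            rw [Matrix.trace_smul, Matrix.trace_one]
            have : (Fintype.card n : ℂ) ≠ 0 := by exact_mod_cast Fintype.card_ne_zero
            simp [this]⟩
        exact ⟨x, trivial⟩
      obtain ⟨Z, hZ, hZ1, hZ2⟩ := exists_Qs_near hs0 (hW x) hps one_pos
      refine ⟨_, ⟨x, Z, hZ, hZ1, rfl⟩, ?_⟩
      have hK := hGpsd _ ⟨x, Z, hZ, hZ1, rfl⟩
      have := trace_holder hs0 hs1 hS.1 hK
      rw [← htdef, ← h0, Real.zero_rpow hs0.ne', zero_mul] at this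
      linarith
    · have hσd : IsDensity (t⁻¹ • pw (1 / s) S) :=
        ⟨hps.smul (inv_nonneg.2 ht0), by
          rw [Matrix.trace_smul, trace_eq_rtr hps, ← htdef, Complex.real_smul,
            ← Complex.ofReal_mul, inv_mul_cancel₀ ht.ne', Complex.ofReal_one]⟩
      obtain ⟨x, hx⟩ := h _ hσd
      obtain ⟨Z, hZ, hZ1, hZ2⟩ := exists_Qs_near hs0 (hW x) hσd.1 (half_pos (sub_pos.2 hx))
      refine ⟨_, ⟨x, Z, hZ, hZ1, rfl⟩, ?_⟩
      have hK := hGpsd _ ⟨x, Z, hZ, hZ1, rfl⟩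
      rw [pw_smul _ (inv_nonneg.2 ht0) hps, pw_pw hS.1, one_div_mul_cancel hs0.ne',
        pw_one hS.1.1, Matrix.smul_mul, rtr_smul] at hZ2
      have h1 : 1 ≤ t⁻¹ ^ s := Real.one_le_rpow ((one_le_inv₀ ht).2 ht1) hs0.le
      have h2 := rtr_mul_nonneg hS.1 hK
      nlinarith
  -- finite subcover
  obtain ⟨F, hFG, hF⟩ : ∃ F : Set (Matrix n n ℂ), (F ⊆ G ∧ F.Finite) ∧
      ∀ S ∈ dualBall n s, ∃ K ∈ F, rtr (S * K) < c := by
    obtain ⟨t, ht1, ht2, ht3⟩ := (dualBall_isCompact (n := n) hs1).elim_finite_subcover_image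
      (b := G) (c := fun K => {S | rtr (S * K) < c})
      (fun K _ => isOpen_lt (continuous_rtr_mul_right K) continuous_const) (by
        intro S hS
        obtain ⟨K, hK, hK'⟩ := hsep S hS
        simp only [Set.mem_iUnion]
        exact ⟨K, hK, hK'⟩)
    refine ⟨t, ⟨ht1, ht2⟩, fun S hS => ?_⟩
    have := ht3 hS
    simp only [Set.mem_iUnion] at this
    obtain ⟨K, hK, hK'⟩ := this
    exact ⟨K, hK, hK'⟩
  have hne : (dualBall n s).Nonempty := by
    refine ⟨specMat 1 fun _ => 0, mem_dualBall_of_rtr_pw_le hs0 hs1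
      (specMat_posSemidef _ fun _ => le_rfl) ?_⟩
    rw [pw_specMat, rtr_specMat, Real.zero_rpow (by positivity), Finset.sum_const_zero]
    exact zero_le_one
  obtain ⟨K0, hK0, hlt⟩ := Sion.exists_lt_iInf_of_lt_iInf_of_finite (E := Matrix n n ℂ)
    (F := Matrix n n ℂ) (β := ℝ) (X := dualBall n s) (Y := convexHull ℝ G)
    (f := fun S K => -rtr (S * K)) hne (dualBall_isCompact hs1)
    (fun K _ => (continuous_rtr_mul_right K).neg.lowerSemicontinuous.lowerSemicontinuousOn _)
    (fun K _ => ConvexOn.quasiconvexOn ⟨dualBall_convex s, fun S _ T _ a b _ _ _ => by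
      simp only [Matrix.add_mul, rtr_add, Matrix.smul_mul, rtr_smul, smul_eq_mul]
      linarith⟩)
    (convex_convexHull ℝ G)
    (fun S _ => (continuous_rtr_mul_left S).neg.upperSemicontinuous.upperSemicontinuousOn _)
    (fun S _ => ConcaveOn.quasiconcaveOn ⟨convex_convexHull ℝ G, fun K _ L _ a b _ _ _ => by
      simp only [Matrix.mul_add, rtr_add, Matrix.mul_smul, rtr_smul, smul_eq_mul]
      linarith⟩)
    (dualBall_convex s) hFG.2 (hFG.1.trans (subset_convexHull ℝ G)) (t := -c)
    (fun S hS => by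
      obtain ⟨K, hK, hK'⟩ := hF S hS
      exact ⟨K, hK, neg_lt_neg hK'⟩)
  rw [mem_convexHull_iff_exists_fintype] at hK0
  obtain ⟨J, hJ, w, z, hw0, hw1, hz, hsum⟩ := hK0
  choose x Z hZ hZ1 hzeq using hz
  obtain ⟨e⟩ : Nonempty (J ≃ Fin (Fintype.card J)) := ⟨Fintype.equivFin J⟩
  have hsum' : ∑ j, w j • (pw (1 / 2) (W (x j)) * Z j * pw (1 / 2) (W (x j))) = K0 := by
    rw [← hsum]
    exact Finset.sum_congr rfl fun j _ => by rw [← hzeq]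
  refine ⟨Fin (Fintype.card J), inferInstance, w ∘ e.symm, x ∘ e.symm, Z ∘ e.symm,
    fun j => hw0 _, ?_, fun j => hZ _, fun j => hZ1 _, ?_⟩
  · rw [← hw1]
    exact Equiv.sum_comp e.symm w
  simp only [Function.comp]
  rw [Equiv.sum_comp e.symm
    (fun j => w j • (pw (1 / 2) (W (x j)) * Z j * pw (1 / 2) (W (x j)))), hsum']
  have hK0psd : K0.PosSemidef := by
    rw [← hsum]
    exact Matrix.posSemidef_sum _ fun j _ => (hGpsd _ ⟨_, _, hZ j, hZ1 j, hzeq j⟩).smul (hw0 j)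
  have hq : 0 < 1 - s := by linarith
  have hT0 := rtr_nonneg (pw_posSemidef (1 / (1 - s)) hK0psd)
  set T := rtr (pw (1 / (1 - s)) K0) with hT
  rcases hT0.eq_or_lt with h0 | hTpos
  · rw [← h0, Real.zero_rpow hq.ne']
    exact hc.le
  have hps := pw_posSemidef (s / (1 - s)) hK0psd
  have hmem : T ^ (-s) • pw (s / (1 - s)) K0 ∈ dualBall n s := by
    refine mem_dualBall_of_rtr_pw_le hs0 hs1 (hps.smul (Real.rpow_nonneg hT0 _)) ?_
    rw [pw_smul _ (Real.rpow_nonneg hT0 _) hps, pw_pw hK0psd, rtr_smul, ← Real.rpow_mul hT0,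
      show s / (1 - s) * (1 / s) = 1 / (1 - s) by field_simp, ← hT,
      show -s * (1 / s) = -1 by field_simp, Real.rpow_neg_one, inv_mul_cancel₀ hTpos.ne']
  have h1 := hlt _ hmem
  have h2 : pw (s / (1 - s)) K0 * K0 = pw (1 / (1 - s)) K0 := by
    conv_lhs => rw [← pw_one hK0psd.1]
    rw [pw_pw hK0psd, one_mul, pw_mul_pw (by
      have : 0 < s / (1 - s) := by positivity
      positivity) hK0psd]
    congr 1
    field_simp
    ring
  simp only [Matrix.smul_mul, rtr_smul, h2, ← hT] at h1
  have h3 : T ^ (-s) * T = T ^ (1 - s) := by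
    conv_lhs => rw [← Real.rpow_one T, ← Real.rpow_mul hT0, ← Real.rpow_add hTpos]
    congr 1; ring
  rw [h3] at h1
  linarith

end Minimax

section Converse

variable {X : Type*} [Fintype X] [Nonempty X] {B : Type*} [Fintype B] [DecidableEq B]

theorem qFid_nonneg (ρ σ : Matrix B B ℂ) : 0 ≤ qFid ρ σ := sq_nonneg _

theorem qPD_nonneg (ρ σ : Matrix B B ℂ) : 0 ≤ qPD ρ σ := Real.sqrt_nonneg _

theorem one_sub_qFid_le_qPD (ρ σ : Matrix B B ℂ) : 1 - qFid ρ σ ≤ qPD ρ σ := by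
  have h := qFid_nonneg ρ σ
  rcases le_or_gt (1 - qFid ρ σ) 0 with h0 | h0
  · exact h0.trans (qPD_nonneg ρ σ)
  · exact Real.le_sqrt_of_sq_le (by nlinarith)

theorem qEpsNS_nonneg (W : X → Matrix B B ℂ) (M : ℝ) : 0 ≤ qEpsNS W M := by
  refine Real.sInf_nonneg ?_
  rintro e ⟨W', σ, -, -, -, rfl⟩
  exact Real.iSup_nonneg fun x => qPD_nonneg _ _

/-- One-shot converse: an upper bound on some fidelity for every feasible channel. -/
theorem one_sub_qEpsNS_le_of_forall {W : X → Matrix B B ℂ} (hW : ∀ x, IsDensity (W x)) {M b : ℝ}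
    (hM : 1 ≤ M)
    (h : ∀ (W' : X → Matrix B B ℂ) (σ : Matrix B B ℂ), (∀ x, IsDensity (W' x)) → IsDensity σ →
      (∀ x, (M • σ - W' x).PosSemidef) → ∃ x, qFid (W x) (W' x) ≤ b) :
    1 - qEpsNS W M ≤ b := by
  have : 1 - b ≤ qEpsNS W M := by
    refine le_csInf ?_ ?_
    · obtain ⟨x0⟩ := ‹Nonempty X›
      refine ⟨_, fun _ => W x0, W x0, fun _ => hW x0, hW x0, fun _ => ?_, rfl⟩
      have : M • W x0 - W x0 = (M - 1) • W x0 := by rw [sub_smul, one_smul]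
      rw [this]
      exact (hW x0).1.smul (by linarith)
    · rintro e ⟨W', σ, hW', hσ, hM', rfl⟩
      obtain ⟨x, hx⟩ := h W' σ hW' hσ hM'
      refine le_trans ?_ (le_ciSup (Set.finite_range _).bddAbove x)
      linarith [one_sub_qFid_le_qPD (W x) (W' x)]
  linarith

theorem cqPow_isDensity {W : X → Matrix B B ℂ} (hW : ∀ x, IsDensity (W x)) (n : ℕ)
    (xs : Fin n → X) : IsDensity (cqPow W n xs) :=
  piT_isDensity fun i => hW (xs i)

/-- Upper bound on the success of simulating the product channel. -/
theorem one_sub_qEpsNS_cqPow_le [Nonempty B] {W : X → Matrix B B ℂ}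
    (hW : ∀ x, IsDensity (W x)) {s : ℝ} (hs0 : 0 < s) (hs1 : s < 1) {c : ℝ} (hc : 0 < c)
    (h : ∀ σ : Matrix B B ℂ, IsDensity σ → ∃ x, Qs s (W x) σ < c) (n : ℕ) {M : ℝ} (hM : 1 ≤ M) :
    1 - qEpsNS (cqPow W n) M ≤ M ^ s * c ^ n := by
  obtain ⟨J, _, w, x, Z, hw0, hw1, hZ, hZ1, hK⟩ :=
    exists_mixture_of_forall_lt (fun x => (hW x).1) hs0 hs1 hc h
  refine one_sub_qEpsNS_le_of_forall (cqPow_isDensity hW n) hM ?_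
  intro W' σ hW' hσ hM'
  by_contra! hcon
  set y : J → Matrix B B ℂ := fun j => pw (1 / 2) (W (x j)) * Z j * pw (1 / 2) (W (x j)) with hy
  have hypsd : ∀ j, (y j).PosSemidef := fun j =>
    sandwich_posSemidef (pw_posSemidef _ (hW _).1) (hZ j).posSemidef
  have hM0 : 0 ≤ M := by linarith
  have hq : 0 < 1 - s := by linarith
  set K := ∑ j, w j • y j with hKdef
  have hKpsd : K.PosSemidef := Matrix.posSemidef_sum _ fun j _ => (hypsd j).smul (hw0 j)
  have hfid : ∀ f : Fin n → J, qFid (cqPow W n (x ∘ f)) (W' (x ∘ f)) ≤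
      M ^ s * rtr (pw s σ * piT (fun i => y (f i))) := by
    intro f
    have hρ : ∀ i, (W (x (f i))).PosSemidef := fun i => (hW _).1
    have := qFid_le (ρ := piT fun i => W (x (f i))) (Z := piT fun i => Z (f i)) hs0 hs1.le hM0
      (piT_posSemidef hρ) hσ.1 (hW' (x ∘ f)) (hM' _) (piT_posDef fun i => hZ (f i)) (by
        rw [pw_piT _ fun i => (hZ (f i)).posSemidef,
          rtr_piT fun i => pw_posSemidef _ (hZ (f i)).posSemidef]
        exact Finset.prod_le_one (fun i _ => rtr_nonneg (pw_posSemidef _ (hZ _).posSemidef))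
          fun i _ => hZ1 _)
    rw [pw_piT _ hρ, piT_mul, piT_mul] at this
    exact this
  have hwf0 : ∀ f : Fin n → J, 0 ≤ ∏ i, w (f i) := fun f => Finset.prod_nonneg fun i _ => hw0 _
  have hwf1 : ∑ f : Fin n → J, ∏ i, w (f i) = 1 := by
    have := Finset.prod_univ_sum (fun _ : Fin n => (Finset.univ : Finset J)) (fun _ j => w j)
    rw [Fintype.piFinset_univ] at this
    rw [← this, hw1, Finset.prod_const_one]
  have hsum : ∑ f : Fin n → J, (∏ i, w (f i)) • piT (fun i => y (f i)) = piT fun _ => K := by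
    rw [hKdef, piT_sum]
    exact Finset.sum_congr rfl fun f _ => (piT_smul (fun i => w (f i)) _).symm
  have hexp : rtr (pw s σ * piT fun _ : Fin n => K) =
      ∑ f : Fin n → J, (∏ i, w (f i)) * rtr (pw s σ * piT (fun i => y (f i))) := by
    rw [← hsum, Matrix.mul_sum, rtr_sum]
    exact Finset.sum_congr rfl fun f _ => by rw [Matrix.mul_smul, rtr_smul]
  have hub : rtr (pw s σ * piT fun _ : Fin n => K) ≤ c ^ n := by
    refine (trace_holder hs0 hs1 (pw_posSemidef _ hσ.1)
      (piT_posSemidef fun _ => hKpsd)).trans ?_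
    rw [pw_pw hσ.1, mul_one_div_cancel hs0.ne', pw_one hσ.1.1, hσ.rtr_eq, Real.one_rpow, one_mul,
      pw_piT _ fun _ => hKpsd, rtr_piT fun _ => pw_posSemidef _ hKpsd, Finset.prod_const,
      Finset.card_univ, Fintype.card_fin]
    have h0 := rtr_nonneg (pw_posSemidef (1 / (1 - s)) hKpsd)
    rw [← Real.rpow_natCast, ← Real.rpow_mul h0, mul_comm, Real.rpow_mul h0, Real.rpow_natCast]
    exact pow_le_pow_left₀ (Real.rpow_nonneg h0 _) hK n
  have h1 : M ^ s * c ^ n < M ^ s * rtr (pw s σ * piT fun _ : Fin n => K) := by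
    rw [hexp, Finset.mul_sum]
    calc M ^ s * c ^ n = ∑ f : Fin n → J, (∏ i, w (f i)) * (M ^ s * c ^ n) := by
          rw [← Finset.sum_mul, hwf1, one_mul]
      _ < ∑ f : Fin n → J, (∏ i, w (f i)) * qFid (cqPow W n (x ∘ f)) (W' (x ∘ f)) := by
          refine Finset.sum_lt_sum (fun f _ =>
            mul_le_mul_of_nonneg_left (hcon (x ∘ f)).le (hwf0 f)) ?_
          obtain ⟨f, -, hf⟩ : ∃ f ∈ (Finset.univ : Finset (Fin n → J)), 0 < ∏ i, w (f i) := by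
            by_contra! hc
            have := Finset.sum_nonpos hc
            rw [hwf1] at this
            linarith
          exact ⟨f, Finset.mem_univ _, mul_lt_mul_of_pos_left (hcon (x ∘ f)) hf⟩
      _ ≤ ∑ f : Fin n → J, M ^ s * ((∏ i, w (f i)) * rtr (pw s σ * piT (fun i => y (f i)))) := by
          refine Finset.sum_le_sum fun f _ => ?_
          calc _ ≤ (∏ i, w (f i)) * (M ^ s * rtr (pw s σ * piT (fun i => y (f i)))) :=
                mul_le_mul_of_nonneg_left (hfid f) (hwf0 f)
            _ = _ := by ring
  have h2 := mul_le_mul_of_nonneg_left hub (Real.rpow_nonneg hM0 s)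
  linarith

end Converse

section Certificate

theorem sqrt_inv_mul_mul {a b : ℝ} (ha : 0 < a) (hb : 0 < b) :
    Real.sqrt (1 / a / b) * b * Real.sqrt (1 / a / b) = 1 / a := by
  rw [mul_right_comm, Real.mul_self_sqrt (by positivity)]
  field_simp

theorem sqrt_inv_mul {a b : ℝ} (ha : 0 < a) (hb : 0 < b) :
    Real.sqrt (1 / a / b) * b = Real.sqrt (b / a) := by
  rw [show b / a = b ^ 2 * (1 / a / b) by field_simp, Real.sqrt_mul (sq_nonneg _),
    Real.sqrt_sq hb.le, mul_comm]

theorem sqrt_mul_eq {a b : ℝ} (ha : 0 < a) : Real.sqrt (a * b) = a * Real.sqrt (b / a) := by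
  rw [show a * b = a ^ 2 * (b / a) by field_simp, Real.sqrt_mul (sq_nonneg a), Real.sqrt_sq ha.le]

variable {n : Type*} [Fintype n] [DecidableEq n]

/-- A unitary supported on the level sets of `q` that diagonalizes all diagonal blocks of `M`. -/
theorem exists_unitary_block (q : n → ℝ) {M : Matrix n n ℂ} (hM : M.IsHermitian) :
    ∃ V : Matrix.unitaryGroup n ℂ,
      (∀ i j, q i ≠ q j → (V : Matrix n n ℂ) i j = 0) ∧
      ∀ i j, q i = q j → i ≠ j →
        (star (V : Matrix n n ℂ) * M * (V : Matrix n n ℂ)) i j = 0 := by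
  have hsub : ∀ v : ℝ, (M.submatrix (Subtype.val : {i // q i = v} → n) Subtype.val).IsHermitian :=
    fun v => hM.submatrix _
  choose U a hUa using fun v => exists_specMat (hsub v)
  set V : Matrix n n ℂ := Matrix.of fun i j =>
    if h : q i = q j then (U (q j)).1 ⟨i, h⟩ ⟨j, rfl⟩ else 0 with hV
  have hV0 : ∀ i j, q i ≠ q j → V i j = 0 := fun i j h => by simp [hV, h]
  have hV1 : ∀ (v : ℝ) (i j : {i // q i = v}), V i j = (U v).1 i j := by
    rintro v ⟨i, hi⟩ ⟨j, rfl⟩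
    simp [hV, hi]
  have hsum : ∀ (v : ℝ) (f : n → ℂ), (∀ i, q i ≠ v → f i = 0) →
      ∑ i, f i = ∑ i : {i // q i = v}, f i := by
    intro v f hf
    rw [← Finset.sum_subtype (Finset.univ.filter fun i => q i = v) (by simp) f,
      Finset.sum_filter_of_ne fun i _ h => by_contra fun hc => h (hf i hc)]
  have hblock : ∀ (N : Matrix n n ℂ) (v : ℝ) (i j : {i // q i = v}),
      (star V * N * V) i.1 j.1 = (star (U v).1 *
        N.submatrix Subtype.val Subtype.val * (U v).1 : Matrix {i // q i = v} {i // q i = v} ℂ)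
          i j := by
    intro N v i j
    rw [Matrix.mul_apply, Matrix.mul_apply, hsum v _ fun k hk => by
      rw [hV0 k j (by rwa [j.2]), mul_zero]]
    refine Finset.sum_congr rfl fun k _ => ?_
    rw [hV1, Matrix.mul_apply, Matrix.mul_apply, hsum v _ fun l hl => by
      rw [Matrix.star_apply, hV0 l i (by rwa [i.2]), star_zero, zero_mul]]
    congr 1
    refine Finset.sum_congr rfl fun l _ => ?_
    rw [Matrix.star_apply, Matrix.star_apply, hV1, Matrix.submatrix_apply]
  have hunit : V ∈ Matrix.unitaryGroup n ℂ := by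
    rw [Matrix.mem_unitaryGroup_iff']
    ext i j
    by_cases h : q i = q j
    · have := hblock 1 (q j) ⟨i, h⟩ ⟨j, rfl⟩
      rw [Matrix.submatrix_one _ Subtype.val_injective, mul_one, mul_one,
        star_mul_self_unitary] at this
      simp only at this
      rw [this]
      simp [Matrix.one_apply]
    · rw [Matrix.mul_apply, Matrix.one_apply_ne (fun hij => h (by rw [hij]))]
      refine Finset.sum_eq_zero fun k _ => ?_
      by_cases hk : q k = q j
      · rw [Matrix.star_apply, hV0 k i (by rw [hk]; exact fun h' => h h'.symm), star_zero, zero_mul]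
      · rw [hV0 k j hk, mul_zero]
  refine ⟨⟨V, hunit⟩, hV0, fun i j h hij => ?_⟩
  have := hblock M (q j) ⟨i, h⟩ ⟨j, rfl⟩
  simp only at this ⊢
  rw [this, hUa (q j), specMat]
  have e1 : star (U (q j)).1 * ((U (q j)).1 *
      Matrix.diagonal (fun k => (a (q j) k : ℂ)) * star (U (q j)).1) *
      (U (q j)).1 = Matrix.diagonal (fun k => (a (q j) k : ℂ)) := by
    calc _ = (star (U (q j)).1 * (U (q j)).1) *
          Matrix.diagonal (fun k => (a (q j) k : ℂ)) *
          (star (U (q j)).1 * (U (q j)).1) := by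
            simp only [Matrix.mul_assoc]
      _ = _ := by rw [star_mul_self_unitary, one_mul, mul_one]
  rw [e1, Matrix.diagonal_apply_ne]
  exact fun hc => hij (congrArg Subtype.val hc)

theorem specMat_apply_self_re (T : Matrix.unitaryGroup n ℂ) (b : n → ℝ) (j : n) :
    (specMat T b j j).re = ∑ k, Complex.normSq ((T : Matrix n n ℂ) j k) * b k := by
  rw [specMat, Matrix.mul_apply, Complex.re_sum]
  refine Finset.sum_congr rfl fun k _ => ?_
  rw [Matrix.mul_diagonal, Matrix.star_apply, mul_right_comm, Complex.star_def, Complex.mul_conj,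
    ← Complex.ofReal_mul, Complex.ofReal_re]

theorem star_mul_specMat_mul (V U : Matrix.unitaryGroup n ℂ) (b : n → ℝ) :
    star (V : Matrix n n ℂ) * specMat U b * (V : Matrix n n ℂ) = specMat (star V * U) b := by
  unfold specMat
  simp only [Submonoid.coe_mul, Unitary.coe_star, star_mul, star_star, Matrix.mul_assoc]

/-- Peierls-type inequality for the concave powers. -/
theorem rtr_pw_le_sum_diag {α : ℝ} (h0 : 0 ≤ α) (h1 : α ≤ 1) {A : Matrix n n ℂ}
    (hA : A.PosSemidef) (V : Matrix.unitaryGroup n ℂ) :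
    rtr (pw α A) ≤ ∑ j, ((star (V : Matrix n n ℂ) * A * (V : Matrix n n ℂ)) j j).re ^ α := by
  obtain ⟨U, b, rfl, hb⟩ := exists_specMat_nonneg hA
  rw [pw_specMat, rtr_specMat, star_mul_specMat_mul]
  set T := star V * U with hT
  calc ∑ k, b k ^ α = ∑ k, ∑ j, Complex.normSq ((T : Matrix n n ℂ) j k) * b k ^ α := by
        refine Finset.sum_congr rfl fun k _ => ?_
        rw [← Finset.sum_mul, sum_normSq_col, one_mul]
    _ = ∑ j, ∑ k, Complex.normSq ((T : Matrix n n ℂ) j k) * b k ^ α := Finset.sum_comm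
    _ ≤ _ := by
        refine Finset.sum_le_sum fun j _ => ?_
        rw [specMat_apply_self_re]
        have := (Real.concaveOn_rpow h0 h1).le_map_sum (t := Finset.univ)
          (w := fun k => Complex.normSq ((T : Matrix n n ℂ) j k)) (p := b)
          (fun k _ => Complex.normSq_nonneg _) (sum_normSq_row T j) (fun k _ => hb k)
        simpa only [smul_eq_mul] using this

theorem sum_inv_card_le_harmonic {ι : Type*} (p : ι → ℝ) (S : Finset ι) :
    ∑ j ∈ S, (1 / ((S.filter fun i => p j ≤ p i).card : ℝ)) ≤ ((harmonic S.card : ℚ) : ℝ) := by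
  induction S using Finset.induction_on_min_value p with
  | empty => simp
  | insert a S ha hmin ih =>
    rw [Finset.sum_insert ha, Finset.card_insert_of_notMem ha, harmonic_succ]
    have h1 : (insert a S).filter (fun i => p a ≤ p i) = insert a S := by
      refine Finset.filter_true_of_mem fun i hi => ?_
      rcases Finset.mem_insert.1 hi with rfl | hi
      · exact le_rfl
      · exact hmin i hi
    rw [h1, Finset.card_insert_of_notMem ha]
    have h2 : ∑ j ∈ S, (1 / (((insert a S).filter fun i => p j ≤ p i).card : ℝ)) ≤
        ∑ j ∈ S, (1 / ((S.filter fun i => p j ≤ p i).card : ℝ)) := by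
      refine Finset.sum_le_sum fun j hj => ?_
      apply one_div_le_one_div_of_le
      · exact_mod_cast Finset.card_pos.2 ⟨j, Finset.mem_filter.2 ⟨hj, le_refl (p j)⟩⟩
      · exact_mod_cast Finset.card_le_card
          (Finset.filter_subset_filter _ (Finset.subset_insert _ _))
    push_cast
    rw [one_div]
    linarith

theorem sum_inv_card_le (p q : n → ℝ) :
    ∑ j, (1 / ((Finset.univ.filter fun i => q i = q j ∧ p j ≤ p i).card : ℝ)) ≤
      ((Finset.univ.image q).card : ℝ) * (1 + Real.log (Fintype.card n)) := by
  rw [← Finset.sum_fiberwise_of_maps_to (t := Finset.univ.image q) (g := q)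
    (fun i _ => Finset.mem_image_of_mem q (Finset.mem_univ i))]
  rw [← nsmul_eq_mul]
  refine Finset.sum_le_card_nsmul _ _ _ fun y hy => ?_
  have h1 := sum_inv_card_le_harmonic p (Finset.univ.filter fun i => q i = y)
  have h2 := harmonic_le_one_add_log (Finset.univ.filter fun i => q i = y).card
  have h3 : Real.log (Finset.univ.filter fun i => q i = y).card ≤ Real.log (Fintype.card n) := by
    apply Real.log_le_log
    · obtain ⟨i, -, hi⟩ := Finset.mem_image.1 hy
      exact_mod_cast Finset.card_pos.2 ⟨i, by simp [hi]⟩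
    · exact_mod_cast Finset.card_le_univ _
  refine le_trans (le_of_eq ?_) (h1.trans (h2.trans (by linarith)))
  refine Finset.sum_congr rfl fun j hj => ?_
  rw [Finset.filter_filter, (Finset.mem_filter.1 hj).2]

/-- `Cert ρ S R e`: some compression `D ρ D` has trace at most one, is dominated by `exp R • S`,
and overlaps with `ρ` by at least `exp (-e / 2)`. -/
def Cert (ρ S : Matrix n n ℂ) (R e : ℝ) : Prop :=
  ∃ D : Matrix n n ℂ, D.PosSemidef ∧ rtr (D * ρ * D) ≤ 1 ∧
    (Real.exp R • S - D * ρ * D).PosSemidef ∧ Real.exp (-e / 2) ≤ rtr (D * ρ)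

theorem exists_cert {ρ : Matrix n n ℂ} (hρ : IsDensity ρ) (U : Matrix.unitaryGroup n ℂ)
    {q : n → ℝ} {c : ℝ} (hc : 0 < c) (hq : ∀ i, c ≤ q i) (hq1 : ∑ i, q i = 1) {s : ℝ}
    (hs0 : 0 ≤ s) (hQ : 0 < Qs s ρ (specMat U q)) :
    ∃ R e, Cert ρ (specMat U q) R e ∧ 0 ≤ R ∧ R ≤ -Real.log c ∧
      e + s * R ≤ -Real.log (Qs s ρ (specMat U q)) + (1 + s) *
        Real.log (((Finset.univ.image q).card : ℝ) * (1 + Real.log (Fintype.card n))) := by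
  have hq0 : ∀ i, 0 < q i := fun i => hc.trans_le (hq i)
  obtain ⟨V, hV, hVd⟩ := exists_unitary_block q
    (Matrix.isHermitian_conjTranspose_mul_mul (U : Matrix n n ℂ) hρ.1.1)
  set T := U * V with hT
  have hTq : ∀ f : n → ℝ, (∀ i j, q i = q j → f i = f j) → specMat T f = specMat U f := by
    intro f hf
    have h1 : (V : Matrix n n ℂ) * Matrix.diagonal (fun i => (f i : ℂ)) =
        Matrix.diagonal (fun i => (f i : ℂ)) * V := by
      ext i j
      rw [Matrix.mul_diagonal, Matrix.diagonal_mul]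
      by_cases h : q i = q j
      · rw [hf i j h, mul_comm]
      · rw [hV i j h, zero_mul, mul_zero]
    unfold specMat
    rw [hT]
    simp only [Submonoid.coe_mul, star_mul]
    calc _ = (U : Matrix n n ℂ) * ((V : Matrix n n ℂ) * Matrix.diagonal (fun i => (f i : ℂ))) *
          (star (V : Matrix n n ℂ)) * star (U : Matrix n n ℂ) := by simp only [Matrix.mul_assoc]
      _ = (U : Matrix n n ℂ) * Matrix.diagonal (fun i => (f i : ℂ)) *
          ((V : Matrix n n ℂ) * star (V : Matrix n n ℂ)) * star (U : Matrix n n ℂ) := by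
            rw [h1]; simp only [Matrix.mul_assoc]
      _ = _ := by rw [self_mul_star_unitary, mul_one]
  set ρ' : Matrix n n ℂ := star (T : Matrix n n ℂ) * ρ * (T : Matrix n n ℂ) with hρ'
  have hρ'd : ∀ i j, q i = q j → i ≠ j → ρ' i j = 0 := by
    intro i j h hij
    rw [← hVd i j h hij, hρ', hT]
    simp only [Submonoid.coe_mul, star_mul, Matrix.mul_assoc, Matrix.star_eq_conjTranspose]
  have hρeq : ρ = (T : Matrix n n ℂ) * ρ' * star (T : Matrix n n ℂ) := by
    rw [hρ']
    calc ρ = ((T : Matrix n n ℂ) * star (T : Matrix n n ℂ)) * ρ *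
          ((T : Matrix n n ℂ) * star (T : Matrix n n ℂ)) := by
            rw [self_mul_star_unitary, one_mul, mul_one]
      _ = _ := by simp only [Matrix.mul_assoc]
  have hρ'psd : ρ'.PosSemidef := hρ.1.conjTranspose_mul_mul_same _
  set p : n → ℝ := fun i => (ρ' i i).re with hp
  have hpc : ∀ i, ρ' i i = (p i : ℂ) := fun i => by
    have := hρ'psd.diag_nonneg (i := i)
    rw [Complex.nonneg_iff] at this
    exact Complex.ext rfl (by simp [← this.2])
  have hp0 : ∀ i, 0 ≤ p i := fun i => by
    have := hρ'psd.diag_nonneg (i := i)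
    rw [Complex.nonneg_iff] at this
    exact this.1
  have hTT : star (T : Matrix n n ℂ) * (T : Matrix n n ℂ) = 1 := star_mul_self_unitary T
  set f : n → ℝ := fun i => q i ^ (s / 2) with hf
  have hpwT : pw (s / 2) (specMat U q) = specMat T f := by
    rw [pw_specMat, hTq f fun i j h => by simp only [hf, h]]
  have hB : (pw (s / 2) (specMat U q) * ρ * pw (s / 2) (specMat U q)).PosSemidef :=
    sandwich_posSemidef (pw_posSemidef _ (specMat_posSemidef U fun i => (hq0 i).le)) hρ.1
  have hdiag : ∀ g : n → ℝ, specMat T g * ρ * specMat T g = (T : Matrix n n ℂ) *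
      (Matrix.diagonal (fun i => (g i : ℂ)) * ρ' * Matrix.diagonal (fun i => (g i : ℂ))) *
      star (T : Matrix n n ℂ) := by
    intro g
    rw [hρ']
    unfold specMat
    simp only [Matrix.mul_assoc]
  have hα : 0 < 1 / (1 + s) := by positivity
  have hα1 : 1 / (1 + s) ≤ 1 := by
    rw [div_le_one (by positivity)]; linarith
  have hpei : rtr (pw (1 / (1 + s)) (pw (s / 2) (specMat U q) * ρ * pw (s / 2) (specMat U q))) ≤
      ∑ j, (q j ^ s * p j) ^ (1 / (1 + s)) := by
    refine (rtr_pw_le_sum_diag hα.le hα1 hB T).trans (le_of_eq ?_)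
    refine Finset.sum_congr rfl fun j _ => ?_
    congr 1
    rw [hpwT, hdiag]
    have : star (T : Matrix n n ℂ) * ((T : Matrix n n ℂ) *
      (Matrix.diagonal (fun i => (f i : ℂ)) * ρ' * Matrix.diagonal (fun i => (f i : ℂ))) *
      star (T : Matrix n n ℂ)) * (T : Matrix n n ℂ) =
      Matrix.diagonal (fun i => (f i : ℂ)) * ρ' * Matrix.diagonal (fun i => (f i : ℂ)) := by
      calc _ = (star (T : Matrix n n ℂ) * (T : Matrix n n ℂ)) *
            (Matrix.diagonal (fun i => (f i : ℂ)) * ρ' * Matrix.diagonal (fun i => (f i : ℂ))) *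
            (star (T : Matrix n n ℂ) * (T : Matrix n n ℂ)) := by simp only [Matrix.mul_assoc]
        _ = _ := by rw [hTT, one_mul, mul_one]
    rw [this, Matrix.mul_diagonal, Matrix.diagonal_mul, hpc, ← Complex.ofReal_mul,
      ← Complex.ofReal_mul, Complex.ofReal_re, hf]
    have h2 : q j ^ s = q j ^ (s / 2) * q j ^ (s / 2) := by
      rw [← Real.rpow_add (hq0 j)]; congr 1; ring
    rw [h2]; ring
  have hne : Nonempty n := by
    by_contra hcon
    rw [not_nonempty_iff] at hcon
    simp at hq1
  set G : n → Finset n := fun j => Finset.univ.filter fun i => q i = q j ∧ p j ≤ p i with hG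
  have hGc : ∀ j, 0 < (G j).card := fun j => Finset.card_pos.2
    ⟨j, Finset.mem_filter.2 ⟨Finset.mem_univ _, rfl, le_refl (p j)⟩⟩
  have hGpos : ∀ j, 0 < ((G j).card : ℝ) := fun j => by
    exact_mod_cast hGc j
  obtain ⟨j, -, hjmax⟩ := Finset.exists_max_image Finset.univ
    (fun j => ((G j).card : ℝ) * (q j ^ s * p j) ^ (1 / (1 + s))) Finset.univ_nonempty
  set k : ℝ := ((G j).card : ℝ) with hk
  have hk0 : 0 < k := hGpos j
  set L : ℝ := ((Finset.univ.image q).card : ℝ) * (1 + Real.log (Fintype.card n)) with hL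
  have hLpos : 0 < L := by
    refine mul_pos ?_ ?_
    · exact_mod_cast Finset.card_pos.2 ⟨q j, Finset.mem_image_of_mem q (Finset.mem_univ j)⟩
    · have := Real.log_natCast_nonneg (Fintype.card n)
      linarith
  have hA0 : ∀ i, 0 ≤ q i ^ s * p i := fun i => mul_nonneg (Real.rpow_nonneg (hq0 i).le _) (hp0 i)
  have hsumle : ∑ i, (q i ^ s * p i) ^ (1 / (1 + s)) ≤
      L * (k * (q j ^ s * p j) ^ (1 / (1 + s))) := by
    calc ∑ i, (q i ^ s * p i) ^ (1 / (1 + s))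
        = ∑ i, (1 / ((G i).card : ℝ)) * (((G i).card : ℝ) *
            (q i ^ s * p i) ^ (1 / (1 + s))) := by
          refine Finset.sum_congr rfl fun i _ => ?_
          rw [← mul_assoc, one_div_mul_cancel (hGpos i).ne', one_mul]
      _ ≤ ∑ i, (1 / ((G i).card : ℝ)) * (k * (q j ^ s * p j) ^ (1 / (1 + s))) :=
          Finset.sum_le_sum fun i _ => mul_le_mul_of_nonneg_left
            (hjmax i (Finset.mem_univ i)) (one_div_nonneg.2 (hGpos i).le)
      _ ≤ _ := by
          rw [← Finset.sum_mul]
          refine mul_le_mul_of_nonneg_right (sum_inv_card_le p q)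
            (mul_nonneg hk0.le (Real.rpow_nonneg (hA0 j) _))
  have hQle : Qs s ρ (specMat U q) ≤ L ^ (1 + s) * (k ^ (1 + s) * (q j ^ s * p j)) := by
    have h1 : (rtr (pw (1 / (1 + s)) (pw (s / 2) (specMat U q) * ρ * pw (s / 2) (specMat U q))))
        ^ (1 + s) ≤ (L * (k * (q j ^ s * p j) ^ (1 / (1 + s)))) ^ (1 + s) :=
      Real.rpow_le_rpow (rtr_nonneg (pw_posSemidef _ hB)) (hpei.trans hsumle) (by linarith)
    refine h1.trans (le_of_eq ?_)
    rw [Real.mul_rpow hLpos.le (mul_nonneg hk0.le (Real.rpow_nonneg (hA0 j) _)),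
      Real.mul_rpow hk0.le (Real.rpow_nonneg (hA0 j) _), ← Real.rpow_mul (hA0 j),
      one_div_mul_cancel (by linarith), Real.rpow_one]
  have hpj : 0 < p j := by
    refine (hp0 j).lt_of_ne fun h => ?_
    rw [← h, mul_zero, mul_zero, mul_zero] at hQle
    linarith
  have hlogk : Real.log (k * q j) = Real.log k + Real.log (q j) :=
    Real.log_mul hk0.ne' (hq0 j).ne'
  have hlogp : Real.log (k * p j) = Real.log k + Real.log (p j) :=
    Real.log_mul hk0.ne' hpj.ne'
  have hmemG : ∀ i, i ∈ G j ↔ q i = q j ∧ p j ≤ p i := fun i => by rw [hG]; simp only [Finset.mem_filter, Finset.mem_univ, true_and]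
  have hkq : k * q j ≤ 1 := by
    rw [← hq1]
    calc k * q j = ∑ i ∈ G j, q i := by
          rw [Finset.sum_congr rfl fun i hi => ((hmemG i).1 hi).1, Finset.sum_const, nsmul_eq_mul]
      _ ≤ _ := Finset.sum_le_sum_of_subset_of_nonneg (Finset.subset_univ _)
          fun i _ _ => (hq0 i).le
  set δ : n → ℝ := fun i => if i ∈ G j then Real.sqrt (1 / k / p i) else 0 with hδ
  have hδ0 : ∀ i, 0 ≤ δ i := fun i => by
    simp only [hδ]; split_ifs
    · exact Real.sqrt_nonneg _
    · exact le_rfl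
  have hDD : specMat T δ * ρ * specMat T δ = specMat T (fun i => if i ∈ G j then 1 / k else 0) := by
    rw [hdiag, specMat]
    congr 2
    ext a b
    rw [Matrix.mul_diagonal, Matrix.diagonal_mul]
    by_cases hab : a = b
    · subst hab
      rw [Matrix.diagonal_apply_eq, hpc, ← Complex.ofReal_mul, ← Complex.ofReal_mul]
      congr 1
      simp only [hδ]
      split_ifs with h
      · have hpa : 0 < p a := hpj.trans_le ((hmemG a).1 h).2
        exact sqrt_inv_mul_mul hk0 hpa
      · simp
    · rw [Matrix.diagonal_apply_ne _ hab]
      by_cases ha : a ∈ G j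
      · by_cases hb : b ∈ G j
        · rw [hρ'd a b (((hmemG a).1 ha).1.trans ((hmemG b).1 hb).1.symm) hab, mul_zero, zero_mul]
        · simp [hδ, hb]
      · simp [hδ, ha]
  refine ⟨-Real.log (k * q j), -Real.log (k * p j), ⟨specMat T δ, specMat_posSemidef T hδ0,
    ?_, ?_, ?_⟩, ?_, ?_, ?_⟩
  · rw [hDD, rtr_specMat, Finset.sum_ite_mem, Finset.univ_inter, Finset.sum_const, nsmul_eq_mul,
      mul_one_div_cancel hk0.ne']
  · rw [hDD, ← hTq q fun i j h => h, specMat_smul, specMat_sub]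
    refine specMat_posSemidef T fun i => ?_
    rw [Real.exp_neg, Real.exp_log (mul_pos hk0 (hq0 j))]
    split_ifs with h
    · rw [((hmemG i).1 h).1]
      have := hq0 j
      apply le_of_eq
      rw [mul_inv, mul_assoc, inv_mul_cancel₀ (hq0 j).ne', mul_one, one_div, sub_self]
    · have := hq0 i
      have := hq0 j
      rw [sub_zero]
      exact mul_nonneg (inv_nonneg.2 (mul_nonneg hk0.le (hq0 j).le)) (hq0 i).le
  · have h1 : rtr (specMat T δ * ρ) = ∑ i, δ i * p i := by
      rw [hρeq, specMat]
      have : (T : Matrix n n ℂ) * Matrix.diagonal (fun i => (δ i : ℂ)) * star (T : Matrix n n ℂ) *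
          ((T : Matrix n n ℂ) * ρ' * star (T : Matrix n n ℂ)) =
          (T : Matrix n n ℂ) * (Matrix.diagonal (fun i => (δ i : ℂ)) * ρ' *
            star (T : Matrix n n ℂ)) := by
        calc _ = (T : Matrix n n ℂ) * Matrix.diagonal (fun i => (δ i : ℂ)) *
            (star (T : Matrix n n ℂ) * (T : Matrix n n ℂ)) * ρ' * star (T : Matrix n n ℂ) := by
              simp only [Matrix.mul_assoc]
          _ = _ := by rw [hTT, mul_one]; simp only [Matrix.mul_assoc]
      rw [this, rtr_mul_comm, Matrix.mul_assoc, hTT, mul_one, rtr, Matrix.trace, Complex.re_sum]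
      refine Finset.sum_congr rfl fun i _ => ?_
      rw [Matrix.diag_apply, Matrix.diagonal_mul, hpc, ← Complex.ofReal_mul, Complex.ofReal_re]
    rw [h1, neg_neg]
    have h2 : Real.exp (Real.log (k * p j) / 2) = Real.sqrt (k * p j) := by
      rw [Real.sqrt_eq_rpow, Real.rpow_def_of_pos (mul_pos hk0 hpj)]
      congr 1; ring
    rw [h2, sqrt_mul_eq hk0]
    calc k * Real.sqrt (p j / k) = ∑ i ∈ G j, Real.sqrt (p j / k) := by
          rw [Finset.sum_const, nsmul_eq_mul]
      _ ≤ ∑ i ∈ G j, δ i * p i := by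
          refine Finset.sum_le_sum fun i hi => ?_
          have hpi : 0 < p i := hpj.trans_le ((hmemG i).1 hi).2
          simp only [hδ, if_pos hi]
          rw [sqrt_inv_mul hk0 hpi]
          exact Real.sqrt_le_sqrt (div_le_div_of_nonneg_right ((hmemG i).1 hi).2 hk0.le)
      _ ≤ _ := Finset.sum_le_sum_of_subset_of_nonneg (Finset.subset_univ _)
          fun i _ _ => mul_nonneg (hδ0 i) (hp0 i)
  · rw [Left.nonneg_neg_iff]
    exact Real.log_nonpos (mul_pos hk0 (hq0 j)).le hkq
  · rw [neg_le_neg_iff]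
    refine Real.log_le_log hc ((hq j).trans ?_)
    refine le_mul_of_one_le_left (hq0 j).le ?_
    rw [hk]
    exact_mod_cast hGc j
  · have h1 := Real.log_le_log hQ hQle
    have h2 : 0 < q j ^ s := Real.rpow_pos_of_pos (hq0 j) _
    have h3 : 0 < k ^ (1 + s) := Real.rpow_pos_of_pos hk0 _
    have h4 : 0 < L ^ (1 + s) := Real.rpow_pos_of_pos hLpos _
    rw [Real.log_mul h4.ne' (mul_pos h3 (mul_pos h2 hpj)).ne', Real.log_mul h3.ne' (mul_pos h2 hpj).ne',
      Real.log_mul h2.ne' hpj.ne', Real.log_rpow hLpos, Real.log_rpow hk0,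
      Real.log_rpow (hq0 j)] at h1
    rw [hlogk, hlogp]
    linarith

end Certificate

section CertOps

variable {n : Type*} [Fintype n] [DecidableEq n]

theorem Cert.mono {ρ S : Matrix n n ℂ} {R e R' e' : ℝ} (h : Cert ρ S R e) (hS : S.PosSemidef)
    (hR : R ≤ R') (he : e ≤ e') : Cert ρ S R' e' := by
  obtain ⟨D, hD, h1, h2, h3⟩ := h
  refine ⟨D, hD, h1, ?_, le_trans (Real.exp_le_exp.2 (by linarith)) h3⟩
  have : Real.exp R' • S - D * ρ * D =
      (Real.exp R' - Real.exp R) • S + (Real.exp R • S - D * ρ * D) := by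
    rw [sub_smul]; abel
  rw [this]
  exact (hS.smul (sub_nonneg.2 (Real.exp_le_exp.2 hR))).add h2

theorem Cert.scale {ρ S : Matrix n n ℂ} {R e c : ℝ} (h : Cert ρ S R e) (hρ : ρ.PosSemidef)
    (hc : 0 ≤ c) : Cert ρ S (R - c) (e + c) := by
  obtain ⟨D, hD, h1, h2, h3⟩ := h
  have hDD : (Real.exp (-c / 2) • D) * ρ * (Real.exp (-c / 2) • D) =
      Real.exp (-c) • (D * ρ * D) := by
    rw [Matrix.smul_mul, Matrix.smul_mul, Matrix.mul_smul, smul_smul, ← Real.exp_add]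
    congr 2; ring
  refine ⟨Real.exp (-c / 2) • D, hD.smul (Real.exp_pos _).le, ?_, ?_, ?_⟩
  · rw [hDD, rtr_smul]
    refine le_trans (mul_le_of_le_one_left (rtr_nonneg (sandwich_posSemidef hD hρ)) ?_) h1
    exact Real.exp_le_one_iff.2 (by linarith)
  · rw [hDD]
    have : Real.exp (R - c) • S - Real.exp (-c) • (D * ρ * D) =
        Real.exp (-c) • (Real.exp R • S - D * ρ * D) := by
      rw [smul_sub, smul_smul, ← Real.exp_add]
      congr 3; ring
    rw [this]
    exact h2.smul (Real.exp_pos _).le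
  · rw [Matrix.smul_mul, rtr_smul]
    have : Real.exp (-(e + c) / 2) = Real.exp (-c / 2) * Real.exp (-e / 2) := by
      rw [← Real.exp_add]; congr 1; ring
    rw [this]
    exact mul_le_mul_of_nonneg_left h3 (Real.exp_pos _).le

theorem Cert.base_change {ρ S S' : Matrix n n ℂ} {R e η : ℝ} (h : Cert ρ S R e)
    (hS : (Real.exp η • S' - S).PosSemidef) : Cert ρ S' (R + η) e := by
  obtain ⟨D, hD, h1, h2, h3⟩ := h
  refine ⟨D, hD, h1, ?_, h3⟩
  have : Real.exp (R + η) • S' - D * ρ * D =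
      Real.exp R • (Real.exp η • S' - S) + (Real.exp R • S - D * ρ * D) := by
    rw [smul_sub, smul_smul, ← Real.exp_add]; abel
  rw [this]
  exact (hS.smul (Real.exp_pos _).le).add h2

theorem Cert.of_submatrix {m : Type*} [Fintype m] [DecidableEq m] (φ : m ≃ n)
    {ρ S : Matrix n n ℂ} {R e : ℝ} (h : Cert (ρ.submatrix φ φ) (S.submatrix φ φ) R e) :
    Cert ρ S R e := by
  obtain ⟨D, hD, h1, h2, h3⟩ := h
  have hsub : ∀ A : Matrix m m ℂ, (A.submatrix φ.symm φ.symm).submatrix φ φ = A := fun A => by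
    ext i j; simp
  have hsub' : ∀ A : Matrix n n ℂ, (A.submatrix φ φ).submatrix φ.symm φ.symm = A := fun A => by
    ext i j; simp
  have hmul : ∀ A B : Matrix m m ℂ, A.submatrix φ.symm φ.symm * B.submatrix φ.symm φ.symm =
      (A * B).submatrix φ.symm φ.symm := fun A B => by
    rw [Matrix.submatrix_mul_equiv]
  have htr : ∀ A : Matrix m m ℂ, rtr (A.submatrix φ.symm φ.symm) = rtr A := fun A => by
    simp only [rtr, Matrix.trace, Matrix.diag_apply, Matrix.submatrix_apply]
    rw [Equiv.sum_comp φ.symm fun i => A i i]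
  refine ⟨D.submatrix φ.symm φ.symm, hD.submatrix _, ?_, ?_, ?_⟩
  · rw [← hsub' ρ, hmul, hmul, htr]; exact h1
  · rw [← hsub' ρ, hmul, hmul]
    have := h2.submatrix φ.symm
    convert this using 1
    ext i j
    simp
  · rw [← hsub' ρ, hmul, htr]; exact h3

end CertOps

section CertTensor

variable {ι : Type*} [Fintype ι] [DecidableEq ι] {B : ι → Type*} [∀ i, Fintype (B i)]
  [∀ i, DecidableEq (B i)]

theorem Cert.piT {ρ S : ∀ i, Matrix (B i) (B i) ℂ} {R e : ι → ℝ}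
    (hρ : ∀ i, (ρ i).PosSemidef) (h : ∀ i, Cert (ρ i) (S i) (R i) (e i)) :
    Cert (ChannelSim.piT ρ) (ChannelSim.piT S) (∑ i, R i) (∑ i, e i) := by
  choose D hD h1 h2 h3 using h
  have hDD : ∀ i, (D i * ρ i * D i).PosSemidef := fun i => sandwich_posSemidef (hD i) (hρ i)
  refine ⟨ChannelSim.piT D, piT_posSemidef hD, ?_, ?_, ?_⟩
  · rw [piT_mul, piT_mul, rtr_piT hDD]
    exact Finset.prod_le_one (fun i _ => rtr_nonneg (hDD i)) fun i _ => h1 i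
  · rw [piT_mul, piT_mul, Real.exp_sum, ← piT_smul]
    exact piT_mono hDD h2
  · rw [rtr_piT_mul hD hρ, neg_div, Finset.sum_div, ← Finset.sum_neg_distrib, Real.exp_sum]
    refine Finset.prod_le_prod (fun i _ => (Real.exp_pos _).le) fun i _ => ?_
    rw [← neg_div]
    exact h3 i

end CertTensor

section Groups

variable {ι γ B : Type*} [Fintype ι] [DecidableEq ι] [Fintype γ] [DecidableEq γ] [Fintype B]
  [DecidableEq B]

/-- Regrouping the coordinates of a function along the fibers of `π`. -/
def fiberEquiv (π : ι → γ) : (∀ g : γ, ({i // π i = g} → B)) ≃ (ι → B) where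
  toFun f i := f (π i) ⟨i, rfl⟩
  invFun f g i := f i.1
  left_inv f := by
    funext g ⟨i, hi⟩
    subst hi
    rfl
  right_inv f := rfl

theorem prod_fiber {M : Type*} [CommMonoid M] (π : ι → γ) (f : ι → M) :
    ∏ g, ∏ i : {i // π i = g}, f i = ∏ i, f i := by
  rw [← Fintype.prod_sigma' (fun g (i : {i // π i = g}) => f i)]
  exact Fintype.prod_equiv (Equiv.sigmaFiberEquiv π) _ _ fun x => rfl

theorem piT_submatrix_fiberEquiv (π : ι → γ) (A : ι → Matrix B B ℂ) :
    (ChannelSim.piT A).submatrix (fiberEquiv π) (fiberEquiv π) =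
      ChannelSim.piT (fun g => ChannelSim.piT (fun i : {i // π i = g} => A i)) := by
  ext a b
  rw [Matrix.submatrix_apply, piT_apply, piT_apply]
  simp only [piT_apply]
  rw [← prod_fiber π]
  refine Finset.prod_congr rfl fun g _ => Finset.prod_congr rfl fun i _ => ?_
  obtain ⟨i, hi⟩ := i
  subst hi
  rfl

theorem Cert.of_groups (π : ι → γ) {ρ S : ι → Matrix B B ℂ} {R e : γ → ℝ}
    (hρ : ∀ i, (ρ i).PosSemidef)
    (h : ∀ g, Cert (ChannelSim.piT fun i : {i // π i = g} => ρ i)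
      (ChannelSim.piT fun i : {i // π i = g} => S i) (R g) (e g)) :
    Cert (ChannelSim.piT ρ) (ChannelSim.piT S) (∑ g, R g) (∑ g, e g) := by
  refine Cert.of_submatrix (fiberEquiv π) ?_
  rw [piT_submatrix_fiberEquiv, piT_submatrix_fiberEquiv]
  exact Cert.piT (fun g => piT_posSemidef fun i => hρ i) h

theorem sum_card_fiber (π : ι → γ) :
    ∑ g, (Fintype.card {i // π i = g} : ℝ) = Fintype.card ι := by
  rw [← Nat.cast_sum, ← Fintype.card_sigma, Fintype.card_congr (Equiv.sigmaFiberEquiv π)]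

theorem card_image_prod_le (a : B → ℝ) :
    (Finset.univ.image fun b : ι → B => ∏ i, a (b i)).card ≤
      (Fintype.card ι + 1) ^ Fintype.card B := by
  have hfac : ∀ b : ι → B, ∏ i, a (b i) =
      ∏ x, a x ^ (Finset.univ.filter fun i => b i = x).card := fun b => by
    rw [← Finset.prod_fiberwise_of_maps_to (t := Finset.univ) (g := b) fun i _ => Finset.mem_univ _]
    refine Finset.prod_congr rfl fun x _ => ?_
    rw [Finset.prod_congr rfl fun i hi => by rw [(Finset.mem_filter.1 hi).2], Finset.prod_const]
  have hsub : (Finset.univ.image fun b : ι → B => ∏ i, a (b i)) ⊆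
      (Finset.univ.image fun t : B → Fin (Fintype.card ι + 1) => ∏ x, a x ^ (t x : ℕ)) := by
    intro y hy
    obtain ⟨b, -, rfl⟩ := Finset.mem_image.1 hy
    refine Finset.mem_image.2 ⟨fun x => ⟨(Finset.univ.filter fun i => b i = x).card,
      Nat.lt_succ_of_le (Finset.card_le_univ _)⟩, Finset.mem_univ _, ?_⟩
    exact (hfac b).symm
  refine (Finset.card_le_card hsub).trans (Finset.card_image_le.trans ?_)
  simp

/-- Overhead of the certificate attached to a word of length `k` over an alphabet of size `d`. -/
def overhead (d k : ℕ) : ℝ :=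
  2 * Real.log (((k : ℝ) + 1) ^ d * (1 + (k : ℝ) * Real.log d))

theorem overhead_mono (d : ℕ) : Monotone (overhead d) := by
  intro k k' h
  have h' : (k : ℝ) ≤ k' := by exact_mod_cast h
  have hl := Real.log_natCast_nonneg d
  unfold overhead
  refine mul_le_mul_of_nonneg_left (Real.log_le_log (by positivity) ?_) (by norm_num)
  gcongr

theorem overhead_nonneg (d k : ℕ) : 0 ≤ overhead d k := by
  have hl := Real.log_natCast_nonneg d
  refine mul_nonneg (by norm_num) (Real.log_nonneg ?_)
  have h1 : (1 : ℝ) ≤ ((k : ℝ) + 1) ^ d := one_le_pow₀ (by linarith [(k.cast_nonneg : (0:ℝ) ≤ k)])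
  have h2 : (0 : ℝ) ≤ (k : ℝ) * Real.log d := by positivity
  nlinarith

theorem exists_word_cert {ρ : ι → Matrix B B ℂ} (hρ : ∀ i, IsDensity (ρ i)) {σ : Matrix B B ℂ}
    (hσ : IsDensity σ) {c s a : ℝ} (hc : 0 < c) (hσc : (σ - c • (1 : Matrix B B ℂ)).PosSemidef)
    (hs0 : 0 ≤ s) (hs1 : s ≤ 1) (hQ : ∀ i, Real.exp (-a) ≤ Qs s (ρ i) σ) :
    ∃ R e, Cert (ChannelSim.piT ρ) (ChannelSim.piT fun _ : ι => σ) R e ∧ 0 ≤ R ∧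
      R ≤ Fintype.card ι * (-Real.log c) ∧
      e + s * R ≤ Fintype.card ι * a + overhead (Fintype.card B) (Fintype.card ι) := by
  obtain ⟨U, q, rfl⟩ := exists_specMat hσ.1.1
  have hqc : ∀ i, c ≤ q i := by
    rw [← specMat_const U, specMat_sub, specMat_posSemidef_iff] at hσc
    exact fun i => sub_nonneg.1 (hσc i)
  have hq1 : ∑ i, q i = 1 := by
    rw [← rtr_specMat U, hσ.rtr_eq]
  have hQp : ∏ i, Qs s (ρ i) (specMat U q) =
      Qs s (ChannelSim.piT ρ) (ChannelSim.piT fun _ : ι => specMat U q) :=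
    (Qs_piT s (fun i => (hρ i).1) fun _ => hσ.1).symm
  have hQlow : Real.exp (-(Fintype.card ι * a)) ≤
      Qs s (ChannelSim.piT ρ) (ChannelSim.piT fun _ : ι => specMat U q) := by
    rw [← hQp]
    calc Real.exp (-(Fintype.card ι * a)) = ∏ _i : ι, Real.exp (-a) := by
          rw [Finset.prod_const, ← Real.exp_nat_mul]; congr 1; simp
      _ ≤ _ := Finset.prod_le_prod (fun i _ => (Real.exp_pos _).le) fun i _ => hQ i
  rw [piT_specMat] at hQlow ⊢
  obtain ⟨R, e, h1, h2, h3, h4⟩ := exists_cert (piT_isDensity hρ) (piU fun _ : ι => U)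
    (q := fun b => ∏ i, q (b i)) (c := c ^ Fintype.card ι) (pow_pos hc _)
    (fun b => by
      calc c ^ Fintype.card ι = ∏ _i : ι, c := by simp
        _ ≤ _ := Finset.prod_le_prod (fun i _ => hc.le) fun i _ => hqc _)
    (by
      have := Finset.prod_univ_sum (fun _ : ι => (Finset.univ : Finset B)) fun _ b => q b
      rw [Fintype.piFinset_univ] at this
      rw [← this]; simp [hq1])
    hs0 ((Real.exp_pos _).trans_le hQlow)
  refine ⟨R, e, h1, h2, h3.trans (le_of_eq ?_), h4.trans (add_le_add ?_ ?_)⟩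
  · rw [Real.log_pow]; ring
  · rw [neg_le, ← Real.log_exp (-(Fintype.card ι * a))]
    exact Real.log_le_log (Real.exp_pos _) hQlow
  · have hne : Nonempty B := by
      by_contra hcon
      rw [not_nonempty_iff] at hcon
      simp at hq1
    have hcard : (1 : ℝ) ≤ ((Finset.univ.image fun b : ι → B => ∏ i, q (b i)).card : ℝ) := by
      exact_mod_cast Finset.card_pos.2 (Finset.univ_nonempty.image _)
    have hcard' : ((Finset.univ.image fun b : ι → B => ∏ i, q (b i)).card : ℝ) ≤
        ((Fintype.card ι : ℝ) + 1) ^ Fintype.card B := by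
      exact_mod_cast card_image_prod_le (ι := ι) q
    have hl := Real.log_natCast_nonneg (Fintype.card B)
    have hlog : Real.log (Fintype.card (ι → B)) =
        (Fintype.card ι : ℝ) * Real.log (Fintype.card B) := by
      rw [Fintype.card_fun, Nat.cast_pow, Real.log_pow]
    rw [hlog, overhead]
    have h0 : (0 : ℝ) ≤ (Fintype.card ι : ℝ) * Real.log (Fintype.card B) := by positivity
    have hL1 : 1 ≤ ((Finset.univ.image fun b : ι → B => ∏ i, q (b i)).card : ℝ) *
        (1 + (Fintype.card ι : ℝ) * Real.log (Fintype.card B)) := by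
      nlinarith
    refine mul_le_mul (by linarith) (Real.log_le_log (by linarith) ?_) (Real.log_nonneg hL1)
      (by norm_num)
    exact mul_le_mul_of_nonneg_right hcard' (by linarith)

end Groups

theorem exists_crossing {f : ℕ → ℝ} {c : ℝ} {N : ℕ} (h0 : c < f 0) (hN : f N ≤ c) :
    ∃ i < N, c < f i ∧ f (i + 1) ≤ c := by
  induction N with
  | zero => exact absurd hN (not_le.2 h0)
  | succ N ih =>
    by_cases h : f N ≤ c
    · obtain ⟨i, hi, h1⟩ := ih h
      exact ⟨i, hi.trans N.lt_succ_self, h1⟩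
    · exact ⟨N, N.lt_succ_self, not_le.1 h, hN⟩

section Path

variable {X B : Type*} [Fintype B] [DecidableEq B]

/-- One node of a path of reference states. -/
structure IsNode (W : X → Matrix B B ℂ) (E r ε c s : ℝ) (σ : Matrix B B ℂ) : Prop where
  density : IsDensity σ
  lower : (σ - c • (1 : Matrix B B ℂ)).PosSemidef
  nonneg : 0 ≤ s
  le_one : s ≤ 1
  bound : ∀ x, Real.exp (-(E + s * r + ε)) ≤ Qs s (W x) σ

/-- A path of reference states from `s = 0` to `s = 1` with small steps. -/
structure IsPath (W : X → Matrix B B ℂ) (E r ε c δ η : ℝ) (T : ℕ) (s : ℕ → ℝ)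
    (σ : ℕ → Matrix B B ℂ) : Prop where
  node : ∀ i ≤ T, IsNode W E r ε c (s i) (σ i)
  start : s 0 = 0
  finish_eq : s T = 1
  step : ∀ i < T, |s (i + 1) - s i| ≤ δ
  base : ∀ i < T, (Real.exp η • σ i - σ (i + 1)).PosSemidef

theorem Cert.base_change_piT {ι : Type*} [Fintype ι] [DecidableEq ι] {ρ : Matrix (ι → B) (ι → B) ℂ}
    {σ σ' : Matrix B B ℂ} {R e η : ℝ}
    (h : Cert ρ (ChannelSim.piT fun _ : ι => σ') R e) (hσ' : σ'.PosSemidef)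
    (hb : (Real.exp η • σ - σ').PosSemidef) :
    Cert ρ (ChannelSim.piT fun _ : ι => σ) (R + Fintype.card ι * η) e := by
  refine h.base_change ?_
  have := piT_mono (ι := ι) (A := fun _ => σ') (A' := fun _ => Real.exp η • σ)
    (fun _ => hσ') fun _ => hb
  rw [piT_smul, Finset.prod_const, ← Real.exp_nat_mul] at this
  exact this

theorem IsPath.exists_cert {W : X → Matrix B B ℂ} {E r ε c δ η : ℝ} {T : ℕ} {s : ℕ → ℝ}
    {σ : ℕ → Matrix B B ℂ} (hP : IsPath W E r ε c δ η T s σ) (hW : ∀ x, IsDensity (W x))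
    (hr : 0 ≤ r) (hc : 0 < c) (hc1 : c ≤ 1) (hδ : 0 ≤ δ) (hη : 0 ≤ η)
    {n m k : ℕ} (w : Fin n → X) (π : Fin n → Fin m)
    (hπ : ∀ g, Fintype.card {i // π i = g} ≤ k) :
    ∃ i ≤ T, Cert (ChannelSim.piT fun j => W (w j)) (ChannelSim.piT fun _ : Fin n => σ i)
      (n * r + n * η)
      (n * (E + ε + δ * (r + -Real.log c)) + m * overhead (Fintype.card B) k +
        k * (-Real.log c)) := by
  set C := -Real.log c with hC
  have hC0 : 0 ≤ C := by
    rw [hC, Left.nonneg_neg_iff]; exact Real.log_nonpos hc.le hc1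
  set O := overhead (Fintype.card B) k with hO
  set K : Fin m → ℝ := fun g => (Fintype.card {i // π i = g} : ℝ) with hK
  have hKn : ∑ g, K g = n := by rw [hK, sum_card_fiber, Fintype.card_fin]
  have hKk : ∀ g, K g ≤ k := fun g => Nat.cast_le.2 (hπ g)
  have hK0 : ∀ g, 0 ≤ K g := fun g => Nat.cast_nonneg _
  have hcert : ∀ i g, ∃ R e, i ≤ T → Cert (ChannelSim.piT fun j : {j // π j = g} => W (w j))
      (ChannelSim.piT fun _ : {j // π j = g} => σ i) R e ∧ 0 ≤ R ∧ R ≤ K g * C ∧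
      e + s i * R ≤ K g * (E + s i * r + ε) + O := by
    intro i g
    by_cases hi : i ≤ T
    · have hn := hP.node i hi
      obtain ⟨R, e, h1, h2, h3, h4⟩ := exists_word_cert
        (ρ := fun j : {j // π j = g} => W (w j)) (fun j => hW _) hn.density hc hn.lower
        hn.nonneg hn.le_one (a := E + s i * r + ε) fun j => hn.bound _
      exact ⟨R, e, fun _ => ⟨h1, h2, h3, h4.trans (add_le_add le_rfl (overhead_mono _ (hπ g)))⟩⟩
    · exact ⟨0, 0, fun h => absurd h hi⟩
  choose R e hRe using hcert
  have hWp : ∀ j, (W (w j)).PosSemidef := fun j => (hW _).1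
  have hgr : ∀ i (R' e' : Fin m → ℝ), (∀ g, Cert (ChannelSim.piT fun j : {j // π j = g} => W (w j))
      (ChannelSim.piT fun _ : {j // π j = g} => σ i) (R' g) (e' g)) →
      Cert (ChannelSim.piT fun j => W (w j)) (ChannelSim.piT fun _ : Fin n => σ i)
        (∑ g, R' g) (∑ g, e' g) := fun i R' e' h =>
    Cert.of_groups (ρ := fun j => W (w j)) (S := fun _ => σ i) π hWp h
  have hσp : ∀ i ≤ T, (ChannelSim.piT fun _ : Fin n => σ i).PosSemidef := fun i hi =>
    piT_posSemidef fun _ => (hP.node i hi).density.1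
  have hn0 : (0 : ℝ) ≤ n := Nat.cast_nonneg _
  have hk0 : (0 : ℝ) ≤ k := Nat.cast_nonneg _
  have hnη : 0 ≤ n * η := mul_nonneg hn0 hη
  have hkC : 0 ≤ k * C := mul_nonneg hk0 hC0
  have hnδ : 0 ≤ n * (δ * (r + C)) := mul_nonneg hn0 (mul_nonneg hδ (by linarith))
  have hsumO : ∑ _g : Fin m, O = m * O := by simp
  have hnode : ∀ i ≤ T, ∑ g, e i g + s i * ∑ g, R i g ≤ n * (E + s i * r + ε) + m * O := by
    intro i hi
    rw [← hsumO, ← hKn, Finset.sum_mul, Finset.mul_sum, ← Finset.sum_add_distrib,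
      ← Finset.sum_add_distrib]
    exact Finset.sum_le_sum fun g _ => (hRe i g hi).2.2.2
  by_cases hA : ∑ g, R 0 g ≤ n * r
  · refine ⟨0, Nat.zero_le _, (hgr 0 (R 0) (e 0) fun g => (hRe 0 g (Nat.zero_le _)).1).mono
      (hσp 0 (Nat.zero_le _)) (by linarith) ?_⟩
    have := hnode 0 (Nat.zero_le _)
    rw [hP.start] at this
    nlinarith
  by_cases hB : ∑ g, R T g ≤ n * r
  · obtain ⟨i, hiT, hi1, hi2⟩ := exists_crossing (f := fun i => ∑ g, R i g) (not_le.1 hA) hB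
    have hiT' : i + 1 ≤ T := hiT
    set N : ℕ → Fin m → Prop := fun h g => (g : ℕ) < h with hN
    set H : ℕ → ℝ := fun h => ∑ g, if N h g then R (i + 1) g else R i g with hH
    have hH0 : H 0 = ∑ g, R i g := by simp [hH, hN]
    have hHm : H m = ∑ g, R (i + 1) g := by simp [hH, hN]
    obtain ⟨h, hhm, hh1, hh2⟩ := exists_crossing (f := H) (c := n * r) (N := m)
      (by rw [hH0]; exact hi1) (by rw [hHm]; exact hi2)
    have hstep : H h - k * C ≤ H (h + 1) := by
      have h1 : H h - H (h + 1) = ∑ g : Fin m, if g = ⟨h, hhm⟩ then R i g - R (i + 1) g else 0 := by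
        simp only [hH]
        rw [← Finset.sum_sub_distrib]
        refine Finset.sum_congr rfl fun g _ => ?_
        by_cases hg : g = ⟨h, hhm⟩
        · subst hg
          simp [hN]
        · have hg' : (g : ℕ) ≠ h := fun hc => hg (Fin.ext hc)
          by_cases hlt : (g : ℕ) < h
          · have : (g : ℕ) < h + 1 := by omega
            simp [hN, hlt, this, hg]
          · have : ¬ (g : ℕ) < h + 1 := by omega
            simp [hN, hlt, this, hg]
      rw [Finset.sum_ite_eq' Finset.univ, if_pos (Finset.mem_univ _)] at h1
      have h2 := (hRe i ⟨h, hhm⟩ hiT.le).2.2.1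
      have h3 := (hRe (i + 1) ⟨h, hhm⟩ hiT).2.1
      have h4 := mul_le_mul_of_nonneg_right (hKk ⟨h, hhm⟩) hC0
      linarith
    have hsi0 := (hP.node i hiT.le).nonneg
    have hsi1 := (hP.node i hiT.le).le_one
    have habs := abs_le.1 (hP.step i hiT)
    refine ⟨i, hiT.le, (hgr i
      (fun g => (if N (h + 1) g then R (i + 1) g else R i g) + K g * η)
      (fun g => if N (h + 1) g then e (i + 1) g else e i g) fun g => ?_).mono
        (hσp i hiT.le) ?_ ?_⟩
    · by_cases hg : N (h + 1) g
      · simp only [if_pos hg]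
        exact (hRe (i + 1) g hiT').1.base_change_piT (hP.node (i + 1) hiT').density.1
          (hP.base i hiT)
      · simp only [if_neg hg]
        exact (hRe i g hiT.le).1.mono (piT_posSemidef fun _ => (hP.node i hiT.le).density.1)
          (le_add_of_nonneg_right (mul_nonneg (hK0 g) hη)) le_rfl
    · rw [Finset.sum_add_distrib, ← Finset.sum_mul, hKn]
      linarith
    · have hgroup : ∀ g, (if N (h + 1) g then e (i + 1) g else e i g) +
          s i * (if N (h + 1) g then R (i + 1) g else R i g) ≤
          K g * (E + ε + s i * r + δ * (r + C)) + O := by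
        intro g
        have hKg := hK0 g
        by_cases hg : N (h + 1) g
        · simp only [if_pos hg]
          obtain ⟨-, h2, h3, h4⟩ := hRe (i + 1) g hiT'
          have h5 : (s i - s (i + 1)) * R (i + 1) g ≤ δ * (K g * C) :=
            (mul_le_mul_of_nonneg_right (by linarith) h2).trans (mul_le_mul_of_nonneg_left h3 hδ)
          have h6 : (s (i + 1) - s i) * (K g * r) ≤ δ * (K g * r) :=
            mul_le_mul_of_nonneg_right (by linarith) (mul_nonneg hKg hr)
          nlinarith
        · simp only [if_neg hg]
          have h4 := (hRe i g hiT.le).2.2.2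
          have : 0 ≤ K g * (δ * (r + C)) := mul_nonneg hKg (mul_nonneg hδ (by linarith))
          nlinarith
      have hsum := Finset.sum_le_sum fun g (_ : g ∈ Finset.univ) => hgroup g
      rw [Finset.sum_add_distrib, Finset.sum_add_distrib, ← Finset.mul_sum, ← Finset.sum_mul,
        hKn, hsumO] at hsum
      change _ + s i * H (h + 1) ≤ _ at hsum
      have h7 : s i * (n * r - H (h + 1)) ≤ 1 * (k * C) :=
        mul_le_mul hsi1 (by linarith) (by linarith) (by norm_num)
      nlinarith
  · have hT := hgr T (R T) (e T) fun g => (hRe T g le_rfl).1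
    have hTs := hT.scale (piT_posSemidef hWp) (c := ∑ g, R T g - n * r) (by linarith)
    refine ⟨T, le_rfl, hTs.mono (hσp T le_rfl) (by linarith) ?_⟩
    have := hnode T le_rfl
    rw [hP.finish_eq] at this
    nlinarith

end Path

section PathExists

variable {X B : Type*} [Fintype B] [DecidableEq B]

theorem IsDensity.one_sub_posSemidef {σ : Matrix B B ℂ} (hσ : IsDensity σ) :
    (1 - σ).PosSemidef := by
  obtain ⟨U, a, rfl, ha⟩ := exists_specMat_nonneg hσ.1
  have h1 := hσ.rtr_eq
  rw [rtr_specMat] at h1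
  rw [← specMat_one U, specMat_sub]
  refine specMat_posSemidef U fun i => ?_
  have := Finset.single_le_sum (fun i _ => ha i) (Finset.mem_univ i)
  linarith

theorem IsDensity.convex {σ τ : Matrix B B ℂ} (hσ : IsDensity σ) (hτ : IsDensity τ) {a b : ℝ}
    (ha : 0 ≤ a) (hb : 0 ≤ b) (hab : a + b = 1) : IsDensity (a • σ + b • τ) := by
  refine ⟨(hσ.1.smul ha).add (hτ.1.smul hb), ?_⟩
  rw [Matrix.trace_add, Matrix.trace_smul, Matrix.trace_smul, hσ.2, hτ.2, Complex.real_smul,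
    Complex.real_smul, mul_one, mul_one, ← Complex.ofReal_add, hab, Complex.ofReal_one]

theorem isDensity_maximallyMixed [Nonempty B] :
    IsDensity ((1 / (Fintype.card B : ℝ)) • (1 : Matrix B B ℂ)) := by
  refine ⟨Matrix.PosSemidef.one.smul (by positivity), ?_⟩
  rw [Matrix.trace_smul, Matrix.trace_one, Complex.real_smul]
  have : (Fintype.card B : ℂ) ≠ 0 := by exact_mod_cast Fintype.card_ne_zero
  push_cast
  field_simp

theorem Qs_concave_of_nonneg {s : ℝ} (hs0 : 0 ≤ s) (hs1 : s ≤ 1) {ρ σ τ : Matrix B B ℂ}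
    (hρ : ρ.PosSemidef) (hσ : σ.PosSemidef) (hτ : τ.PosSemidef) {a b : ℝ} (ha : 0 ≤ a)
    (hb : 0 ≤ b) (hab : a + b = 1) :
    a * Qs s ρ σ + b * Qs s ρ τ ≤ Qs s ρ (a • σ + b • τ) := by
  rcases hs0.eq_or_lt with rfl | hs0
  · rw [Qs_zero hρ hσ, Qs_zero hρ hτ, Qs_zero hρ ((hσ.smul ha).add (hτ.smul hb)), ← add_mul, hab,
      one_mul]
  · exact Qs_concave hs0 hs1 hρ hσ hτ ha hb hab

theorem exists_node [Nonempty B] {W : X → Matrix B B ℂ} (hW : ∀ x, IsDensity (W x)) {E r : ℝ}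
    (hE : 0 ≤ E) (hopt : ∀ s, 0 < s → s ≤ 1 → ∀ ε > 0, ∃ σ, IsDensity σ ∧
      ∀ x, Real.exp (-(E + s * r + ε)) ≤ Qs s (W x) σ) {ε : ℝ} (hε : 0 < ε) :
    ∃ c, 0 < c ∧ c ≤ 1 ∧ ∀ s, 0 ≤ s → s ≤ 1 → ∃ σ, IsNode W E r ε c s σ := by
  set d : ℝ := (Fintype.card B : ℝ) with hd
  have hd1 : 1 ≤ d := by
    rw [hd]; exact_mod_cast Fintype.card_pos
  set t : ℝ := 1 - Real.exp (-(ε / 2)) with ht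
  have hexp : Real.exp (-(ε / 2)) < 1 := by
    rw [← Real.exp_zero]; exact Real.exp_lt_exp.2 (by linarith)
  have ht0 : 0 < t := by linarith
  have ht1 : t < 1 := by linarith [Real.exp_pos (-(ε / 2))]
  refine ⟨t * (1 / d), by positivity, ?_, fun s hs0 hs1 => ?_⟩
  · have : 1 / d ≤ 1 := by rw [div_le_one (by linarith)]; exact hd1
    nlinarith
  set I : Matrix B B ℂ := (1 / d) • (1 : Matrix B B ℂ) with hI
  have hId : IsDensity I := isDensity_maximallyMixed
  have key : ∃ σ, IsDensity σ ∧ ∀ x, Real.exp (-(E + s * r + ε / 2)) ≤ Qs s (W x) σ := by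
    rcases hs0.eq_or_lt with rfl | hs0
    · refine ⟨I, hId, fun x => ?_⟩
      rw [Qs_zero (hW x).1 hId.1, (hW x).rtr_eq]
      exact Real.exp_le_one_iff.2 (by linarith)
    · exact hopt s hs0 hs1 _ (by linarith)
  obtain ⟨σ, hσ, hσQ⟩ := key
  refine ⟨(1 - t) • σ + t • I, hσ.convex hId (by linarith) ht0.le (by ring), ?_, hs0, hs1, ?_⟩
  · have : (1 - t) • σ + t • I - (t * (1 / d)) • (1 : Matrix B B ℂ) = (1 - t) • σ := by
      rw [hI, smul_smul]; abel
    rw [this]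
    exact hσ.1.smul (by linarith)
  · intro x
    have h1 := Qs_concave_of_nonneg hs0 hs1 (hW x).1 hσ.1 hId.1 (sub_nonneg.2 ht1.le) ht0.le
      (by ring : (1 - t) + t = 1)
    have h2 : 0 ≤ t * Qs s (W x) I := mul_nonneg ht0.le (Qs_nonneg s (hW x).1 hId.1)
    have h3 : Real.exp (-(E + s * r + ε)) = (1 - t) * Real.exp (-(E + s * r + ε / 2)) := by
      rw [ht, sub_sub_cancel, ← Real.exp_add]; congr 1; ring
    have h4 := mul_le_mul_of_nonneg_left (hσQ x) (sub_nonneg.2 ht1.le)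
    linarith

theorem IsNode.interpolate {W : X → Matrix B B ℂ} (hW : ∀ x, IsDensity (W x)) {E r ε c s s' : ℝ}
    {σ σ' : Matrix B B ℂ} (hE : 0 ≤ E) (hε : 0 ≤ ε)
    (h : IsNode W E r (ε / 2) c s σ) (h' : IsNode W E r (ε / 2) c s' σ') (hss : s ≤ s')
    (hr' : (s' - s) * r ≤ ε / 2) {a : ℝ} (ha0 : 0 ≤ a) (ha1 : a ≤ 1) :
    IsNode W E r ε c s ((1 - a) • σ + a • σ') := by
  have ha1' : 0 ≤ 1 - a := sub_nonneg.2 ha1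
  refine ⟨h.density.convex h'.density ha1' ha0 (by ring), ?_, h.nonneg, h.le_one, fun x => ?_⟩
  · have : (1 - a) • σ + a • σ' - c • (1 : Matrix B B ℂ) =
        (1 - a) • (σ - c • (1 : Matrix B B ℂ)) + a • (σ' - c • (1 : Matrix B B ℂ)) := by
      rw [smul_sub, smul_sub, sub_add_sub_comm, ← add_smul]
      simp
    rw [this]
    exact (h.lower.smul ha1').add (h'.lower.smul ha0)
  · refine le_trans ?_ (Qs_concave_of_nonneg h.nonneg h.le_one (hW x).1 h.density.1 h'.density.1 ha1' ha0
      (by ring))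
    have h1 : Real.exp (-(E + s * r + ε)) ≤ Qs s (W x) σ :=
      (Real.exp_le_exp.2 (by linarith)).trans (h.bound x)
    have h2 : Real.exp (-(E + s * r + ε)) ≤ Qs s (W x) σ' := by
      rcases h.nonneg.eq_or_lt with h0 | h0
      · rw [← h0, Qs_zero (hW x).1 h'.density.1, (hW x).rtr_eq]
        exact Real.exp_le_one_iff.2 (by linarith)
      · exact ((Real.exp_le_exp.2 (by linarith)).trans (h'.bound x)).trans
          (Qs_anti h0 hss h'.le_one (hW x).1 h'.density)
    calc Real.exp (-(E + s * r + ε)) = (1 - a) * Real.exp (-(E + s * r + ε)) +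
          a * Real.exp (-(E + s * r + ε)) := by ring
      _ ≤ _ := add_le_add (mul_le_mul_of_nonneg_left h1 ha1') (mul_le_mul_of_nonneg_left h2 ha0)

theorem exists_path [Nonempty B] {W : X → Matrix B B ℂ} (hW : ∀ x, IsDensity (W x)) {E r : ℝ}
    (hE : 0 ≤ E) (hr : 0 ≤ r) (hopt : ∀ s, 0 < s → s ≤ 1 → ∀ ε > 0, ∃ σ, IsDensity σ ∧
      ∀ x, Real.exp (-(E + s * r + ε)) ≤ Qs s (W x) σ) {ε : ℝ} (hε : 0 < ε) :
    ∃ c, 0 < c ∧ c ≤ 1 ∧ ∀ δ > 0, ∀ η > 0, ∃ T s σ, IsPath W E r ε c δ η T s σ := by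
  obtain ⟨c, hc, hc1, hnode⟩ := exists_node hW hE hopt (half_pos hε)
  refine ⟨c, hc, hc1, fun δ hδ η hη => ?_⟩
  obtain ⟨N, hN⟩ := exists_nat_gt (1 / δ + 2 * r / ε)
  have hN0 : (0 : ℝ) < N := lt_of_le_of_lt (by positivity) hN
  have hNδ : 1 / (N : ℝ) ≤ δ := by
    have : 1 / δ < N := lt_of_le_of_lt (le_add_of_nonneg_right (by positivity)) hN
    rw [div_lt_iff₀ hδ] at this
    rw [div_le_iff₀ hN0]; linarith
  have hNr : 1 / (N : ℝ) * r ≤ ε / 2 := by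
    have : 2 * r / ε < N := lt_of_le_of_lt (le_add_of_nonneg_left (by positivity)) hN
    rw [div_lt_iff₀ hε] at this
    rw [one_div_mul_eq_div, div_le_iff₀ hN0]; linarith
  have hη' : 0 < (Real.exp η - 1) * c :=
    mul_pos (by linarith [Real.one_lt_exp_iff.2 hη]) hc
  obtain ⟨L, hL⟩ := exists_nat_gt (1 / ((Real.exp η - 1) * c))
  have hL0 : (0 : ℝ) < L := lt_of_le_of_lt (by positivity) hL
  have hL0' : 0 < L := by exact_mod_cast hL0
  have hLη : 1 / (L : ℝ) ≤ (Real.exp η - 1) * c := by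
    rw [div_lt_iff₀ hη'] at hL
    rw [div_le_iff₀ hL0]; linarith
  set t : ℕ → ℝ := fun j => min ((j : ℝ) / N) 1 with ht
  have ht0 : ∀ j, 0 ≤ t j := fun j => le_min (by positivity) zero_le_one
  have ht1 : ∀ j, t j ≤ 1 := fun j => min_le_right _ _
  have htmono : ∀ j, t j ≤ t (j + 1) := fun j => min_le_min_right _ (by
    push_cast; gcongr; linarith)
  have htstep : ∀ j, t (j + 1) - t j ≤ 1 / N := fun j => by
    have h1 : t (j + 1) ≤ (j : ℝ) / N + 1 / N := (min_le_left _ _).trans (by push_cast; rw [add_div])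
    have h2 : t (j + 1) ≤ 1 + 1 / N := (ht1 _).trans (by have := one_div_pos.2 hN0; linarith)
    have : t (j + 1) - 1 / N ≤ t j := le_min (by linarith) (by linarith)
    linarith
  choose τ hτ using fun j => hnode (t j) (ht0 j) (ht1 j)
  have hpow_int : ∀ (j : ℕ) (a : ℝ), 0 ≤ a → a ≤ 1 →
      IsNode W E r ε c (t j) ((1 - a) • τ j + a • τ (j + 1)) := fun j a ha0 ha1 =>
    (hτ j).interpolate hW hE hε.le (hτ (j + 1)) (htmono j)
      ((mul_le_mul_of_nonneg_right (htstep j) hr).trans hNr) ha0 ha1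
  set F : ℕ → ℝ → Matrix B B ℂ := fun j a => (1 - a) • τ j + a • τ (j + 1) with hF
  have hsucc : ∀ i : ℕ, (t ((i + 1) / L) = t (i / L) ∨ t ((i + 1) / L) = t (i / L + 1)) ∧
      F ((i + 1) / L) (((i + 1) % L : ℕ) / (L : ℝ)) =
        F (i / L) ((((i % L : ℕ) : ℝ) + 1) / L) := by
    intro i
    have hi := Nat.div_add_mod i L
    have hlt := Nat.mod_lt i hL0'
    set j := i / L with hj
    set u := i % L with hu
    by_cases h : u + 1 < L
    · have h1 : (i + 1) / L = j := by
        rw [← hi, add_assoc, Nat.mul_add_div hL0', Nat.div_eq_of_lt h, add_zero]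
      have h2 : (i + 1) % L = u + 1 := by
        rw [← hi, add_assoc, Nat.mul_add_mod, Nat.mod_eq_of_lt h]
      rw [h1, h2]
      refine ⟨Or.inl rfl, ?_⟩
      push_cast
      rfl
    · have h3 : u + 1 = L := by omega
      have h1 : (i + 1) / L = j + 1 := by
        rw [← hi, add_assoc, h3, Nat.mul_add_div hL0', Nat.div_self hL0']
      have h2 : (i + 1) % L = 0 := by
        rw [← hi, add_assoc, h3, Nat.mul_add_mod, Nat.mod_self]
      have h4 : ((u : ℝ) + 1) / L = 1 := by
        rw [div_eq_one_iff_eq hL0.ne']; exact_mod_cast h3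
      rw [h1, h2, h4]
      refine ⟨Or.inr rfl, ?_⟩
      simp [hF]
  have hfrac : ∀ i : ℕ, 0 ≤ ((i % L : ℕ) : ℝ) / L ∧ ((i % L : ℕ) : ℝ) / L ≤ 1 := fun i => by
    refine ⟨by positivity, ?_⟩
    rw [div_le_one hL0]
    exact_mod_cast (Nat.mod_lt i hL0').le
  refine ⟨N * L, fun i => t (i / L), fun i => F (i / L) (((i % L : ℕ) : ℝ) / L), ?_, ?_, ?_, ?_, ?_⟩
  · exact fun i _ => hpow_int _ _ (hfrac i).1 (hfrac i).2
  · simp [ht]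
  · simp only [ht]
    rw [Nat.mul_div_cancel _ hL0', div_self hN0.ne', min_self]
  · intro i _
    rw [abs_of_nonneg]
    · rcases (hsucc i).1 with h | h
      · rw [h, sub_self]; exact hδ.le
      · rw [h]; exact (htstep _).trans hNδ
    · rcases (hsucc i).1 with h | h
      · rw [h, sub_self]
      · rw [h]; exact sub_nonneg.2 (htmono _)
  · intro i _
    rw [(hsucc i).2]
    set j := i / L
    set a := ((i % L : ℕ) : ℝ) / L with ha
    have hnd := hpow_int j a (hfrac i).1 (hfrac i).2
    have h1 : F j ((((i % L : ℕ) : ℝ) + 1) / L) = F j a + (1 / (L : ℝ)) • (τ (j + 1) - τ j) := by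
      simp only [hF, add_div, ← ha]
      module
    have h2 : Real.exp η • F j a - F j ((((i % L : ℕ) : ℝ) + 1) / L) =
        (Real.exp η - 1) • (F j a - c • (1 : Matrix B B ℂ)) +
        ((Real.exp η - 1) * c - 1 / (L : ℝ)) • (1 : Matrix B B ℂ) +
        (1 / (L : ℝ)) • ((1 - τ (j + 1)) + τ j) := by
      rw [h1]
      module
    rw [h2]
    refine ((hnd.lower.smul ?_).add (Matrix.PosSemidef.one.smul ?_)).add
      (((hτ (j + 1)).density.one_sub_posSemidef.add (hτ j).density.1).smul ?_)
    · linarith [Real.one_lt_exp_iff.2 hη]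
    · linarith
    · positivity

end PathExists

section Achievability

variable {Y B : Type*} [Fintype Y] [Nonempty Y] [Fintype B] [DecidableEq B]

theorem le_one_sub_qEpsNS {V : Y → Matrix B B ℂ} (hV : ∀ y, IsDensity (V y)) {K : ℕ} (hK : 0 < K)
    {S : Fin K → Matrix B B ℂ} (hS : ∀ i, IsDensity (S i)) {M R e : ℝ}
    (hM : 2 * (K : ℝ) ≤ M) (hR : Real.exp R * (2 * K) ≤ M) (he : 0 ≤ e)
    (h : ∀ y, ∃ i, Cert (V y) (S i) R e) : Real.exp (-e) / 2 ≤ 1 - qEpsNS V M := by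
  have hK0 : (0 : ℝ) < K := by exact_mod_cast hK
  have hM0 : 0 < M := by linarith
  choose i D hD h1 h2 h3 using h
  set p : Y → ℝ := fun y => rtr (D y * V y * D y) with hp
  have hDD : ∀ y, (D y * V y * D y).PosSemidef := fun y => sandwich_posSemidef (hD y) (hV y).1
  have hp1 : ∀ y, 0 ≤ 1 - p y := fun y => sub_nonneg.2 (h1 y)
  have hp0 : ∀ y, 0 ≤ p y := fun y => rtr_nonneg (hDD y)
  set V' : Y → Matrix B B ℂ := fun y => D y * V y * D y + (1 - p y) • S (i y) with hV'
  have hV'd : ∀ y, IsDensity (V' y) := fun y => by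
    refine ⟨(hDD y).add ((hS _).1.smul (hp1 y)), ?_⟩
    rw [Matrix.trace_add, Matrix.trace_smul, (hS _).2, trace_eq_rtr (hDD y), Complex.real_smul,
      mul_one, ← Complex.ofReal_add]
    simp [hp]
  set σ : Matrix B B ℂ := (1 / (K : ℝ)) • ∑ j, S j with hσ
  have hσd : IsDensity σ := by
    refine ⟨(Matrix.posSemidef_sum _ fun j _ => (hS j).1).smul (by positivity), ?_⟩
    rw [hσ, Matrix.trace_smul, Matrix.trace_sum, Finset.sum_congr rfl fun j _ => (hS j).2,
      Finset.sum_const, Finset.card_univ, Fintype.card_fin, Complex.real_smul, nsmul_eq_mul,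
      mul_one]
    have : (K : ℂ) ≠ 0 := by exact_mod_cast hK.ne'
    push_cast
    field_simp
  have hdom : ∀ y, (M • σ - V' y).PosSemidef := fun y => by
    have e1 : ∑ j, S j = S (i y) + ∑ j ∈ Finset.univ.erase (i y), S j :=
      (Finset.add_sum_erase _ _ (Finset.mem_univ _)).symm
    have e2 : M • σ - V' y = (M / K) • (∑ j ∈ Finset.univ.erase (i y), S j) +
        ((M / K - Real.exp R - (1 - p y)) • S (i y) +
          (Real.exp R • S (i y) - D y * V y * D y)) := by
      rw [hσ, hV', e1, smul_smul, mul_one_div]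
      module
    rw [e2]
    refine ((Matrix.posSemidef_sum _ fun j _ => (hS j).1).smul (by positivity)).add
      (((hS _).1.smul ?_).add (h2 y))
    have e3 : Real.exp R ≤ M / K / 2 := by
      rw [div_div, le_div_iff₀ (by positivity)]; linarith
    have e4 : 1 ≤ M / K / 2 := by
      rw [div_div, le_div_iff₀ (by positivity)]; linarith
    linarith [hp0 y]
  have hfid : ∀ y, qPD (V y) (V' y) ≤ 1 - Real.exp (-e) / 2 := fun y => by
    have f1 : (V' y - D y * V y * D y).PosSemidef := by
      rw [hV', add_sub_cancel_left]
      exact (hS _).1.smul (hp1 y)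
    have f2 := le_qFid (hV y).1 (hV'd y).1 (hD y) f1
    have f3 : Real.exp (-e) ≤ rtr (D y * V y) ^ 2 := by
      have : Real.exp (-e) = Real.exp (-e / 2) ^ 2 := by
        rw [← Real.exp_nat_mul]; congr 1; push_cast; ring
      rw [this]
      exact pow_le_pow_left₀ (Real.exp_pos _).le (h3 y) 2
    have f4 : Real.exp (-e) ≤ 1 := Real.exp_le_one_iff.2 (by linarith)
    have f5 := Real.exp_pos (-e)
    refine Real.sqrt_le_iff.2 ⟨by linarith, ?_⟩
    nlinarith
  have : qEpsNS V M ≤ 1 - Real.exp (-e) / 2 := by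
    refine le_trans (csInf_le ⟨0, ?_⟩ ⟨V', σ, hV'd, hσd, hdom, rfl⟩) (ciSup_le hfid)
    rintro x ⟨W', τ, -, -, -, rfl⟩
    exact Real.iSup_nonneg fun x => qPD_nonneg _ _
  linarith

end Achievability

section Asymptotics

theorem eventually_log_le {a : ℝ} (ha : 0 < a) :
    ∀ᶠ n : ℕ in Filter.atTop, Real.log ((n : ℝ) + 2) ≤ a * n := by
  have h1 : Filter.Tendsto (fun n : ℕ => (n : ℝ) + 2) Filter.atTop Filter.atTop :=
    Filter.tendsto_atTop_add_const_right _ _ tendsto_natCast_atTop_atTop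
  have h2 := h1.eventually (Real.isLittleO_log_id_atTop.def (half_pos ha))
  filter_upwards [h2, Filter.eventually_ge_atTop 2] with n hn hn2
  have hn2' : (2 : ℝ) ≤ n := by exact_mod_cast hn2
  rw [Real.norm_eq_abs, id, Real.norm_eq_abs, abs_of_pos (by linarith : (0 : ℝ) < (n : ℝ) + 2)] at hn
  have := (le_abs_self _).trans hn
  nlinarith

theorem overhead_succ_le {d : ℕ} (n : ℕ) :
    overhead d (n + 1) ≤ 2 * (d + 1) * Real.log ((n : ℝ) + 2) + 2 * Real.log (1 + Real.log d) := by
  have hl := Real.log_natCast_nonneg d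
  have hn : (0 : ℝ) ≤ n := Nat.cast_nonneg n
  have h1 : Real.log ((((n + 1 : ℕ) : ℝ) + 1) ^ d * (1 + ((n + 1 : ℕ) : ℝ) * Real.log d)) ≤
      Real.log (((n : ℝ) + 2) ^ d * (((n : ℝ) + 2) * (1 + Real.log d))) := by
    apply Real.log_le_log (by positivity)
    push_cast
    have e1 : (n : ℝ) + 1 + 1 = n + 2 := by ring
    rw [e1]
    refine mul_le_mul_of_nonneg_left ?_ (by positivity)
    nlinarith
  have h2 : Real.log (((n : ℝ) + 2) ^ d * (((n : ℝ) + 2) * (1 + Real.log d))) =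
      d * Real.log ((n : ℝ) + 2) + (Real.log ((n : ℝ) + 2) + Real.log (1 + Real.log d)) := by
    rw [Real.log_mul (by positivity) (by positivity), Real.log_mul (by positivity) (by positivity),
      Real.log_pow]
  rw [h2] at h1
  unfold overhead
  linarith

theorem eventually_overhead_le (d m : ℕ) (A : ℝ) {a : ℝ} (ha : 0 < a) :
    ∀ᶠ n : ℕ in Filter.atTop, m * overhead d (n + 1) + A ≤ a * n := by
  set c1 : ℝ := m * (2 * (d + 1)) with hc1
  set c2 : ℝ := m * (2 * Real.log (1 + Real.log d)) + A with hc2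
  have hc1' : 0 ≤ c1 := by positivity
  have h1 := eventually_log_le (a := a / (2 * (c1 + 1))) (by positivity)
  have h2 : ∀ᶠ n : ℕ in Filter.atTop, 2 * c2 / a ≤ (n : ℝ) :=
    tendsto_natCast_atTop_atTop.eventually_ge_atTop _
  filter_upwards [h1, h2] with n hn1 hn2
  have h3 := mul_le_mul_of_nonneg_left (overhead_succ_le (d := d) n) (Nat.cast_nonneg (α := ℝ) m)
  rw [div_le_iff₀ ha] at hn2
  have h4 : (c1 + 1) * Real.log ((n : ℝ) + 2) ≤ a / 2 * n := by
    calc _ ≤ (c1 + 1) * (a / (2 * (c1 + 1)) * n) := mul_le_mul_of_nonneg_left hn1 (by linarith)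
      _ = _ := by field_simp
  have h5 : 0 ≤ Real.log ((n : ℝ) + 2) :=
    Real.log_nonneg (by linarith [(Nat.cast_nonneg n : (0 : ℝ) ≤ n)])
  nlinarith

theorem exists_partition (n : ℕ) {m : ℕ} (hm : 0 < m) :
    ∃ π : Fin n → Fin m, ∀ g, Fintype.card {i // π i = g} ≤ n / m + 1 := by
  set k := n / m + 1 with hk
  have hk0 : 0 < k := Nat.succ_pos _
  have hnk : n < m * k := by
    have h1 := Nat.div_add_mod n m
    have h2 := Nat.mod_lt n hm
    rw [hk, Nat.mul_add, Nat.mul_one]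
    omega
  refine ⟨fun i => ⟨i / k, Nat.div_lt_of_lt_mul (by have := i.2; rw [Nat.mul_comm]; omega)⟩,
    fun g => ?_⟩
  have hinj : Function.Injective
      (fun i : {i : Fin n // (⟨i / k, Nat.div_lt_of_lt_mul (by
        have := i.2; rw [Nat.mul_comm]; omega)⟩ : Fin m) = g} =>
        (⟨(i.1 : ℕ) % k, Nat.mod_lt _ hk0⟩ : Fin k)) := by
    intro i j hij
    have h1 : (i.1 : ℕ) % k = (j.1 : ℕ) % k := congrArg Fin.val hij
    have h2 : (i.1 : ℕ) / k = g := congrArg Fin.val i.2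
    have h3 : (j.1 : ℕ) / k = g := congrArg Fin.val j.2
    apply Subtype.ext
    apply Fin.ext
    rw [← Nat.div_add_mod (i.1 : ℕ) k, ← Nat.div_add_mod (j.1 : ℕ) k, h1, h2, h3]
  simpa using Fintype.card_le_of_injective _ hinj

theorem eventually_le_one_sub_qEpsNS {X B : Type*} [Fintype X] [Nonempty X] [Fintype B]
    [DecidableEq B] [Nonempty B] {W : X → Matrix B B ℂ} (hW : ∀ x, IsDensity (W x)) {E r : ℝ}
    (hE : 0 ≤ E) (hr : 0 < r) (hopt : ∀ s, 0 < s → s ≤ 1 → ∀ ε > 0, ∃ σ, IsDensity σ ∧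
      ∀ x, Real.exp (-(E + s * r + ε)) ≤ Qs s (W x) σ) {ε : ℝ} (hε : 0 < ε) :
    ∀ᶠ n : ℕ in Filter.atTop,
      Real.exp (-(n * (E + ε))) ≤ 1 - qEpsNS (cqPow W n) (Real.exp (n * r)) := by
  have hε8 : 0 < ε / 8 := by linarith
  obtain ⟨c, hc, hc1, hpath⟩ := exists_path hW hE hr.le hopt hε8
  set C := -Real.log c with hC
  have hC0 : 0 ≤ C := by
    rw [hC, Left.nonneg_neg_iff]; exact Real.log_nonpos hc.le hc1
  set δ := ε / 8 / (r + C) with hδ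
  have hrC : 0 < r + C := by linarith
  have hδ0 : 0 < δ := by positivity
  have hδC : δ * (r + C) = ε / 8 := div_mul_cancel₀ _ hrC.ne'
  obtain ⟨T, s, σ, hP⟩ := hpath δ hδ0 (ε / 8) hε8
  obtain ⟨m, hm⟩ := exists_nat_gt (C / (ε / 8))
  have hm0 : (0 : ℝ) < m := lt_of_le_of_lt (by positivity) hm
  have hm0' : 0 < m := by exact_mod_cast hm0
  have hCm : C / m ≤ ε / 8 := by
    rw [div_lt_iff₀ hε8] at hm
    rw [div_le_iff₀ hm0]; linarith
  set K : ℕ := T + 1 with hK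
  have hK0 : (0 : ℝ) < K := by rw [hK]; positivity
  set ℓ := Real.log (2 * K) with hℓ
  have hℓ0 : 0 ≤ ℓ := Real.log_nonneg (by
    have : (1 : ℝ) ≤ K := by rw [hK]; push_cast; linarith [(Nat.cast_nonneg T : (0 : ℝ) ≤ T)]
    linarith)
  have hlim : ∀ᶠ n : ℕ in Filter.atTop, ℓ / r ≤ (n : ℝ) :=
    tendsto_natCast_atTop_atTop.eventually_ge_atTop _
  filter_upwards [hlim, eventually_overhead_le (Fintype.card B) m (C + ℓ + Real.log 2) hε8]
    with n hn1 hn2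
  have hn0 : (0 : ℝ) ≤ n := Nat.cast_nonneg n
  obtain ⟨π, hπ⟩ := exists_partition n hm0'
  have hkn : ((n / m + 1 : ℕ) : ℝ) ≤ n / m + 1 := by
    push_cast
    exact add_le_add Nat.cast_div_le le_rfl
  have hkC : ((n / m + 1 : ℕ) : ℝ) * C ≤ n * (ε / 8) + C := by
    calc _ ≤ ((n : ℝ) / m + 1) * C := mul_le_mul_of_nonneg_right hkn hC0
      _ = n * (C / m) + C := by ring
      _ ≤ _ := add_le_add (mul_le_mul_of_nonneg_left hCm hn0) le_rfl
  have hO : overhead (Fintype.card B) (n / m + 1) ≤ overhead (Fintype.card B) (n + 1) :=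
    overhead_mono _ (Nat.succ_le_succ (Nat.div_le_self _ _))
  have hmO := mul_le_mul_of_nonneg_left hO hm0.le
  have hnε : 0 ≤ n * (ε / 8) := by positivity
  set e : ℝ := n * (E + ε) - Real.log 2 with he
  have hO0 := mul_nonneg hm0.le (overhead_nonneg (Fintype.card B) (n + 1))
  have hnE : 0 ≤ n * E := mul_nonneg hn0 hE
  have key := le_one_sub_qEpsNS (cqPow_isDensity hW n) (K := K) (Nat.succ_pos T)
    (S := fun i => ChannelSim.piT fun _ : Fin n => σ i)
    (fun i => piT_isDensity fun _ => (hP.node i (Nat.lt_succ_iff.1 i.2)).density)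
    (M := Real.exp (n * r)) (R := n * r - ℓ) (e := e) ?_ ?_ ?_ ?_
  · refine le_trans (le_of_eq ?_) key
    rw [he, neg_sub, sub_eq_add_neg, Real.exp_add, Real.exp_log (by norm_num)]
    ring
  · rw [← Real.exp_log (by positivity : (0 : ℝ) < 2 * K)]
    rw [div_le_iff₀ hr] at hn1
    exact Real.exp_le_exp.2 hn1
  · refine le_of_eq ?_
    rw [Real.exp_sub, hℓ, Real.exp_log (by positivity : (0 : ℝ) < 2 * K)]
    field_simp
  · rw [he]
    nlinarith
  · intro w
    obtain ⟨i, hi, hcert⟩ := hP.exists_cert hW hr.le hc hc1 hδ0.le hε8.le w π hπ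
    refine ⟨⟨i, Nat.lt_succ_of_le hi⟩, ?_⟩
    have hsc := hcert.scale (piT_posSemidef fun j => (hW _).1) (c := n * (ε / 8) + ℓ)
      (by linarith)
    refine hsc.mono (piT_posSemidef fun _ => (hP.node i hi).density.1) (by linarith) ?_
    rw [hδC, he]
    nlinarith

end Asymptotics

section Exponent

variable {X B : Type*} [Fintype X] [Nonempty X] [Fintype B] [DecidableEq B]

theorem Qs_le_one {s : ℝ} (hs0 : 0 < s) (hs1 : s ≤ 1) {ρ σ : Matrix B B ℂ} (hρ : IsDensity ρ)
    (hσ : IsDensity σ) : Qs s ρ σ ≤ 1 := by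
  have h0 : 0 ≤ Qs 1 ρ σ := Qs_nonneg 1 hρ.1 hσ.1
  have h1 : Qs 1 ρ σ ≤ 1 := by
    by_contra! hcon
    have h2 := (Qs_anti (by norm_num : (0 : ℝ) < 1 / 2) (by norm_num) le_rfl hρ.1 hσ).trans
      (Qs_le_rpow (by norm_num) (by norm_num) hρ hσ.1)
    have h3 := Real.rpow_lt_rpow_of_exponent_lt hcon (by norm_num : (1 / 2 : ℝ) < 1)
    rw [Real.rpow_one] at h3
    linarith
  rcases hs1.eq_or_lt with rfl | hs1
  · exact h1
  · exact (Qs_le_rpow hs0 hs1 hρ hσ.1).trans (Real.rpow_le_one h0 h1 hs0.le)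

theorem sandD_eq_top {α : ℝ} (hα1 : α < 1) {ρ σ : Matrix B B ℂ} (h : ρ * σ = 0) :
    sandD α ρ σ = ⊤ := by
  rw [sandD, if_neg hα1.ne, if_pos (Or.inr ⟨hα1, h⟩)]

theorem sandD_eq_log {α : ℝ} (hα0 : 0 < α) (hα1 : α < 1) {ρ σ : Matrix B B ℂ}
    (hρ : ρ.PosSemidef) (hσ : σ.PosSemidef) (h : ρ * σ ≠ 0) :
    sandD α ρ σ = ((-(α / (1 - α)) * Real.log (Qs ((1 - α) / α) ρ σ) : ℝ) : EReal) := by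
  rw [sandD, if_neg hα1.ne, if_neg (by rintro (h' | h'); exacts [not_lt.2 hα1.le h'.1, h h'.2])]
  congr 1
  have e1 : (1 - α) / (2 * α) = (1 - α) / α / 2 := by rw [div_div, mul_comm]
  have e2 : 1 / (1 + (1 - α) / α) = α := by field_simp; ring
  have e3 : 1 + (1 - α) / α = 1 / α := by field_simp; ring
  rw [e1]
  change (α - 1)⁻¹ * Real.log (rtr (pw α (pw ((1 - α) / α / 2) σ * ρ * pw ((1 - α) / α / 2) σ))) = _
  have hQ : Qs ((1 - α) / α) ρ σ =
      rtr (pw α (pw ((1 - α) / α / 2) σ * ρ * pw ((1 - α) / α / 2) σ)) ^ (1 / α) := by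
    rw [Qs, nQ, e2, e3]
  have hQpos := Qs_pos (div_pos (by linarith : 0 < 1 - α) hα0) hρ hσ h
  set t := rtr (pw α (pw ((1 - α) / α / 2) σ * ρ * pw ((1 - α) / α / 2) σ)) with ht
  have ht0 : 0 ≤ t := rtr_nonneg (pw_posSemidef _ (sandwich_posSemidef (pw_posSemidef _ hσ) hρ))
  have ht1 : 0 < t := by
    refine ht0.lt_of_ne fun h0 => ?_
    rw [hQ, ← h0, Real.zero_rpow (one_div_pos.2 hα0).ne'] at hQpos
    exact lt_irrefl _ hQpos
  rw [hQ, Real.log_rpow ht1]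
  have h1 : 1 - α ≠ 0 := by linarith
  have h2 : α - 1 ≠ 0 := by linarith
  field_simp
  ring

theorem sandD_nonneg {α : ℝ} (hα0 : 1 / 2 ≤ α) (hα1 : α < 1) {ρ σ : Matrix B B ℂ}
    (hρ : IsDensity ρ) (hσ : IsDensity σ) : 0 ≤ sandD α ρ σ := by
  by_cases h : ρ * σ = 0
  · rw [sandD_eq_top hα1 h]; exact le_top
  · have hα : 0 < α := by linarith
    rw [sandD_eq_log hα hα1 hρ.1 hσ.1 h]
    have hs0 : 0 < (1 - α) / α := div_pos (by linarith) hα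
    have hs1 : (1 - α) / α ≤ 1 := by rw [div_le_one hα]; linarith
    have h1 := Real.log_nonpos (Qs_nonneg ((1 - α) / α) hρ.1 hσ.1) (Qs_le_one hs0 hs1 hρ hσ)
    have h2 : 0 ≤ α / (1 - α) := div_nonneg hα.le (by linarith)
    exact_mod_cast (by nlinarith : 0 ≤ -(α / (1 - α)) * Real.log (Qs ((1 - α) / α) ρ σ))

theorem mul_maximallyMixed_ne_zero [Nonempty B] {ρ : Matrix B B ℂ} (hρ : IsDensity ρ) :
    ρ * ((1 / (Fintype.card B : ℝ)) • (1 : Matrix B B ℂ)) ≠ 0 := by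
  intro h
  rw [Matrix.mul_smul, mul_one] at h
  have hc : (1 / (Fintype.card B : ℝ)) ≠ 0 := by
    have : (0 : ℝ) < Fintype.card B := by exact_mod_cast Fintype.card_pos
    positivity
  have := hρ.2
  rw [(smul_eq_zero.1 h).resolve_left hc] at this
  simp at this

theorem exists_sandMI_bound [Nonempty B] {W : X → Matrix B B ℂ} (hW : ∀ x, IsDensity (W x)) :
    ∃ b : ℝ, ∀ α, 1 / 2 ≤ α → α < 1 → ∃ v : ℝ, sandMI α W = (v : EReal) ∧ 0 ≤ v ∧
      (1 - α) / α * v ≤ b := by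
  set I : Matrix B B ℂ := (1 / (Fintype.card B : ℝ)) • (1 : Matrix B B ℂ) with hI
  have hId : IsDensity I := isDensity_maximallyMixed
  refine ⟨∑ x, -Real.log (Qs 1 (W x) I), fun α hα0 hα1 => ?_⟩
  set b := ∑ x, -Real.log (Qs 1 (W x) I) with hb
  have hα : 0 < α := by linarith
  have hs0 : 0 < (1 - α) / α := div_pos (by linarith) hα
  have hs1 : (1 - α) / α ≤ 1 := by rw [div_le_one hα]; linarith
  have h1 : sandMI α W ≤ ((α / (1 - α) * b : ℝ) : EReal) := by
    refine (iInf_le _ (⟨I, hId⟩ : {σ : Matrix B B ℂ // IsDensity σ})).trans (iSup_le fun x => ?_)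
    rw [sandD_eq_log hα hα1 (hW x).1 hId.1 (mul_maximallyMixed_ne_zero (hW x))]
    rw [EReal.coe_le_coe_iff, neg_mul, ← mul_neg]
    refine mul_le_mul_of_nonneg_left ?_ (div_nonneg hα.le (by linarith))
    have h2 : ∀ y, 0 ≤ -Real.log (Qs 1 (W y) I) := fun y => by
      rw [Left.nonneg_neg_iff]
      exact Real.log_nonpos (Qs_nonneg 1 (hW y).1 hId.1) (Qs_le_one one_pos le_rfl (hW y) hId)
    refine le_trans ?_ (Finset.single_le_sum (fun y _ => h2 y) (Finset.mem_univ x))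
    rw [neg_le_neg_iff]
    exact Real.log_le_log (Qs_pos one_pos (hW x).1 hId.1 (mul_maximallyMixed_ne_zero (hW x)))
      (Qs_anti hs0 hs1 le_rfl (hW x).1 hId)
  have h0 : 0 ≤ sandMI α W := le_iInf fun σ =>
    (sandD_nonneg hα0 hα1 (hW (Classical.arbitrary X)) σ.2).trans
      (le_iSup (fun x => sandD α (W x) σ.1) (Classical.arbitrary X))
  have hne_top : sandMI α W ≠ ⊤ := fun h => by
    rw [h] at h1; exact not_le.2 (EReal.coe_lt_top _) h1
  have hne_bot : sandMI α W ≠ ⊥ := fun h => by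
    rw [h] at h0; exact not_le.2 EReal.bot_lt_zero h0
  have hv : sandMI α W = ((sandMI α W).toReal : EReal) := (EReal.coe_toReal hne_top hne_bot).symm
  refine ⟨(sandMI α W).toReal, hv, EReal.toReal_nonneg h0, ?_⟩
  rw [hv, EReal.coe_le_coe_iff] at h1
  have h3 := mul_le_mul_of_nonneg_left h1 hs0.le
  have h4 : (1 - α) / α * (α / (1 - α) * b) = b := by
    have : 1 - α ≠ 0 := by linarith
    field_simp
  linarith

theorem exists_near_opt {W : X → Matrix B B ℂ} (hW : ∀ x, IsDensity (W x)) {α v : ℝ}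
    (hα0 : 0 < α) (hα1 : α < 1) (hv : sandMI α W = (v : EReal)) {ε : ℝ} (hε : 0 < ε) :
    ∃ σ, IsDensity σ ∧ ∀ x, Real.exp (-((1 - α) / α * v + ε)) ≤ Qs ((1 - α) / α) (W x) σ := by
  have h1α : 0 < 1 - α := by linarith
  have hs0 : 0 < (1 - α) / α := div_pos h1α hα0
  have hlt : sandMI α W < ((v + ε * (α / (1 - α)) : ℝ) : EReal) := by
    rw [hv, EReal.coe_lt_coe_iff]
    have : 0 < ε * (α / (1 - α)) := by positivity
    linarith
  obtain ⟨⟨σ, hσ⟩, hlt⟩ := iInf_lt_iff.1 hlt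
  refine ⟨σ, hσ, fun x => ?_⟩
  have hx := (le_iSup (fun x => sandD α (W x) σ) x).trans hlt.le
  by_cases h : W x * σ = 0
  · simp only [sandD_eq_top hα1 h] at hx
    exact absurd hx (not_le.2 (EReal.coe_lt_top _))
  · simp only [sandD_eq_log hα0 hα1 (hW x).1 hσ.1 h] at hx
    rw [EReal.coe_le_coe_iff] at hx
    rw [← Real.le_log_iff_exp_le (Qs_pos hs0 (hW x).1 hσ.1 h)]
    have h3 := mul_le_mul_of_nonneg_left hx hs0.le
    have h4 : (1 - α) / α * (-(α / (1 - α)) * Real.log (Qs ((1 - α) / α) (W x) σ)) =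
        -Real.log (Qs ((1 - α) / α) (W x) σ) := by
      field_simp
    have h5 : (1 - α) / α * (v + ε * (α / (1 - α))) = (1 - α) / α * v + ε := by
      field_simp
    linarith

theorem exists_Qs_lt {W : X → Matrix B B ℂ} (hW : ∀ x, IsDensity (W x)) {α v : ℝ}
    (hα0 : 0 < α) (hα1 : α < 1) (hv : sandMI α W = (v : EReal)) {ε : ℝ} (hε : 0 < ε)
    {σ : Matrix B B ℂ} (hσ : IsDensity σ) :
    ∃ x, Qs ((1 - α) / α) (W x) σ < Real.exp (-((1 - α) / α * v - ε)) := by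
  have h1α : 0 < 1 - α := by linarith
  have hs0 : 0 < (1 - α) / α := div_pos h1α hα0
  have hlt : ((v - ε * (α / (1 - α)) : ℝ) : EReal) < ⨆ x, sandD α (W x) σ := by
    refine lt_of_lt_of_le ?_ (iInf_le (fun σ : {σ : Matrix B B ℂ // IsDensity σ} =>
      ⨆ x, sandD α (W x) σ.1) ⟨σ, hσ⟩)
    change _ < sandMI α W
    rw [hv, EReal.coe_lt_coe_iff]
    have : 0 < ε * (α / (1 - α)) := by positivity
    linarith
  obtain ⟨x, hx⟩ := lt_iSup_iff.1 hlt
  refine ⟨x, ?_⟩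
  by_cases h : W x * σ = 0
  · rw [Qs_eq_zero hs0 hσ.1 h]
    exact Real.exp_pos _
  · rw [sandD_eq_log hα0 hα1 (hW x).1 hσ.1 h, EReal.coe_lt_coe_iff] at hx
    rw [← Real.log_lt_iff_lt_exp (Qs_pos hs0 (hW x).1 hσ.1 h)]
    have h3 := mul_lt_mul_of_pos_left hx hs0
    have h4 : (1 - α) / α * (-(α / (1 - α)) * Real.log (Qs ((1 - α) / α) (W x) σ)) =
        -Real.log (Qs ((1 - α) / α) (W x) σ) := by
      field_simp
    have h5 : (1 - α) / α * (v - ε * (α / (1 - α))) = (1 - α) / α * v - ε := by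
      field_simp
    linarith

theorem one_sub_qEpsNS_cqPow_le_exp [Nonempty B] {W : X → Matrix B B ℂ}
    (hW : ∀ x, IsDensity (W x)) {r : ℝ} (hr : 0 < r) {α : ℝ} (hα0 : 1 / 2 ≤ α) (hα1 : α ≤ 1)
    {ε : ℝ} (hε : 0 < ε) (n : ℕ) :
    1 - qEpsNS (cqPow W n) (Real.exp (n * r)) ≤
      Real.exp (-(n * ((1 - α) / α * ((sandMI α W).toReal - r) - ε))) := by
  have hn0 : (0 : ℝ) ≤ n := Nat.cast_nonneg n
  rcases hα1.eq_or_lt with rfl | hα1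
  · have h1 := qEpsNS_nonneg (cqPow W n) (Real.exp (n * r))
    have h2 : (1 : ℝ) ≤ Real.exp (-(n * ((1 - 1) / 1 * ((sandMI 1 W).toReal - r) - ε))) := by
      refine Real.one_le_exp ?_
      have : 0 ≤ n * ε := mul_nonneg hn0 hε.le
      linarith
    linarith
  have hα : 0 < α := by linarith
  have hM : 1 ≤ Real.exp (n * r) := Real.one_le_exp (mul_nonneg hn0 hr.le)
  obtain ⟨b, hb⟩ := exists_sandMI_bound hW
  obtain ⟨v, hv, -, -⟩ := hb α hα0 hα1
  rw [hv, EReal.toReal_coe]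
  have hs0 : 0 < (1 - α) / α := div_pos (by linarith) hα
  rcases hα0.eq_or_lt with rfl | hα0
  · have e1 : (1 - 1 / 2) / (1 / 2) = (1 : ℝ) := by norm_num
    set u := v - ε / 2 - r with hu
    set t := min (1 / 2) (ε / 2 / (|u| + 1)) with ht
    have ht0 : 0 < t := lt_min (by norm_num) (by positivity)
    have ht1 : t ≤ 1 / 2 := min_le_left _ _
    have ht2 : t * u ≤ ε / 2 := by
      have h1 : t * (|u| + 1) ≤ ε / 2 := by
        rw [← le_div_iff₀ (by positivity)]; exact min_le_right _ _
      have h2 := mul_le_mul_of_nonneg_left (le_abs_self u) ht0.le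
      linarith
    have hs1 : 0 < 1 - t := by linarith
    have key := one_sub_qEpsNS_cqPow_le hW (s := 1 - t) hs1 (by linarith)
      (c := Real.exp (-(v - ε / 2)) ^ (1 - t)) (Real.rpow_pos_of_pos (Real.exp_pos _) _)
      (fun σ hσ => by
        obtain ⟨x, hx⟩ := exists_Qs_lt hW hα hα1 hv (half_pos hε) hσ
        rw [e1, one_mul] at hx
        exact ⟨x, (Qs_le_rpow hs1 (by linarith) (hW x) hσ.1).trans_lt
          (Real.rpow_lt_rpow (Qs_nonneg 1 (hW x).1 hσ.1) hx hs1)⟩) n hM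
    refine key.trans ?_
    rw [← Real.exp_mul, ← Real.exp_mul, ← Real.exp_nat_mul, ← Real.exp_add, e1, one_mul]
    refine Real.exp_le_exp.2 ?_
    have : n * (t * u) ≤ n * (ε / 2) := mul_le_mul_of_nonneg_left ht2 hn0
    rw [hu] at this
    nlinarith
  · have hs1 : (1 - α) / α < 1 := by rw [div_lt_one hα]; linarith
    refine (one_sub_qEpsNS_cqPow_le hW hs0 hs1 (Real.exp_pos _)
      (fun σ hσ => exists_Qs_lt hW hα hα1 hv hε hσ) n hM).trans (le_of_eq ?_)
    rw [← Real.exp_mul, ← Real.exp_nat_mul, ← Real.exp_add]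
    congr 1
    ring

end Exponent

end ChannelSim

open ChannelSim in
/-- exact strong converse exponent for non-signaling assisted classical-quantum
channel simulation. -/
theorem statement7 {X : Type*} [Fintype X] [Nonempty X] {d : ℕ}
    (W : X → Matrix (Fin d) (Fin d) ℂ) (hW : ∀ x, IsDensity (W x))
    (r : ℝ) (hr : 0 < r) :
    Filter.Tendsto
      (fun n : ℕ => -(1 / (n : ℝ)) *
        Real.log (1 - qEpsNS (cqPow W n) (Real.exp (n * r)))) Filter.atTop
      (nhds (⨆ α : {a : ℝ // 1 / 2 ≤ a ∧ a ≤ 1},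
        ((1 - α.1) / α.1) * ((sandMI α.1 W).toReal - r))) := by
  have hd : Nonempty (Fin d) := by
    by_contra hcon
    rw [not_nonempty_iff] at hcon
    have := (hW (Classical.arbitrary X)).2
    rw [Matrix.trace, Fintype.sum_empty] at this
    exact zero_ne_one this
  set f : {a : ℝ // 1 / 2 ≤ a ∧ a ≤ 1} → ℝ := fun α =>
    ((1 - α.1) / α.1) * ((sandMI α.1 W).toReal - r) with hf
  obtain ⟨b, hb⟩ := exists_sandMI_bound hW
  have hbdd : BddAbove (Set.range f) := by
    refine ⟨max b 0, ?_⟩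
    rintro _ ⟨⟨α, hα0, hα1⟩, rfl⟩
    rcases hα1.eq_or_lt with rfl | hα1
    · simp [hf]
    · obtain ⟨v, hv, -, hvb⟩ := hb α hα0 hα1
      refine le_max_of_le_left ?_
      simp only [hf, hv, EReal.toReal_coe]
      have : 0 ≤ (1 - α) / α * r :=
        mul_nonneg (div_nonneg (by linarith) (by linarith)) hr.le
      linarith
  set E : ℝ := ⨆ α, f α with hE
  have hE0 : 0 ≤ E := by
    have h1 : f ⟨1, by norm_num, le_rfl⟩ ≤ E := le_ciSup hbdd _
    simpa [hf] using h1
  have hopt : ∀ s, 0 < s → s ≤ 1 → ∀ ε > 0, ∃ σ, IsDensity σ ∧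
      ∀ x, Real.exp (-(E + s * r + ε)) ≤ Qs s (W x) σ := by
    intro s hs0 hs1 ε hε
    have hα0 : 1 / 2 ≤ 1 / (1 + s) := one_div_le_one_div_of_le (by linarith) (by linarith)
    have hα1 : 1 / (1 + s) < 1 := by rw [div_lt_one (by linarith)]; linarith
    have hsα : (1 - 1 / (1 + s)) / (1 / (1 + s)) = s := by field_simp; ring
    obtain ⟨v, hv, -, -⟩ := hb _ hα0 hα1
    obtain ⟨σ, hσ, hσQ⟩ := exists_near_opt hW (by linarith) hα1 hv hε
    rw [hsα] at hσQ
    refine ⟨σ, hσ, fun x => le_trans (Real.exp_le_exp.2 ?_) (hσQ x)⟩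
    have h1 : f ⟨1 / (1 + s), hα0, hα1.le⟩ ≤ E := le_ciSup hbdd _
    simp only [hf, hv, EReal.toReal_coe, hsα] at h1
    linarith
  rw [Metric.tendsto_atTop']
  intro ε hε
  have hne : Nonempty {a : ℝ // 1 / 2 ≤ a ∧ a ≤ 1} := ⟨⟨1, by norm_num, le_rfl⟩⟩
  obtain ⟨α, hα⟩ := exists_lt_of_lt_ciSup (show E - ε / 4 < ⨆ α, f α by rw [← hE]; linarith)
  obtain ⟨N, hN⟩ := Filter.eventually_atTop.1
    (eventually_le_one_sub_qEpsNS hW hE0 hr hopt (half_pos hε))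
  refine ⟨N, fun n hn => ?_⟩
  have hn0 : (0 : ℝ) < n := by exact_mod_cast (Nat.zero_le N).trans_lt hn
  have h1 := hN n hn.le
  have h2 := one_sub_qEpsNS_cqPow_le_exp hW hr α.2.1 α.2.2 (ε := ε / 4) (by linarith) n
  set x := 1 - qEpsNS (cqPow W n) (Real.exp (n * r)) with hx
  have hx0 : 0 < x := (Real.exp_pos _).trans_le h1
  have h3 := (Real.le_log_iff_exp_le hx0).2 h1
  have h4 := (Real.log_le_iff_le_exp hx0).2 h2
  change E - ε / 4 < (1 - α.1) / α.1 * ((sandMI α.1 W).toReal - r) at hα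
  have h5 : -(1 / (n : ℝ)) * Real.log x = -Real.log x / n := by ring
  rw [Real.dist_eq, abs_lt, h5]
  constructor
  · rw [lt_sub_iff_add_lt, lt_div_iff₀ hn0]
    nlinarith
  · rw [sub_lt_iff_lt_add, div_lt_iff₀ hn0]
    nlinarith
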